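/- Assume V⁺ ∈ L¹ and assumption (i): ℙ{V(ω,z) ≥ 0} = 1 for all z ∈ R₀ and there exists c ∈ ℝ with ℙ{V(ω,z) ≥ c} = 1 for all z ∈ R∖R₀. Fix a face A ≠ {0} of C₊, let R' = R ∩ A, assume V⁺(·,z) ∈ L_{z,R'} for each z ∈ R'∖{0} and V⁺(·,0) ∈ L_{ẑ,R'} for some ẑ ∈ R'∖{0}, and assume ℙ is ergodic under {T_z : z ∈ R ∩ A}. Let α be the deterministic function on relint A characterized by α(ξ) = lim_{n→∞} a(0,x_n)/n ℙ-a.s. for every sequence x_n ∈ G₊ ∩ A with x_n/n → ξ. Then for every ξ ∈ relint A and every representation ξ = Σ_{z∈R'} γ_z z with γ_z ∈ ℝ₊: α(ξ) = sup over B ∈ K⁺_A(V) of (− Σ_{z∈R'} γ_z E[B(·,0,z)]), and moreover there exists B ∈ K⁺_A(V) attaining this supremum, i.e. α(ξ) = − Σ_{z∈R'} γ_z E[B(·,0,z)]. -/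

import Mathlib

open MeasureTheory Filter Set
open scoped ENNReal NNReal Classical Topology

noncomputable section

namespace RWRP

abbrev Zd (d : ℕ) := Fin d → ℤ

variable {d : ℕ} {Ω : Type*} {Γ : Type*}

/-- Embedding of `ℤ^d` into `ℝ^d`. -/
def toR (x : Zd d) : Fin d → ℝ := fun i => (x i : ℝ)

/-- The `ℓ¹` norm on `ℝ^d`. -/
def n1 (ξ : Fin d → ℝ) : ℝ := ∑ i, |ξ i|

/-- The `ℓ¹` norm of a lattice point. -/
def n1Z (x : Zd d) : ℝ := n1 (toR x)

/-- `G₊`: the additive semigroup (ℤ₊-combinations) generated by the step set. -/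
def Gp (R : Finset (Zd d)) : Set (Zd d) := {x | ∃ b : Zd d → ℕ, x = ∑ z ∈ R, b z • z}

/-- `G(R')`: the additive group (ℤ-combinations) generated by `R'`. -/
def GZ (R : Finset (Zd d)) : Set (Zd d) := {x | ∃ b : Zd d → ℤ, x = ∑ z ∈ R, b z • z}

/-- ℤ₊-combinations of elements of a set of lattice points. -/
def GpS (S : Set (Zd d)) : Set (Zd d) :=
  {x | ∃ (m : ℕ) (c : Fin m → Zd d), (∀ i, c i ∈ S) ∧ x = ∑ i, c i}

/-- `C₊`: the real cone generated by the step set. -/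
def Cp (R : Finset (Zd d)) : Set (Fin d → ℝ) :=
  {ξ | ∃ b : Zd d → ℝ, (∀ z, 0 ≤ b z) ∧ ξ = ∑ z ∈ R, b z • toR z}

/-- `C'₊`: the rational cone generated by the step set. -/
def CpQ (R : Finset (Zd d)) : Set (Fin d → ℝ) :=
  {ξ | ∃ b : Zd d → ℚ, (∀ z, 0 ≤ b z) ∧ ξ = ∑ z ∈ R, (b z : ℝ) • toR z}

/-- `A` is a face of the convex set `K`. -/
def IsFace (K A : Set (Fin d → ℝ)) : Prop :=
  A ⊆ K ∧ Convex ℝ A ∧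
    ∀ ⦃ξ ζ η : Fin d → ℝ⦄ ⦃t : ℝ⦄, ξ ∈ A → ζ ∈ K → η ∈ K → t ∈ Set.Ioo (0:ℝ) 1 →
      ξ = t • ζ + (1 - t) • η → ζ ∈ A ∧ η ∈ A

/-- `U`: the convex hull of the step set. -/
def hullU (R : Finset (Zd d)) : Set (Fin d → ℝ) := convexHull ℝ (toR '' (R : Set (Zd d)))

/-- `U₀` is the face of `U` containing `0` in its relative interior (the empty set if `0 ∉ U`). -/
def IsZeroFace (R : Finset (Zd d)) (U₀ : Set (Fin d → ℝ)) : Prop :=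
  ((0 : Fin d → ℝ) ∈ hullU R ∧ IsFace (hullU R) U₀ ∧
    (0 : Fin d → ℝ) ∈ intrinsicInterior ℝ U₀) ∨
  ((0 : Fin d → ℝ) ∉ hullU R ∧ U₀ = ∅)

/-- `R₀ = R ∩ U₀`. -/
def R0 (R : Finset (Zd d)) (U₀ : Set (Fin d → ℝ)) : Set (Zd d) := {z | z ∈ R ∧ toR z ∈ U₀}

/-- `A_δ`: the directions in the face `A` at ℓ¹ distance `≥ δ` (after normalization) from the
relative boundary of `A`. -/
def faceDelta (A : Set (Fin d → ℝ)) (δ : ℝ) : Set (Fin d → ℝ) :=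
  {ξ | ξ ∈ A ∧ ξ ≠ 0 ∧
    ENNReal.ofReal δ ≤ ⨅ (η : Fin d → ℝ) (_ : η ∈ A \ intrinsicInterior ℝ A),
      ENNReal.ofReal (n1 ((n1 ξ)⁻¹ • ξ - η))}

/-- `U'_δ = {ξ ∈ U' : dist(ξ, U' ∖ relint Uall) ≥ δ}`. -/
def faceDeltaU (Uall U' : Set (Fin d → ℝ)) (δ : ℝ) : Set (Fin d → ℝ) :=
  {ξ | ξ ∈ U' ∧
    ENNReal.ofReal δ ≤ ⨅ (η : Fin d → ℝ) (_ : η ∈ U' \ intrinsicInterior ℝ Uall),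
      ENNReal.ofReal (n1 (ξ - η))}

/-- `D_n`: points reachable in exactly `n` admissible steps (counted with multiplicities). -/
def Dn (R : Finset (Zd d)) (n : ℕ) : Set (Zd d) :=
  {x | ∃ b : Zd d → ℕ, (∑ z ∈ R, b z) = n ∧ x = ∑ z ∈ R, b z • z}

/-- Position after `k` steps of the path with increments `f`, started at `x`. -/
def pos (x : Zd d) (f : ℕ → Zd d) (k : ℕ) : Zd d := x + ∑ i ∈ Finset.range k, f i

/-- Convert a finite tuple of admissible steps to an increment sequence. -/
def stepF {R : Finset (Zd d)} (n : ℕ) (s : Fin n → {z : Zd d // z ∈ R}) : ℕ → Zd d :=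
  fun i => if h : i < n then (s ⟨i, h⟩ : Zd d) else 0

/-- The path started at `x` with increments `f` hits `y` for the first time (after time `0`)
at time `n`. -/
def firstHit (x y : Zd d) (n : ℕ) (f : ℕ → Zd d) : Prop :=
  pos x f n = y ∧ ∀ k ∈ Finset.Ioo 0 n, pos x f k ≠ y

/-- Probability weight of a tuple of steps under the random walk kernel `p`. -/
def pathW (p : Zd d → ℝ) {R : Finset (Zd d)} {n : ℕ} (s : Fin n → {z : Zd d // z ∈ R}) : ℝ≥0∞ :=
  ∏ i, ENNReal.ofReal (p (s i : Zd d))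

/-- Total potential collected along the first `n` steps of a path. -/
def pathV (T : Zd d → Ω → Ω) (V : Ω → Zd d → ℝ) (ω : Ω) (x : Zd d) (n : ℕ)
    (f : ℕ → Zd d) : ℝ :=
  ∑ i ∈ Finset.range n, V (T (pos x f i) ω) (f i)

/-- `E_x[exp(-∑_{k<τ_y} V(T_{X_k}ω, Z_{k+1})) 1{τ_y < ∞}]`, as a sum over killed paths. -/
def walkK (T : Zd d → Ω → Ω) (V : Ω → Zd d → ℝ) (p : Zd d → ℝ) (R : Finset (Zd d))
    (ω : Ω) (x y : Zd d) : ℝ≥0∞ :=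
  ∑' n : ℕ, ∑ s : Fin (n+1) → {z : Zd d // z ∈ R},
    if firstHit x y (n+1) (stepF (n+1) s) then
      pathW p s * ENNReal.ofReal (Real.exp (-(pathV T V ω x (n+1) (stepF (n+1) s))))
    else 0

/-- The point-to-point quantity `a(ω,x,y)` (real-valued version, with junk values where the
underlying expectation is `0` or `∞`). -/
def aFun (T : Zd d → Ω → Ω) (V : Ω → Zd d → ℝ) (p : Zd d → ℝ) (R : Finset (Zd d))
    (ω : Ω) (x y : Zd d) : ℝ :=
  if y = x then 0 else - Real.log ((walkK T V p R ω x y).toReal)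

/-- The point-to-point quantity `a(ω,x,y)` with values in `[-∞,∞]`. -/
def aE (T : Zd d → Ω → Ω) (V : Ω → Zd d → ℝ) (p : Zd d → ℝ) (R : Finset (Zd d))
    (ω : Ω) (x y : Zd d) : EReal :=
  if y = x then (0 : EReal) else - (ENNReal.log (walkK T V p R ω x y))

/-- The zero-temperature quantity `a_∞(ω,x,y)`: the infimum of the total potential over
admissible paths from `x` to `y` that hit `y` for the first time at their last step. -/
def aInf (T : Zd d → Ω → Ω) (V : Ω → Zd d → ℝ) (R : Finset (Zd d))
    (ω : Ω) (x y : Zd d) : ℝ :=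
  if y = x then 0 else
    sInf {v : ℝ | ∃ n : ℕ, ∃ s : Fin (n+1) → {z : Zd d // z ∈ R},
      firstHit x y (n+1) (stepF (n+1) s) ∧ v = pathV T V ω x (n+1) (stepF (n+1) s)}

/-- The Green's function `g(ω,x,y)`, with values in `[0,∞]`. -/
def greenK (T : Zd d → Ω → Ω) (V : Ω → Zd d → ℝ) (p : Zd d → ℝ) (R : Finset (Zd d))
    (ω : Ω) (x y : Zd d) : ℝ≥0∞ :=
  (if y = x then 1 else 0) +
  ∑' n : ℕ, ∑ s : Fin (n+1) → {z : Zd d // z ∈ R},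
    if pos x (stepF (n+1) s) (n+1) = y then
      pathW p s * ENNReal.ofReal (Real.exp (-(pathV T V ω x (n+1) (stepF (n+1) s))))
    else 0

/-- `E_x[exp(-∑_{k<n} V) 1{X_n = y}]`: the restricted-length partition function. -/
def resK (T : Zd d → Ω → Ω) (V : Ω → Zd d → ℝ) (p : Zd d → ℝ) (R : Finset (Zd d))
    (ω : Ω) (n : ℕ) (x y : Zd d) : ℝ≥0∞ :=
  ∑ s : Fin n → {z : Zd d // z ∈ R},
    if pos x (stepF n s) n = y then
      pathW p s * ENNReal.ofReal (Real.exp (-(pathV T V ω x n (stepF n s))))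
    else 0

/-- `G_{x,(n),y} = log E_x[exp(-∑_{k<n} V) 1{X_n = y}]`. -/
def GRes (T : Zd d → Ω → Ω) (V : Ω → Zd d → ℝ) (p : Zd d → ℝ) (R : Finset (Zd d))
    (ω : Ω) (n : ℕ) (x y : Zd d) : ℝ :=
  Real.log ((resK T V p R ω n x y).toReal)

/-- The return probability `P₀(τ₀ < ∞)` of the reference walk. -/
def retP (p : Zd d → ℝ) (R : Finset (Zd d)) : ℝ≥0∞ :=
  ∑' n : ℕ, ∑ s : Fin (n+1) → {z : Zd d // z ∈ R},
    if firstHit (0 : Zd d) 0 (n+1) (stepF (n+1) s) then pathW p s else 0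

/-- `R_ε`: the ℓ¹-distance from the origin to the nearest point `x` of `G₊(S)` with
`V(T_x ω, z) ≥ ε` for some `z ∈ S`, as an element of `[0,∞]`. -/
def Reps (T : Zd d → Ω → Ω) (V : Ω → Zd d → ℝ) (S : Set (Zd d)) (ε : ℝ) (ω : Ω) : ℝ≥0∞ :=
  ⨅ (x : Zd d) (_ : x ∈ GpS S ∧ ∃ z ∈ S, ε ≤ V (T x ω) z), ENNReal.ofReal (n1Z x)

/-- The shift maps on a product space. -/
def shiftT (z : Zd d) (ω : Zd d → Γ) : Zd d → Γ := fun y => ω (z + y)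

/-- A function is locally Lipschitz (w.r.t. the ℓ¹ norm) on a set. -/
def LocLipOn (f : (Fin d → ℝ) → ℝ) (S : Set (Fin d → ℝ)) : Prop :=
  ∀ ξ ∈ S, ∃ K ε : ℝ, 0 < ε ∧ ∀ x ∈ S, ∀ y ∈ S,
    n1 (x - ξ) < ε → n1 (y - ξ) < ε → |f x - f y| ≤ K * n1 (x - y)

section measurable

variable [MeasurableSpace Ω]

/-- The σ-algebra of measurable sets invariant under the shifts `{T_z : z ∈ S}`. -/
def invSigma (T : Zd d → Ω → Ω) (S : Set (Zd d)) : MeasurableSpace Ω where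
  MeasurableSet' A := MeasurableSet A ∧ ∀ z ∈ S, T z ⁻¹' A = A
  measurableSet_empty := ⟨MeasurableSet.empty, fun _ _ => by simp⟩
  measurableSet_compl A hA := ⟨hA.1.compl, fun z hz => by
    rw [Set.preimage_compl, hA.2 z hz]⟩
  measurableSet_iUnion f hf := ⟨MeasurableSet.iUnion fun i => (hf i).1, fun z hz => by
    rw [Set.preimage_iUnion]
    exact Set.iUnion_congr fun i => (hf i).2 z hz⟩

/-- `ℙ` is ergodic under the shifts `{T_z : z ∈ S}`. -/
def ErgodicUnder (ℙ : Measure Ω) (T : Zd d → Ω → Ω) (S : Set (Zd d)) : Prop :=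
  ∀ A : Set Ω, MeasurableSet A → (∀ z ∈ S, T z ⁻¹' A = A) → ℙ A = 0 ∨ ℙ A = 1

/-- The class `𝓛_{z,R'}`. -/
def classL (ℙ : Measure Ω) (T : Zd d → Ω → Ω) (g : Ω → ℝ) (z : Zd d)
    (R' : Finset (Zd d)) : Prop :=
  ∀ᵐ ω ∂ℙ,
    (⨅ ε : {e : ℝ // 0 < e},
      Filter.limsup (fun n : ℕ =>
        ⨆ (x : Zd d) (_ : x ∈ Gp R' ∧ n1Z x ≤ n),
          (n : ℝ≥0∞)⁻¹ *
            ∑ k ∈ Finset.range (⌊(ε : ℝ) * n⌋₊ + 1), ENNReal.ofReal (g (T (x + k • z) ω)))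
        Filter.atTop) = 0

/-- Extended conditional expectation, with values in `[-∞,∞]`: the decreasing limit of the
conditional expectations of the truncations `max f (-n)`.  It agrees a.s. with the usual
conditional expectation in `[-∞,∞)` whenever `f⁺` is integrable. -/
def condExpE (ℙ : Measure Ω) (m : MeasurableSpace Ω) (f : Ω → ℝ) : Ω → EReal :=
  fun ω => ⨅ n : ℕ, ((MeasureTheory.condExp m ℙ (fun ω' => max (f ω') (-(n : ℝ))) ω : ℝ) : EReal)

/-- `EReal → ℝ≥0∞`, sending `[-∞,0]` to `0` and `⊤` to `⊤`. -/
def erealToENN (x : EReal) : ℝ≥0∞ := if x = ⊤ then ⊤ else ENNReal.ofReal x.toReal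

/-- `ᾱ(x) = inf_{n ≥ 1} (1/n) E[a(0,nx) | I_x]`, with `ᾱ(0) = 0`. -/
def alphaBar (ℙ : Measure Ω) (T : Zd d → Ω → Ω) (V : Ω → Zd d → ℝ) (p : Zd d → ℝ)
    (R : Finset (Zd d)) (x : Zd d) : Ω → EReal :=
  fun ω =>
    if x = 0 then 0 else
    ⨅ n : {m : ℕ // 0 < m},
      (((n : ℕ) : ℝ)⁻¹ : EReal) *
        condExpE ℙ (invSigma T {x}) (fun ω' => aFun T V p R ω' 0 ((n : ℕ) • x)) ω

/-- `x̂_t(ξ) = ∑_z ⌊tγ_z⌋ z`. -/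
def xhat (R : Finset (Zd d)) (γ : Zd d → ℝ) (t : ℝ) : Zd d := ∑ z ∈ R, ⌊t * γ z⌋ • z

/-- `tilde-α(ξ) = inf_{t ∈ ℚ, t>0} (1/t) E[a(0, x̂_t(ξ)) | 𝔖]`, where `𝔖` is the σ-algebra of
sets invariant under the shifts from `S`. -/
def tAlpha (ℙ : Measure Ω) (T : Zd d → Ω → Ω) (V : Ω → Zd d → ℝ) (p : Zd d → ℝ)
    (R : Finset (Zd d)) (S : Set (Zd d)) (γ : Zd d → ℝ) : Ω → EReal :=
  fun ω => ⨅ t : {q : ℚ // 0 < q},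
    ((((t : ℚ) : ℝ))⁻¹ : EReal) *
      condExpE ℙ (invSigma T S) (fun ω' => aFun T V p R ω' 0 (xhat R γ ((t : ℚ) : ℝ))) ω

/-- The σ-algebra `𝔖_ξ` of sets invariant under the shifts from `R_ξ = R ∩ C_ξ`. -/
def Sface (T : Zd d → Ω → Ω) (R : Finset (Zd d))
    (Cface : (Fin d → ℝ) → Set (Fin d → ℝ)) (ξ : Fin d → ℝ) : MeasurableSpace Ω :=
  invSigma T {z | z ∈ R ∧ toR z ∈ Cface ξ}

/-- `tilde-α` as a function of the direction `ξ`, given a choice `Cface` of the face `C_ξ`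
and a choice `γfun` of cone coefficients. -/
def tAlphaF (ℙ : Measure Ω) (T : Zd d → Ω → Ω) (V : Ω → Zd d → ℝ) (p : Zd d → ℝ)
    (R : Finset (Zd d)) (Cface : (Fin d → ℝ) → Set (Fin d → ℝ))
    (γfun : (Fin d → ℝ) → Zd d → ℝ) (ξ : Fin d → ℝ) : Ω → EReal :=
  fun ω => if ξ = 0 then 0 else tAlpha ℙ T V p R {z | z ∈ R ∧ toR z ∈ Cface ξ} (γfun ξ) ω

/-- `B` is an `L¹` covariant cocycle on the group generated by the allowed steps. -/
def IsCocycle (ℙ : Measure Ω) (T : Zd d → Ω → Ω) (S : Set (Zd d))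
    (B : Ω → Zd d → Zd d → ℝ) : Prop :=
  (∀ x y : Zd d, Measurable fun ω => B ω x y) ∧
  (∀ x ∈ S, ∀ y ∈ S, Integrable (fun ω => B ω x y) ℙ) ∧
  (∀ᵐ ω ∂ℙ, ∀ x ∈ S, ∀ y ∈ S, ∀ z ∈ S, B ω x y + B ω y z = B ω x z) ∧
  (∀ᵐ ω ∂ℙ, ∀ x ∈ S, ∀ y ∈ S, ∀ z ∈ S, B ω (x + z) (y + z) = B (T z ω) x y)

/-- The class `K⁺_A(V)` of centered cocycles. -/
def InKplus (ℙ : Measure Ω) (T : Zd d → Ω → Ω) (V : Ω → Zd d → ℝ) (p : Zd d → ℝ)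
    (R' : Finset (Zd d)) (B : Ω → Zd d → Zd d → ℝ) : Prop :=
  IsCocycle ℙ T (GZ R') B ∧
  ∀ᵐ ω ∂ℙ, ∑ z ∈ R', p z * Real.exp (-(V ω z) - B ω 0 z) ≤ 1

/-- The standing setting: shifts, stationary `ℙ`, finite step set, measurable potential,
random walk kernel. -/
def Setting (ℙ : Measure Ω) (T : Zd d → Ω → Ω) (R : Finset (Zd d))
    (V : Ω → Zd d → ℝ) (p : Zd d → ℝ) : Prop :=
  (∀ z : Zd d, Measurable (T z)) ∧ T 0 = id ∧ (∀ x y : Zd d, T (x + y) = T x ∘ T y) ∧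
  (∀ z : Zd d, MeasurePreserving (T z) ℙ ℙ) ∧ 2 ≤ R.card ∧
  (∀ z : Zd d, Measurable fun ω => V ω z) ∧
  (∀ z ∈ R, 0 < p z ∧ p z < 1) ∧ ∑ z ∈ R, p z = 1

/-- `V⁺ ∈ L¹`. -/
def VplusL1 (ℙ : Measure Ω) (V : Ω → Zd d → ℝ) (R : Finset (Zd d)) : Prop :=
  ∀ z ∈ R, Integrable (fun ω => max (V ω z) 0) ℙ

/-- Assumption (i): `V ≥ 0` a.s. on `R₀` and `V ≥ c` a.s. on `R ∖ R₀`. -/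
def AssumptionI (ℙ : Measure Ω) (V : Ω → Zd d → ℝ) (R : Finset (Zd d))
    (U₀ : Set (Fin d → ℝ)) : Prop :=
  (∀ z ∈ R0 R U₀, ∀ᵐ ω ∂ℙ, 0 ≤ V ω z) ∧
  ∃ c : ℝ, ∀ z ∈ R, toR z ∉ U₀ → ∀ᵐ ω ∂ℙ, c ≤ V ω z

end measurable

end RWRP

namespace RWRP
variable {d : ℕ} {Ω : Type*}

def cw (T : Zd d → Ω → Ω) (V : Ω → Zd d → ℝ) (p : Zd d → ℝ) (ω : Ω) (x z : Zd d) : ℝ≥0∞ :=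
  ENNReal.ofReal (p z) * ENNReal.ofReal (Real.exp (-(V (T x ω) z)))

def Kn (T : Zd d → Ω → Ω) (V : Ω → Zd d → ℝ) (p : Zd d → ℝ) (R : Finset (Zd d))
    (ω : Ω) (n : ℕ) (x y : Zd d) : ℝ≥0∞ :=
  ∑ s : Fin (n+1) → {z : Zd d // z ∈ R},
    if firstHit x y (n+1) (stepF (n+1) s) then
      pathW p s * ENNReal.ofReal (Real.exp (-(pathV T V ω x (n+1) (stepF (n+1) s))))
    else 0

def Kt (T : Zd d → Ω → Ω) (V : Ω → Zd d → ℝ) (p : Zd d → ℝ) (R : Finset (Zd d))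
    (ω : Ω) (x y : Zd d) : ℝ≥0∞ := if y = x then 1 else walkK T V p R ω x y

lemma stepF_cons_zero {R : Finset (Zd d)} (n : ℕ) (z : {z : Zd d // z ∈ R})
    (s : Fin n → {z : Zd d // z ∈ R}) :
    stepF (n+1) (Fin.cons z s : Fin (n+1) → {z : Zd d // z ∈ R}) 0 = z := by
  simp [stepF]

lemma stepF_cons_succ {R : Finset (Zd d)} (n : ℕ) (z : {z : Zd d // z ∈ R})
    (s : Fin n → {z : Zd d // z ∈ R}) (i : ℕ) :
    stepF (n+1) (Fin.cons z s : Fin (n+1) → {z : Zd d // z ∈ R}) (i+1) = stepF n s i := by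
  unfold stepF
  by_cases h : i < n
  · rw [dif_pos h, dif_pos (by omega)]
    have : (⟨i+1, by omega⟩ : Fin (n+1)) = Fin.succ ⟨i, h⟩ := rfl
    rw [this, Fin.cons_succ]
  · rw [dif_neg h, dif_neg (by omega)]

lemma pos_succ' (x : Zd d) (f : ℕ → Zd d) (k : ℕ) :
    pos x f (k+1) = pos (x + f 0) (fun i => f (i+1)) k := by
  unfold pos
  rw [Finset.sum_range_succ']
  abel

lemma pathV_succ' (T : Zd d → Ω → Ω) (V : Ω → Zd d → ℝ) (ω : Ω) (x : Zd d) (n : ℕ)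
    (f : ℕ → Zd d) : pathV T V ω x (n+1) f =
      V (T x ω) (f 0) + pathV T V ω (x + f 0) n (fun i => f (i+1)) := by
  unfold pathV
  rw [Finset.sum_range_succ']
  simp only [pos_succ']
  rw [add_comm]
  simp [pos]

lemma firstHit_succ (x y : Zd d) (n : ℕ) (f : ℕ → Zd d) :
    firstHit x y (n+2) f ↔ x + f 0 ≠ y ∧ firstHit (x + f 0) y (n+1) (fun i => f (i+1)) := by
  unfold firstHit
  rw [pos_succ']
  constructor
  · rintro ⟨h1, h2⟩
    refine ⟨?_, h1, ?_⟩
    · have := h2 1 (by simp)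
      simpa [pos_succ', pos] using this
    · intro k hk
      have := h2 (k+1) (by simp at hk ⊢; omega)
      rwa [pos_succ'] at this
  · rintro ⟨h0, h1, h2⟩
    refine ⟨h1, ?_⟩
    intro k hk
    obtain ⟨k, rfl⟩ : ∃ j, k = j+1 := ⟨k-1, by simp at hk; omega⟩
    rw [pos_succ']
    by_cases hk0 : k = 0
    · subst hk0; simpa [pos] using h0
    · exact h2 k (by simp at hk ⊢; omega)

lemma Kn_zero (T : Zd d → Ω → Ω) (V : Ω → Zd d → ℝ) (p : Zd d → ℝ) (R : Finset (Zd d))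
    (ω : Ω) (x y : Zd d) :
    Kn T V p R ω 0 x y = ∑ z ∈ R, cw T V p ω x z * (if x + z = y then 1 else 0) := by
  unfold Kn
  rw [← Equiv.sum_comp (Equiv.funUnique (Fin 1) {z : Zd d // z ∈ R}).symm]
  rw [← Finset.sum_coe_sort R]
  refine Finset.sum_congr rfl fun z _ => ?_
  have hf : ∀ s : Fin 1 → {z : Zd d // z ∈ R}, firstHit x y (0+1) (stepF (0+1) s) ↔ x + s 0 = y := by
    intro s
    unfold firstHit
    have : Finset.Ioo 0 (0+1) = ∅ := by decide
    rw [this]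
    simp [pos, stepF]
  simp only [hf]
  simp [pathW, pathV, pos, stepF, cw]

lemma Kn_succ (T : Zd d → Ω → Ω) (V : Ω → Zd d → ℝ) (p : Zd d → ℝ) (R : Finset (Zd d))
    (ω : Ω) (n : ℕ) (x y : Zd d) :
    Kn T V p R ω (n+1) x y =
      ∑ z ∈ R, cw T V p ω x z * (if x + z = y then 0 else Kn T V p R ω n (x + z) y) := by
  rw [← Finset.sum_coe_sort R]
  unfold Kn
  rw [← Equiv.sum_comp (Fin.consEquiv (fun _ : Fin (n+2) => {z : Zd d // z ∈ R})),
    Fintype.sum_prod_type]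
  refine Finset.sum_congr rfl fun z _ => ?_
  split_ifs with h
  · rw [mul_zero]
    refine Finset.sum_eq_zero fun s _ => ?_
    rw [if_neg]
    change ¬ firstHit x y (n+1+1) (stepF (n+1+1) (Fin.cons z s : Fin (n+2) → {z : Zd d // z ∈ R}))
    rw [firstHit_succ, stepF_cons_zero]
    tauto
  · rw [Finset.mul_sum]
    refine Finset.sum_congr rfl fun s _ => ?_
    have e0 : (Fin.consEquiv (fun _ : Fin (n+2) => {z : Zd d // z ∈ R})) (z, s) = (Fin.cons z s : Fin (n+2) → {z : Zd d // z ∈ R}) := rfl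
    rw [e0]
    have e1 : firstHit x y (n+1+1) (stepF (n+1+1) (Fin.cons z s : Fin (n+2) → {z : Zd d // z ∈ R}))
        ↔ firstHit (x + (z : Zd d)) y (n+1) (stepF (n+1) s) := by
      rw [firstHit_succ, stepF_cons_zero]
      simp only [stepF_cons_succ]
      tauto
    simp only [e1]
    split_ifs
    · rw [pathV_succ', stepF_cons_zero]
      simp only [stepF_cons_succ]
      unfold pathW cw
      rw [Fin.prod_univ_succ]
      simp only [Fin.cons_zero, Fin.cons_succ]
      rw [neg_add, Real.exp_add, ENNReal.ofReal_mul (Real.exp_nonneg _)]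
      ring
    · simp

lemma walkK_eq (T : Zd d → Ω → Ω) (V : Ω → Zd d → ℝ) (p : Zd d → ℝ) (R : Finset (Zd d))
    (ω : Ω) (x y : Zd d) : walkK T V p R ω x y = ∑' n, Kn T V p R ω n x y := rfl

lemma walkK_step (T : Zd d → Ω → Ω) (V : Ω → Zd d → ℝ) (p : Zd d → ℝ) (R : Finset (Zd d))
    (ω : Ω) (x y : Zd d) :
    walkK T V p R ω x y = ∑ z ∈ R, cw T V p ω x z * Kt T V p R ω (x + z) y := by
  rw [walkK_eq, tsum_eq_zero_add' ENNReal.summable, Kn_zero]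
  simp only [Kn_succ]
  rw [Summable.tsum_finsetSum (fun _ _ => ENNReal.summable), ← Finset.sum_add_distrib]
  refine Finset.sum_congr rfl fun z _ => ?_
  rw [ENNReal.tsum_mul_left, ← mul_add]
  congr 1
  unfold Kt
  by_cases h : x + z = y
  · simp [h]
  · have h' : ¬ y = x + z := fun e => h e.symm
    simp only [if_neg h, if_neg h', zero_add, walkK_eq]

lemma walkK_super (T : Zd d → Ω → Ω) (V : Ω → Zd d → ℝ) (p : Zd d → ℝ) (R : Finset (Zd d))
    (ω : Ω) (h : Zd d → ℝ≥0∞)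
    (hh : ∀ x, ∑ z ∈ R, cw T V p ω x z * h (x + z) ≤ h x) (x y : Zd d) :
    walkK T V p R ω x y * h y ≤ h x := by
  have key : ∀ N : ℕ, ∀ x, (∑ n ∈ Finset.range N, Kn T V p R ω n x y) * h y ≤ h x := by
    intro N
    induction N with
    | zero => intro x; simp
    | succ N ih =>
      intro x
      rw [Finset.sum_range_succ', Kn_zero]
      simp only [Kn_succ]
      rw [Finset.sum_comm, ← Finset.sum_add_distrib, Finset.sum_mul]
      refine le_trans (Finset.sum_le_sum fun z _ => ?_) (hh x)
      rw [← Finset.mul_sum, ← mul_add, mul_assoc]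
      gcongr
      by_cases hz : x + z = y
      · simp [hz]
      · simp only [if_neg hz, add_zero]
        exact ih _
  rw [walkK_eq, ENNReal.tsum_eq_iSup_nat, ENNReal.iSup_mul]
  exact iSup_le fun N => key N x

end RWRP

namespace RWRP
variable {d : ℕ} {Ω : Type*}

lemma toR_add (x y : Zd d) : toR (x + y) = toR x + toR y := by
  funext i; simp [toR]
lemma toR_zero : toR (0 : Zd d) = 0 := by
  funext i; simp [toR]
lemma toR_nsmul (n : ℕ) (x : Zd d) : toR (n • x) = (n : ℝ) • toR x := by
  funext i; simp [toR]
lemma toR_sum {ι : Type*} (s : Finset ι) (f : ι → Zd d) :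
    toR (∑ i ∈ s, f i) = ∑ i ∈ s, toR (f i) := by
  funext i; simp [toR]

lemma exists_list (R : Finset (Zd d)) (b : Zd d → ℕ) :
    ∃ l : List (Zd d), (∀ z ∈ l, z ∈ R) ∧ l.sum = ∑ z ∈ R, b z • z ∧
      l.length = ∑ z ∈ R, b z ∧
      ∀ φ : Zd d → ℝ, (l.map φ).sum = ∑ z ∈ R, (b z : ℝ) * φ z := by
  induction R using Finset.induction_on with
  | empty => exact ⟨[], by simp, by simp, by simp, by simp⟩
  | insert a s ha ih =>
    obtain ⟨l, h1, h2, h4, h3⟩ := ih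
    refine ⟨List.replicate (b a) a ++ l, ?_, ?_, ?_, ?_⟩
    · intro z hz
      rcases List.mem_append.1 hz with hz | hz
      · rw [List.eq_of_mem_replicate hz]; exact Finset.mem_insert_self _ _
      · exact Finset.mem_insert_of_mem (h1 z hz)
    · rw [List.sum_append, h2, Finset.sum_insert ha, List.sum_replicate]
    · rw [List.length_append, h4, Finset.sum_insert ha, List.length_replicate]
    · intro φ
      rw [List.map_append, List.sum_append, h3, Finset.sum_insert ha, List.map_replicate,
        List.sum_replicate, nsmul_eq_mul]

lemma Gp_zero (R : Finset (Zd d)) : (0 : Zd d) ∈ Gp R := ⟨fun _ => 0, by simp⟩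
lemma Gp_add {R : Finset (Zd d)} {x y : Zd d} (hx : x ∈ Gp R) (hy : y ∈ Gp R) : x + y ∈ Gp R := by
  obtain ⟨b, rfl⟩ := hx
  obtain ⟨c, rfl⟩ := hy
  exact ⟨b + c, by simp [add_smul, Finset.sum_add_distrib]⟩
lemma Gp_mem {R : Finset (Zd d)} {z : Zd d} (hz : z ∈ R) : z ∈ Gp R :=
  ⟨fun w => if w = z then 1 else 0, by simp [ite_smul, hz]⟩
lemma Gp_nsmul {R : Finset (Zd d)} {x : Zd d} (n : ℕ) (hx : x ∈ Gp R) : n • x ∈ Gp R := by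
  induction n with
  | zero => simpa using Gp_zero R
  | succ n ih => rw [succ_nsmul]; exact Gp_add ih hx
lemma Gp_list {R : Finset (Zd d)} (l : List (Zd d)) (hl : ∀ z ∈ l, z ∈ R) : l.sum ∈ Gp R := by
  induction l with
  | nil => simpa using Gp_zero R
  | cons a l ih =>
    rw [List.sum_cons]
    exact Gp_add (Gp_mem (hl a (by simp))) (ih fun z hz => hl z (by simp [hz]))
lemma Gp_sum {ι : Type*} {R : Finset (Zd d)} (s : Finset ι) (f : ι → Zd d) (h : ∀ i ∈ s, f i ∈ Gp R) :
    ∑ i ∈ s, f i ∈ Gp R := by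
  induction s using Finset.induction_on with
  | empty => simpa using Gp_zero R
  | insert a s ha ih =>
    rw [Finset.sum_insert ha]
    exact Gp_add (h a (by simp)) (ih fun i hi => h i (by simp [hi]))

lemma Cp_of_sum {R : Finset (Zd d)} (b : Zd d → ℝ) (hb : ∀ z ∈ R, 0 ≤ b z) :
    ∑ z ∈ R, b z • toR z ∈ Cp R := by
  refine ⟨fun z => max (b z) 0, fun z => le_max_right _ _, Finset.sum_congr rfl fun z hz => ?_⟩
  simp only [max_eq_left (hb z hz)]

lemma Cp_smul {R : Finset (Zd d)} {x : Fin d → ℝ} (hx : x ∈ Cp R) {t : ℝ} (ht : 0 ≤ t) :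
    t • x ∈ Cp R := by
  obtain ⟨b, hb, rfl⟩ := hx
  exact ⟨fun z => t * b z, fun z => mul_nonneg ht (hb z), by simp [Finset.smul_sum, mul_smul]⟩

section face
variable {R : Finset (Zd d)} {A : Set (Fin d → ℝ)} (hA : IsFace (Cp R) A)
include hA

lemma face_smul_aux {x : Fin d → ℝ} (hx : x ∈ A) {t : ℝ} (ht : 1 < t) : t • x ∈ A ∧ (0 : Fin d → ℝ) ∈ A := by
  refine hA.2.2 (t := t⁻¹) hx (Cp_smul (hA.1 hx) (by linarith)) ⟨fun _ => 0, by simp, by simp⟩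
    ⟨by positivity, inv_lt_one_of_one_lt₀ ht⟩ ?_
  rw [smul_zero, add_zero, smul_smul, inv_mul_cancel₀ (by positivity), one_smul]

lemma face_zero {x : Fin d → ℝ} (hx : x ∈ A) : (0 : Fin d → ℝ) ∈ A :=
  (face_smul_aux hA hx (by norm_num : (1:ℝ) < 2)).2

lemma face_smul {x : Fin d → ℝ} (hx : x ∈ A) {t : ℝ} (ht : 0 ≤ t) : t • x ∈ A := by
  by_cases h : 1 < t
  · exact (face_smul_aux hA hx h).1
  · have := hA.2.1 hx (face_zero hA hx) ht (sub_nonneg.2 (not_lt.1 h)) (by ring)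
    simpa using this

lemma face_add {x y : Fin d → ℝ} (hx : x ∈ A) (hy : y ∈ A) : x + y ∈ A := by
  have := hA.2.1 hx hy (by norm_num : (0:ℝ) ≤ 1/2) (by norm_num : (0:ℝ) ≤ 1/2) (by norm_num)
  have := face_smul hA this (by norm_num : (0:ℝ) ≤ 2)
  rw [smul_add, smul_smul, smul_smul] at this
  norm_num at this
  exact this

lemma face_split {x y : Fin d → ℝ} (hx : x ∈ Cp R) (hy : y ∈ Cp R) (h : x + y ∈ A) :
    x ∈ A ∧ y ∈ A := by
  have := hA.2.2 (t := 1/2) h (Cp_smul hx (by norm_num : (0:ℝ) ≤ 2)) (Cp_smul hy (by norm_num : (0:ℝ) ≤ 2))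
    ⟨by norm_num, by norm_num⟩ (by rw [smul_smul, smul_smul]; norm_num)
  refine ⟨?_, ?_⟩
  · have := face_smul hA this.1 (by norm_num : (0:ℝ) ≤ 1/2)
    rwa [smul_smul, show (1/2 * 2 : ℝ) = 1 by norm_num, one_smul] at this
  · have := face_smul hA this.2 (by norm_num : (0:ℝ) ≤ 1/2)
    rwa [smul_smul, show (1/2 * 2 : ℝ) = 1 by norm_num, one_smul] at this

lemma face_decomp {b : Zd d → ℝ} (hb : ∀ z, 0 ≤ b z) (h : ∑ z ∈ R, b z • toR z ∈ A) {z : Zd d}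
    (hz : z ∈ R) (hbz : 0 < b z) : toR z ∈ A := by
  rw [← Finset.add_sum_erase _ _ hz] at h
  have h1 : b z • toR z ∈ Cp R := by
    refine ⟨fun w => if w = z then b z else 0, fun w => by dsimp only; split_ifs <;> simp [hb], ?_⟩
    simp [ite_smul, hz]
  have h2 : ∑ w ∈ R.erase z, b w • toR w ∈ Cp R := by
    refine ⟨fun w => if w = z then 0 else b w, fun w => by dsimp only; split_ifs <;> simp [hb], ?_⟩
    rw [← Finset.add_sum_erase _ _ hz]
    simp only [if_true, zero_smul, zero_add]
    refine Finset.sum_congr rfl fun w hw => ?_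
    rw [if_neg (Finset.ne_of_mem_erase hw)]
  have := face_smul hA (face_split hA h1 h2 h).1 (inv_nonneg.2 hbz.le)
  rwa [smul_smul, inv_mul_cancel₀ hbz.ne', one_smul] at this

variable {R' : Finset (Zd d)} (hR' : ∀ z, z ∈ R' ↔ z ∈ R ∧ toR z ∈ A)
include hR'

lemma sum_eq_face {M : Type*} [AddCommMonoid M] (f : Zd d → M) (h : ∀ z ∈ R, toR z ∉ A → f z = 0) :
    ∑ z ∈ R, f z = ∑ z ∈ R', f z := by
  symm
  refine Finset.sum_subset (fun z hz => ((hR' z).1 hz).1) fun z hz hz' => ?_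
  exact h z hz fun hzA => hz' ((hR' z).2 ⟨hz, hzA⟩)

lemma face_rep {x : Fin d → ℝ} (hx : x ∈ A) : ∃ b : Zd d → ℝ, (∀ z, 0 ≤ b z) ∧
    x = ∑ z ∈ R', b z • toR z := by
  obtain ⟨b, hb, rfl⟩ := hA.1 hx
  refine ⟨b, hb, sum_eq_face hA hR' _ fun z hz hzA => ?_⟩
  by_contra hne
  refine hzA (face_decomp hA hb hx hz (lt_of_le_of_ne (hb z) ?_))
  rintro h0
  rw [← h0] at hne
  simp at hne

lemma Gp_face {x : Zd d} (hx : x ∈ Gp R) (hxA : toR x ∈ A) : x ∈ Gp R' := by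
  obtain ⟨b, rfl⟩ := hx
  refine ⟨b, sum_eq_face hA hR' _ fun z hz hzA => ?_⟩
  by_contra hne
  have h : ∑ z ∈ R, (b z : ℝ) • toR z ∈ A := by
    rw [toR_sum] at hxA; simpa only [toR_nsmul] using hxA
  refine hzA (face_decomp hA (fun z => Nat.cast_nonneg _) h hz ?_)
  rcases Nat.eq_zero_or_pos (b z) with h0 | h0
  · rw [h0] at hne; simp at hne
  · exact_mod_cast h0

lemma face_sum (h0 : (0 : Fin d → ℝ) ∈ A) {b : Zd d → ℝ} (hb : ∀ z ∈ R', 0 ≤ b z) :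
    ∑ z ∈ R', b z • toR z ∈ A := by
  have : ∀ s ⊆ R', ∑ z ∈ s, b z • toR z ∈ A := by
    intro s
    induction s using Finset.induction_on with
    | empty => intro _; simpa using h0
    | insert a s ha ih =>
      intro hs
      rw [Finset.sum_insert ha]
      have ha' : a ∈ R' := hs (Finset.mem_insert_self _ _)
      exact face_add hA (face_smul hA ((hR' a).1 ha').2 (hb a ha'))
        (ih fun z hz => hs (Finset.mem_insert_of_mem hz))
  exact this R' subset_rfl

lemma Gp_face' (h0 : (0 : Fin d → ℝ) ∈ A) {x : Zd d} (hx : x ∈ Gp R') : x ∈ Gp R ∧ toR x ∈ A := by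
  obtain ⟨b, rfl⟩ := hx
  constructor
  · exact Gp_sum _ _ fun z hz => Gp_nsmul _ (Gp_mem ((hR' z).1 hz).1)
  · rw [toR_sum]
    simp only [toR_nsmul]
    exact face_sum hA hR' h0 fun z _ => Nat.cast_nonneg _

lemma toR_Gp_Cp {x : Zd d} (hx : x ∈ Gp R) : toR x ∈ Cp R := by
  obtain ⟨b, rfl⟩ := hx
  rw [toR_sum]
  simp only [toR_nsmul]
  exact Cp_of_sum _ fun z _ => Nat.cast_nonneg _

lemma Gp_step (h0 : (0 : Fin d → ℝ) ∈ A) {y z : Zd d} (hy : y ∈ Gp R') (hz : z ∈ R)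
    (hyz : y - z ∈ Gp R) : z ∈ R' ∧ y - z ∈ Gp R' := by
  have h1 := (Gp_face' hA hR' h0 hy).2
  rw [show y = z + (y - z) by abel, toR_add] at h1
  have h2 := face_split hA (toR_Gp_Cp hA hR' (Gp_mem hz)) (toR_Gp_Cp hA hR' hyz) h1
  exact ⟨(hR' z).2 ⟨hz, h2.1⟩, Gp_face hA hR' hyz h2.2⟩

end face

lemma relint_extend {A : Set (Fin d → ℝ)} {x s : Fin d → ℝ} (hx : x ∈ intrinsicInterior ℝ A)
    (hs : s ∈ affineSpan ℝ A) : ∃ ε : ℝ, 0 < ε ∧ x + ε • (x - s) ∈ A := by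
  obtain ⟨y, hy, rfl⟩ := hx
  have hline : ∀ t : ℝ, (y : Fin d → ℝ) + t • ((y : Fin d → ℝ) - s) ∈ affineSpan ℝ A := by
    intro t
    have := AffineMap.lineMap_mem t y.2 (AffineMap.lineMap_mem (2:ℝ) hs y.2)
    convert this using 1
    simp only [AffineMap.lineMap_apply, vsub_eq_sub, vadd_eq_add]
    module
  let g : ℝ → affineSpan ℝ A := fun t => ⟨_, hline t⟩
  have hg : Continuous g := by
    refine Continuous.subtype_mk ?_ _
    fun_prop
  have hg0 : g 0 = y := by ext; simp [g]
  have : ∀ᶠ t in 𝓝 (0:ℝ), g t ∈ ((↑) : affineSpan ℝ A → Fin d → ℝ) ⁻¹' A := by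
    apply hg.continuousAt.eventually_mem
    rw [hg0]
    exact mem_interior_iff_mem_nhds.1 hy
  have h2 := (this.filter_mono (nhdsWithin_le_nhds (s := Ioi 0))).and self_mem_nhdsWithin
  obtain ⟨t, h1, h2⟩ := h2.exists
  exact ⟨t, h2, h1⟩

lemma exists_pos_rep {R : Finset (Zd d)} {A : Set (Fin d → ℝ)} (hA : IsFace (Cp R) A)
    {R' : Finset (Zd d)} (hR' : ∀ z, z ∈ R' ↔ z ∈ R ∧ toR z ∈ A) {ξ : Fin d → ℝ}
    (hξ : ξ ∈ intrinsicInterior ℝ A) :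
    ∃ g : Zd d → ℝ, (∀ z, 0 < g z) ∧ ∑ z ∈ R', g z • toR z = ξ := by
  have hξA := intrinsicInterior_subset hξ
  have hs := face_sum hA hR' (face_zero hA hξA) (b := fun _ => 1) (fun _ _ => zero_le_one)
  obtain ⟨ε, hε, h⟩ := relint_extend hξ (subset_affineSpan ℝ A hs)
  obtain ⟨b, hb, hbe⟩ := face_rep hA hR' h
  refine ⟨fun z => (1+ε)⁻¹ * (ε + b z), fun z => ?_, ?_⟩
  · have := hb z; positivity
  · simp only [one_smul] at hbe
    simp only [mul_smul, add_smul, ← Finset.smul_sum, Finset.sum_add_distrib]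
    rw [← hbe]
    have : (1 + ε) ≠ 0 := by positivity
    rw [inv_smul_eq_iff₀ this]
    module

lemma exists_u [MeasurableSpace Ω] (ℙ : Measure Ω) (V : Ω → Zd d → ℝ) (R : Finset (Zd d))
    (U₀ : Set (Fin d → ℝ)) (hU₀ : IsZeroFace R U₀) (hi : AssumptionI ℙ V R U₀) :
    ∃ u : (Fin d → ℝ) →ₗ[ℝ] ℝ, ∀ z ∈ R, ∀ᵐ ω ∂ℙ, - u (toR z) ≤ V ω z := by
  set L := Submodule.span ℝ U₀ with hL
  set Kc := convexHull ℝ (toR '' {z : Zd d | z ∈ R ∧ toR z ∉ U₀}) with hKc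
  have hdisj : Disjoint Kc (L : Set (Fin d → ℝ)) := by
    rw [Set.disjoint_left]
    intro x hxK hxL
    have hKU : Kc ⊆ hullU R := convexHull_mono (image_mono fun z hz => hz.1)
    rcases hU₀ with ⟨h0U, hface, h0⟩ | ⟨h0U, hemp⟩
    · have hconv : Convex ℝ (hullU R \ U₀) := by
        intro a ha b hb s t hs ht hst
        refine ⟨convex_convexHull ℝ _ ha.1 hb.1 hs ht hst, fun hab => ?_⟩
        rcases hs.eq_or_lt with h | hs
        · subst h
          simp only [zero_add] at hst; subst hst
          simp at hab; exact hb.2 hab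
        rcases ht.eq_or_lt with h | ht
        · subst h
          simp only [add_zero] at hst; subst hst
          simp at hab; exact ha.2 hab
        have ht' : t = 1 - s := by linarith
        subst ht'
        exact ha.2 (hface.2.2 hab ha.1 hb.1 ⟨hs, by linarith⟩ rfl).1
      have hsub : Kc ⊆ hullU R \ U₀ := by
        refine convexHull_min ?_ hconv
        rintro _ ⟨z, ⟨hz, hz'⟩, rfl⟩
        exact ⟨subset_convexHull ℝ _ ⟨z, hz, rfl⟩, hz'⟩
      have h0U₀ := intrinsicInterior_subset h0
      have hxa : x ∈ affineSpan ℝ U₀ := by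
        have : ∀ w ∈ L, w ∈ affineSpan ℝ U₀ := by
          intro w hw
          have h0a : (0 : Fin d → ℝ) ∈ affineSpan ℝ U₀ := subset_affineSpan ℝ _ h0U₀
          have hdir : L ≤ (affineSpan ℝ U₀).direction := by
            rw [hL, Submodule.span_le]
            intro y hy
            have := AffineSubspace.vsub_mem_direction (subset_affineSpan ℝ _ hy) h0a
            simpa using this
          have := AffineSubspace.vadd_mem_of_mem_direction (hdir hw) h0a
          simpa using this
        exact this x hxL
      obtain ⟨ε, hε, hx⟩ := relint_extend h0 hxa
      refine (hsub hxK).2 ?_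
      refine (hface.2.2 (t := ε / (1+ε)) h0U₀ (hKU hxK) (hface.1 hx) ⟨by positivity, ?_⟩ ?_).1
      · rw [div_lt_one (by positivity)]; linarith
      · have : 1 + ε ≠ 0 := by positivity
        simp only [zero_sub, zero_add, smul_neg, smul_smul, ← sub_eq_add_neg]
        rw [← sub_smul]
        have : ε / (1 + ε) - (1 - ε / (1+ε)) * ε = 0 := by field_simp; ring
        rw [this, zero_smul]
    · rw [hL, hemp, Submodule.span_empty] at hxL
      have : x = 0 := by simpa using hxL
      subst this
      exact h0U (hKU hxK)
  have hfin : (toR '' {z : Zd d | z ∈ R ∧ toR z ∉ U₀}).Finite :=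
    Set.Finite.image _ (R.finite_toSet.subset fun z hz => hz.1)
  obtain ⟨f, r, v, h1, h2, h3⟩ := geometric_hahn_banach_compact_closed (convex_convexHull ℝ _)
    (hfin.isCompact_convexHull ℝ) L.convex L.closed_of_finiteDimensional hdisj
  have hf0 : ∀ b ∈ L, f b = 0 := by
    intro b hb
    by_contra hne
    have := h3 (((v - 1) / f b) • b) (L.smul_mem _ hb)
    rw [map_smul, smul_eq_mul, div_mul_cancel₀ _ hne] at this
    linarith
  have hv : v < 0 := by simpa using h3 0 L.zero_mem
  obtain ⟨hi0, c, hc⟩ := hi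
  refine ⟨(|c| / v) • (f : (Fin d → ℝ) →ₗ[ℝ] ℝ), fun z hz => ?_⟩
  by_cases hzU : toR z ∈ U₀
  · filter_upwards [hi0 z ⟨hz, hzU⟩] with ω hω
    have : f (toR z) = 0 := hf0 _ (Submodule.subset_span hzU)
    simpa [this] using hω
  · filter_upwards [hc z hz hzU] with ω hω
    have hfz : f (toR z) < v := (h1 _ (subset_convexHull ℝ _ ⟨z, ⟨hz, hzU⟩, rfl⟩)).trans h2
    refine le_trans ?_ hω
    simp only [LinearMap.smul_apply, ContinuousLinearMap.coe_coe, smul_eq_mul]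
    have : |c| ≤ |c| / v * f (toR z) := by
      rw [div_mul_eq_mul_div, le_div_iff_of_neg hv]
      exact mul_le_mul_of_nonneg_left hfz.le (abs_nonneg _)
    linarith [neg_abs_le c]

end RWRP

namespace RWRP
variable {d : ℕ} {Ω : Type*}

structure Ctx [MeasurableSpace Ω] (ℙ : Measure Ω) (T : Zd d → Ω → Ω) (R : Finset (Zd d))
    (V : Ω → Zd d → ℝ) (p : Zd d → ℝ) (R' : Finset (Zd d)) (u : (Fin d → ℝ) →ₗ[ℝ] ℝ) : Prop where
  T0 : T 0 = id
  Tadd : ∀ x y : Zd d, T (x + y) = T x ∘ T y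
  mp : ∀ z : Zd d, MeasurePreserving (T z) ℙ ℙ
  mV : ∀ z : Zd d, Measurable fun ω => V ω z
  ppos : ∀ z ∈ R, 0 < p z
  ple : ∀ z ∈ R, p z ≤ 1
  psum : ∑ z ∈ R, p z = 1
  sub : R' ⊆ R
  hV1 : ∀ z ∈ R, Integrable (fun ω => max (V ω z) 0) ℙ
  hu : ∀ z ∈ R, ∀ᵐ ω ∂ℙ, - u (toR z) ≤ V ω z
  step : ∀ y z, y ∈ Gp R' → z ∈ R → y - z ∈ Gp R → z ∈ R' ∧ y - z ∈ Gp R'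

lemma Gp_iff_list {R : Finset (Zd d)} {x : Zd d} : x ∈ Gp R ↔ ∃ l : List (Zd d), (∀ z ∈ l, z ∈ R) ∧ l.sum = x := by
  constructor
  · rintro ⟨b, rfl⟩
    obtain ⟨l, h1, h2, _⟩ := exists_list R b
    exact ⟨l, h1, h2⟩
  · rintro ⟨l, h, rfl⟩
    exact Gp_list l h

lemma Gp_mono {R' R : Finset (Zd d)} (h : R' ⊆ R) : Gp R' ⊆ Gp R := by
  intro x hx
  obtain ⟨l, hl, rfl⟩ := Gp_iff_list.1 hx
  exact Gp_list l fun z hz => h (hl z hz)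

/-- path sums -/
def ps (T : Zd d → Ω → Ω) (g : Ω → Zd d → ℝ) : List (Zd d) → Ω → ℝ
  | [], _ => 0
  | z :: l, ω => g ω z + ps T g l (T z ω)

def Wf (V : Ω → Zd d → ℝ) (p : Zd d → ℝ) (ω : Ω) (z : Zd d) : ℝ := max (V ω z) 0 - Real.log (p z)

lemma walkK_cov (T : Zd d → Ω → Ω) (Tadd : ∀ x y : Zd d, T (x + y) = T x ∘ T y) (V : Ω → Zd d → ℝ)
    (p : Zd d → ℝ) (R : Finset (Zd d)) (ω : Ω) (v x y : Zd d) :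
    walkK T V p R (T v ω) x y = walkK T V p R ω (x + v) (y + v) := by
  have hpos : ∀ f k, pos (x + v) f k = pos x f k + v := by
    intro f k; unfold pos; abel
  unfold walkK
  refine tsum_congr fun n => Finset.sum_congr rfl fun s _ => ?_
  have h1 : firstHit x y (n+1) (stepF (n+1) s) ↔ firstHit (x+v) (y+v) (n+1) (stepF (n+1) s) := by
    unfold firstHit
    simp [hpos]
  have h2 : pathV T V (T v ω) x (n+1) (stepF (n+1) s) = pathV T V ω (x+v) (n+1) (stepF (n+1) s) := by
    unfold pathV
    simp [hpos, Tadd]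
  simp only [h1, h2]

lemma aFun_cov (T : Zd d → Ω → Ω) (Tadd : ∀ x y : Zd d, T (x + y) = T x ∘ T y) (V : Ω → Zd d → ℝ)
    (p : Zd d → ℝ) (R : Finset (Zd d)) (ω : Ω) (v x y : Zd d) :
    aFun T V p R (T v ω) x y = aFun T V p R ω (x + v) (y + v) := by
  unfold aFun
  rw [walkK_cov T Tadd]
  simp

lemma aFun_meas [MeasurableSpace Ω] (T : Zd d → Ω → Ω) (hT : ∀ z, Measurable (T z)) (V : Ω → Zd d → ℝ)
    (hV : ∀ z : Zd d, Measurable fun ω => V ω z)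
    (p : Zd d → ℝ) (R : Finset (Zd d)) (x y : Zd d) :
    Measurable fun ω => aFun T V p R ω x y := by
  unfold aFun
  by_cases h : y = x
  · simp [h]
  simp only [if_neg h]
  refine (Real.measurable_log.comp (ENNReal.measurable_toReal.comp ?_)).neg
  unfold walkK
  refine Measurable.ennreal_tsum fun n => Finset.measurable_sum _ fun s _ => ?_
  split_ifs
  · refine Measurable.const_mul (ENNReal.measurable_ofReal.comp (Real.measurable_exp.comp (Measurable.neg ?_))) _
    unfold pathV
    exact Finset.measurable_sum _ fun i _ => (hV _).comp (hT _)
  · exact measurable_const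

def Good (T : Zd d → Ω → Ω) (R : Finset (Zd d)) (V : Ω → Zd d → ℝ) (u : (Fin d → ℝ) →ₗ[ℝ] ℝ) (ω : Ω) : Prop :=
  ∀ x, ∀ z ∈ R, - u (toR z) ≤ V (T x ω) z

section good
variable {T : Zd d → Ω → Ω} {R : Finset (Zd d)} {V : Ω → Zd d → ℝ} {p : Zd d → ℝ} {u : (Fin d → ℝ) →ₗ[ℝ] ℝ}
  {ω : Ω} (hg : Good T R V u ω) (ppos : ∀ z ∈ R, 0 < p z) (psum : ∑ z ∈ R, p z = 1)
include hg ppos psum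

lemma walkK_le (x y : Zd d) :
    walkK T V p R ω x y ≤ ENNReal.ofReal (Real.exp (u (toR y) - u (toR x))) := by
  have := walkK_super T V p R ω (fun x => ENNReal.ofReal (Real.exp (-u (toR x)))) (fun x => ?_) x y
  · have h1 := mul_le_mul_left this (ENNReal.ofReal (Real.exp (u (toR y))))
    rw [mul_assoc, ← ENNReal.ofReal_mul (Real.exp_pos _).le, ← Real.exp_add, ← ENNReal.ofReal_mul (Real.exp_pos _).le,
      ← Real.exp_add] at h1
    simpa [add_comm, sub_eq_add_neg] using h1
  · calc ∑ z ∈ R, cw T V p ω x z * ENNReal.ofReal (Real.exp (-u (toR (x + z))))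
        ≤ ∑ z ∈ R, ENNReal.ofReal (p z) * ENNReal.ofReal (Real.exp (-u (toR x))) := by
          refine Finset.sum_le_sum fun z hz => ?_
          unfold cw
          rw [mul_assoc, ← ENNReal.ofReal_mul (Real.exp_pos _).le, ← Real.exp_add]
          gcongr
          rw [toR_add, map_add]
          linarith [hg x z hz]
      _ = _ := by
          rw [← Finset.sum_mul, ← ENNReal.ofReal_sum_of_nonneg fun z hz => (ppos z hz).le, psum]
          simp

lemma Kt_le (x y : Zd d) :
    Kt T V p R ω x y ≤ ENNReal.ofReal (Real.exp (u (toR y) - u (toR x))) := by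
  unfold Kt
  split_ifs with h
  · subst h; simp
  · exact walkK_le hg ppos psum x y

lemma Kt_step (x y : Zd d) : ∑ z ∈ R, cw T V p ω x z * Kt T V p R ω (x+z) y ≤ Kt T V p R ω x y := by
  rw [← walkK_step]
  unfold Kt
  split_ifs with h
  · subst h; simpa using walkK_le hg ppos psum y y
  · exact le_rfl

lemma Kt_step1 (x y : Zd d) {z : Zd d} (hz : z ∈ R) :
    cw T V p ω x z * Kt T V p R ω (x+z) y ≤ Kt T V p R ω x y :=
  (Finset.single_le_sum (f := fun z => cw T V p ω x z * Kt T V p R ω (x+z) y) (fun _ _ => bot_le) hz).trans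
    (Kt_step hg ppos psum x y)

lemma Kt_pos_list (l : List (Zd d)) (hl : ∀ z ∈ l, z ∈ R) (x : Zd d) : 0 < Kt T V p R ω x (x + l.sum) := by
  induction l generalizing x with
  | nil => simp [Kt]
  | cons z l ih =>
    have hz := hl z (by simp)
    refine lt_of_lt_of_le ?_ (Kt_step1 hg ppos psum x _ hz)
    have := ih (fun w hw => hl w (by simp [hw])) (x + z)
    rw [List.sum_cons, ← add_assoc]
    refine ENNReal.mul_pos ?_ this.ne'
    unfold cw
    refine (ENNReal.mul_pos ?_ ?_).ne' <;> simp [Real.exp_pos, ppos z hz]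

lemma Kt_eq {x y : Zd d} (h : y - x ∈ Gp R) :
    Kt T V p R ω x y = ENNReal.ofReal (Real.exp (-aFun T V p R ω x y)) := by
  obtain ⟨l, hl, hs⟩ := Gp_iff_list.1 h
  have hpos := Kt_pos_list hg ppos psum l hl x
  rw [hs, add_sub_cancel] at hpos
  have htop : Kt T V p R ω x y ≠ ⊤ := ((Kt_le hg ppos psum x y).trans_lt ENNReal.ofReal_lt_top).ne
  have : aFun T V p R ω x y = - Real.log (Kt T V p R ω x y).toReal := by
    unfold aFun Kt
    split_ifs <;> simp
  rw [this, neg_neg, Real.exp_log (ENNReal.toReal_pos hpos.ne' htop), ENNReal.ofReal_toReal htop]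

lemma a_lower {x y : Zd d} (h : y - x ∈ Gp R) : u (toR x) - u (toR y) ≤ aFun T V p R ω x y := by
  have := Kt_le hg ppos psum x y
  rw [Kt_eq hg ppos psum h, ENNReal.ofReal_le_ofReal_iff (Real.exp_pos _).le, Real.exp_le_exp] at this
  linarith

lemma a_star0 {x y z : Zd d} (hz : z ∈ R) (h : y - (x + z) ∈ Gp R) :
    aFun T V p R ω x y ≤ V (T x ω) z - Real.log (p z) + aFun T V p R ω (x+z) y := by
  have h' : y - x ∈ Gp R := by
    have := Gp_add (Gp_mem hz) h
    rwa [show z + (y - (x+z)) = y - x by abel] at this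
  have := Kt_step1 hg ppos psum x y hz
  rw [Kt_eq hg ppos psum h, Kt_eq hg ppos psum h'] at this
  unfold cw at this
  rw [← ENNReal.ofReal_mul (ppos z hz).le, ← ENNReal.ofReal_mul (by have := ppos z hz; positivity),
    ENNReal.ofReal_le_ofReal_iff (Real.exp_pos _).le] at this
  nth_rw 1 [← Real.exp_log (ppos z hz)] at this
  rw [← Real.exp_add, ← Real.exp_add, Real.exp_le_exp] at this
  linarith

lemma a_star {x y z : Zd d} (hz : z ∈ R) (h : y - (x + z) ∈ Gp R) :
    aFun T V p R ω x y ≤ Wf V p (T x ω) z + aFun T V p R ω (x+z) y := by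
  have := a_star0 hg ppos psum hz h
  unfold Wf
  linarith [le_max_left (V (T x ω) z) 0]

lemma a_sum {R' : Finset (Zd d)} (hsub : R' ⊆ R) {t : Zd d} (ht : t ∈ Gp R) (h : ∀ z ∈ R', t - z ∈ Gp R) (hT0 : T 0 = id) :
    ∑ z ∈ R', p z * Real.exp (-(V ω z) - (aFun T V p R ω z t - aFun T V p R ω 0 t)) ≤ 1 := by
  have h1 := (Finset.sum_le_sum_of_subset hsub).trans (Kt_step hg ppos psum 0 t)
  rw [Kt_eq hg ppos psum (by simpa using ht)] at h1
  have h2 : ∑ z ∈ R', cw T V p ω 0 z * Kt T V p R ω (0+z) t =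
      ENNReal.ofReal (∑ z ∈ R', p z * Real.exp (-(V ω z) - aFun T V p R ω z t)) := by
    rw [ENNReal.ofReal_sum_of_nonneg fun z hz => by have := ppos z (hsub hz); positivity]
    refine Finset.sum_congr rfl fun z hz => ?_
    rw [zero_add, Kt_eq hg ppos psum (h z hz)]
    unfold cw
    rw [hT0, mul_assoc, ← ENNReal.ofReal_mul (Real.exp_pos _).le, ← Real.exp_add,
      ← ENNReal.ofReal_mul (ppos z (hsub hz)).le, id, sub_eq_add_neg]
  rw [h2, ENNReal.ofReal_le_ofReal_iff (Real.exp_pos _).le] at h1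
  calc _ = Real.exp (aFun T V p R ω 0 t) * ∑ z ∈ R', p z * Real.exp (-(V ω z) - aFun T V p R ω z t) := by
        rw [Finset.mul_sum]
        refine Finset.sum_congr rfl fun z _ => ?_
        rw [mul_left_comm, ← Real.exp_add]
        congr 2; ring
    _ ≤ Real.exp (aFun T V p R ω 0 t) * Real.exp (-aFun T V p R ω 0 t) := by gcongr
    _ = 1 := by rw [← Real.exp_add]; simp

lemma a_upper (Tadd : ∀ x y : Zd d, T (x + y) = T x ∘ T y) (l : List (Zd d)) (hl : ∀ z ∈ l, z ∈ R) (x : Zd d) :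
    aFun T V p R ω x (x + l.sum) ≤ ps T (Wf V p) l (T x ω) := by
  induction l generalizing x with
  | nil => simp [ps, aFun]
  | cons z l ih =>
    have hz := hl z (by simp)
    have hl' : ∀ w ∈ l, w ∈ R := fun w hw => hl w (by simp [hw])
    have h1 := ih hl' (x + z)
    rw [List.sum_cons, ← add_assoc]
    have h2 := a_star hg ppos psum hz (x := x) (y := x + z + l.sum) (by simpa using Gp_list l hl')
    simp only [ps]
    rw [add_comm x z, Tadd z x, Function.comp] at h1
    rw [add_comm x z] at h2 ⊢
    linarith

end good

section ctx
variable [MeasurableSpace Ω] {ℙ : Measure Ω} [IsProbabilityMeasure ℙ] {T : Zd d → Ω → Ω} {R : Finset (Zd d)}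
    {V : Ω → Zd d → ℝ} {p : Zd d → ℝ} {R' : Finset (Zd d)} {u : (Fin d → ℝ) →ₗ[ℝ] ℝ}
    (c : Ctx ℙ T R V p R' u)

lemma ae_shift (hmp : ∀ z : Zd d, MeasurePreserving (T z) ℙ ℙ) {P : Ω → Prop} (h : ∀ᵐ ω ∂ℙ, P ω) :
    ∀ᵐ ω ∂ℙ, ∀ x : Zd d, P (T x ω) :=
  ae_all_iff.2 fun x => (hmp x).quasiMeasurePreserving.ae h

lemma ps_int (hmp : ∀ z : Zd d, MeasurePreserving (T z) ℙ ℙ) {g : Ω → Zd d → ℝ} (l : List (Zd d))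
    (h : ∀ z ∈ l, Integrable (fun ω => g ω z) ℙ) : Integrable (ps T g l) ℙ ∧
      ∫ ω, ps T g l ω ∂ℙ = (l.map fun z => ∫ ω, g ω z ∂ℙ).sum := by
  induction l with
  | nil => simp [ps]
  | cons z l ih =>
    obtain ⟨h1, h2⟩ := ih fun w hw => h w (by simp [hw])
    have h3 := h z (by simp)
    have h4 : Integrable (fun ω => ps T g l (T z ω)) ℙ := (hmp z).integrable_comp_of_integrable h1
    have h5 : ∫ ω, ps T g l (T z ω) ∂ℙ = ∫ ω, ps T g l ω ∂ℙ := by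
      have := integral_map (μ := ℙ) (hmp z).measurable.aemeasurable (f := ps T g l)
        (by rw [(hmp z).map_eq]; exact h1.aestronglyMeasurable)
      rw [(hmp z).map_eq] at this
      exact this.symm
    refine ⟨h3.add h4, ?_⟩
    simp only [ps, List.map_cons, List.sum_cons]
    rw [integral_add h3 h4, h5, h2]

lemma integral_shift (hmp : ∀ z : Zd d, MeasurePreserving (T z) ℙ ℙ) {f : Ω → ℝ} (hf : AEStronglyMeasurable f ℙ)
    (z : Zd d) : ∫ ω, f (T z ω) ∂ℙ = ∫ ω, f ω ∂ℙ := by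
  have := integral_map (μ := ℙ) (hmp z).measurable.aemeasurable (f := f)
    (by rw [(hmp z).map_eq]; exact hf)
  rw [(hmp z).map_eq] at this
  exact this.symm

include c

lemma Ctx.good : ∀ᵐ ω ∂ℙ, Good T R V u ω := by
  unfold Good
  refine ae_shift (P := fun ω => ∀ z ∈ R, - u (toR z) ≤ V ω z) c.mp ?_
  exact (Finset.eventually_all R).2 c.hu

lemma Ctx.W_nonneg {z : Zd d} (hz : z ∈ R) (ω : Ω) : 0 ≤ Wf V p ω z := by
  unfold Wf
  linarith [le_max_right (V ω z) 0, Real.log_nonpos (c.ppos z hz).le (c.ple z hz)]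

lemma Ctx.W_int {z : Zd d} (hz : z ∈ R) : Integrable (fun ω => Wf V p ω z) ℙ :=
  (c.hV1 z hz).sub (integrable_const _)

lemma Ctx.a_meas (x y : Zd d) : Measurable fun ω => aFun T V p R ω x y :=
  aFun_meas T (fun z => (c.mp z).measurable) V c.mV p R x y

lemma Ctx.a_int0 {y : Zd d} (hy : y ∈ Gp R) : Integrable (fun ω => aFun T V p R ω 0 y) ℙ := by
  obtain ⟨l, hl, rfl⟩ := Gp_iff_list.1 hy
  have h1 := (ps_int c.mp (g := Wf V p) l fun z hz => c.W_int (hl z hz)).1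
  refine Integrable.mono' (h1.abs.add (integrable_const |u (toR l.sum)|)) (c.a_meas _ _).aestronglyMeasurable ?_
  filter_upwards [c.good] with ω hω
  have h2 := a_upper hω c.ppos c.psum c.Tadd l hl 0
  have h3 := a_lower hω c.ppos c.psum (x := 0) (y := l.sum) (by simpa using hy)
  simp only [zero_add, c.T0, id, toR_zero, map_zero, zero_sub] at h2 h3
  simp only [Pi.add_apply]
  rw [Real.norm_eq_abs, abs_le]
  constructor
  · linarith [le_abs_self (u (toR l.sum)), abs_nonneg (ps T (Wf V p) l ω)]
  · linarith [le_abs_self (ps T (Wf V p) l ω), abs_nonneg (u (toR l.sum))]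

omit [IsProbabilityMeasure ℙ] in
lemma Ctx.a_eq (ω : Ω) (x y : Zd d) : aFun T V p R ω x y = aFun T V p R (T x ω) 0 (y - x) := by
  rw [aFun_cov T c.Tadd]; simp

lemma Ctx.a_int {x y : Zd d} (hy : y - x ∈ Gp R) : Integrable (fun ω => aFun T V p R ω x y) ℙ := by
  simp only [c.a_eq _ x y]
  exact (c.mp x).integrable_comp_of_integrable (c.a_int0 hy)

omit c [IsProbabilityMeasure ℙ] in
variable (ℙ T V p R) in
def ef (y : Zd d) : ℝ := ∫ ω, aFun T V p R ω 0 y ∂ℙ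

variable (ℙ V p) in
def EW (z : Zd d) : ℝ := ∫ ω, Wf V p ω z ∂ℙ

lemma Ctx.EW_nonneg {z : Zd d} (hz : z ∈ R) : 0 ≤ EW ℙ V p z :=
  integral_nonneg fun ω => c.W_nonneg hz ω

lemma Ctx.a_integral (x y : Zd d) : ∫ ω, aFun T V p R ω x y ∂ℙ = ef ℙ T R V p (y - x) := by
  simp only [c.a_eq _ x y]
  exact integral_shift c.mp (c.a_meas _ _).aestronglyMeasurable x

lemma Ctx.e_step {y z : Zd d} (hy : y ∈ Gp R) (hz : z ∈ R) :
    ef ℙ T R V p (y + z) ≤ EW ℙ V p z + ef ℙ T R V p y := by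
  have h1 : ∫ ω, aFun T V p R ω z (y+z) ∂ℙ = ef ℙ T R V p y := by
    rw [c.a_integral]; simp
  rw [← h1, EW, ← integral_add (c.W_int hz) (c.a_int (by simpa using hy))]
  refine integral_mono_ae (c.a_int0 (Gp_add hy (Gp_mem hz))) ((c.W_int hz).add (c.a_int (by simpa using hy))) ?_
  filter_upwards [c.good] with ω hω
  have := a_star hω c.ppos c.psum hz (x := 0) (y := y + z) (by simpa using hy)
  simpa [c.T0] using this

lemma Ctx.e_list {y : Zd d} (hy : y ∈ Gp R) (l : List (Zd d)) (hl : ∀ z ∈ l, z ∈ R) :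
    ef ℙ T R V p (y + l.sum) ≤ ef ℙ T R V p y + (l.map (EW ℙ V p)).sum := by
  induction l generalizing y with
  | nil => simp
  | cons z l ih =>
    have hz := hl z (by simp)
    have h1 := ih (Gp_add hy (Gp_mem hz)) fun w hw => hl w (by simp [hw])
    have h2 := c.e_step hy hz
    simp only [List.sum_cons, List.map_cons]
    rw [← add_assoc]
    linarith

lemma Ctx.e_lower {y : Zd d} (hy : y ∈ Gp R) : - u (toR y) ≤ ef ℙ T R V p y := by
  have : ∫ _ω, - u (toR y) ∂ℙ = - u (toR y) := by simp
  rw [← this]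
  refine integral_mono_ae (integrable_const _) (c.a_int0 hy) ?_
  filter_upwards [c.good] with ω hω
  have h3 := a_lower hω c.ppos c.psum (x := 0) (y := y) (by simpa using hy)
  simpa [toR_zero] using h3

variable (ℙ V p R u) in
omit c in
def C0 : ℝ := ∑ z ∈ R, (EW ℙ V p z + |u (toR z)|)

lemma Ctx.C0_le {z : Zd d} (hz : z ∈ R) : EW ℙ V p z + |u (toR z)| ≤ C0 ℙ R V p u :=
  Finset.single_le_sum (f := fun z => EW ℙ V p z + |u (toR z)|)
    (fun w hw => add_nonneg (c.EW_nonneg hw) (abs_nonneg _)) hz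

lemma Ctx.C0_nonneg : 0 ≤ C0 ℙ R V p u :=
  Finset.sum_nonneg fun w hw => add_nonneg (c.EW_nonneg hw) (abs_nonneg _)

lemma Ctx.list_bound (l : List (Zd d)) (hl : ∀ z ∈ l, z ∈ R) :
    (l.map (EW ℙ V p)).sum ≤ C0 ℙ R V p u * l.length ∧ |u (toR l.sum)| ≤ C0 ℙ R V p u * l.length := by
  induction l with
  | nil => simp [toR_zero]
  | cons z l ih =>
    obtain ⟨h1, h2⟩ := ih fun w hw => hl w (by simp [hw])
    have h3 := c.C0_le (hl z (by simp))
    have h4 := c.EW_nonneg (hl z (by simp))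
    simp only [List.map_cons, List.sum_cons, List.length_cons, Nat.cast_add, Nat.cast_one, mul_add, mul_one,
      toR_add, map_add]
    have h5 := abs_add_le (u (toR z)) (u (toR l.sum))
    have h6 := abs_nonneg (u (toR z))
    constructor <;> linarith

lemma Ctx.e_abs (l : List (Zd d)) (hl : ∀ z ∈ l, z ∈ R) :
    |ef ℙ T R V p l.sum| ≤ C0 ℙ R V p u * l.length := by
  obtain ⟨h1, h2⟩ := c.list_bound l hl
  have h3 := c.e_list (Gp_zero R) l hl
  have h4 := c.e_lower (Gp_list l hl)
  have h5 : ef ℙ T R V p 0 = 0 := by simp [ef, aFun]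
  rw [zero_add, h5, zero_add] at h3
  rw [abs_le]
  constructor <;> linarith [le_abs_self (u (toR l.sum))]

lemma Ctx.diff_bound {x w t : Zd d} (hw : w ∈ R) (h : t - (x + w) ∈ Gp R) :
    ∫ ω, |aFun T V p R ω (x+w) t - aFun T V p R ω x t| ∂ℙ ≤
      2 * EW ℙ V p w + ef ℙ T R V p (t - (x + w)) - ef ℙ T R V p (t - x) := by
  have h' : t - x ∈ Gp R := by
    have := Gp_add (Gp_mem hw) h
    rwa [show w + (t - (x+w)) = t - x by abel] at this
  have hW : Integrable (fun ω => Wf V p (T x ω) w) ℙ := (c.mp x).integrable_comp_of_integrable (c.W_int hw)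
  have hW2 : ∫ ω, Wf V p (T x ω) w ∂ℙ = EW ℙ V p w :=
    integral_shift c.mp (c.W_int hw).aestronglyMeasurable x
  have hI : Integrable (fun ω => 2 * Wf V p (T x ω) w + aFun T V p R ω (x+w) t) ℙ := (hW.const_mul 2).add (c.a_int h)
  rw [← c.a_integral, ← c.a_integral, ← hW2, ← integral_const_mul, ← integral_add (hW.const_mul 2) (c.a_int h),
    ← integral_sub hI (c.a_int h')]
  refine integral_mono_ae ((c.a_int h).sub (c.a_int h')).abs (hI.sub (c.a_int h')) ?_
  filter_upwards [c.good] with ω hω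
  have h1 := a_star hω c.ppos c.psum hw h
  have h2 := c.W_nonneg hw (T x ω)
  rw [abs_le]
  constructor <;> linarith

end ctx

end RWRP

namespace RWRP
variable {d : ℕ} {Ω : Type*}

lemma GZ_eq (R : Finset (Zd d)) : GZ R = (AddSubgroup.closure (R : Set (Zd d)) : Set (Zd d)) := by
  ext x
  constructor
  · rintro ⟨b, rfl⟩
    exact sum_mem fun z hz => zsmul_mem (AddSubgroup.subset_closure hz) _
  · intro hx
    induction hx using AddSubgroup.closure_induction with
    | mem x hx => exact ⟨fun w => if w = x then 1 else 0, by simp [ite_smul, Finset.mem_coe.1 hx]⟩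
    | zero => exact ⟨fun _ => 0, by simp⟩
    | add x y _ _ hx hy =>
      obtain ⟨b, rfl⟩ := hx
      obtain ⟨c, rfl⟩ := hy
      exact ⟨b + c, by simp [add_smul, Finset.sum_add_distrib]⟩
    | neg x _ hx =>
      obtain ⟨b, rfl⟩ := hx
      exact ⟨-b, by simp⟩

lemma GZ_zero (R : Finset (Zd d)) : (0 : Zd d) ∈ GZ R := by rw [GZ_eq]; exact zero_mem _
lemma GZ_mem {R : Finset (Zd d)} {z : Zd d} (h : z ∈ R) : z ∈ GZ R := by
  rw [GZ_eq]; exact AddSubgroup.subset_closure h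
lemma GZ_add {R : Finset (Zd d)} {x y : Zd d} (hx : x ∈ GZ R) (hy : y ∈ GZ R) : x + y ∈ GZ R := by
  rw [GZ_eq] at *; exact add_mem hx hy
lemma GZ_sub {R : Finset (Zd d)} {x y : Zd d} (hx : x ∈ GZ R) (hy : y ∈ GZ R) : x - y ∈ GZ R := by
  rw [GZ_eq] at *; exact sub_mem hx hy
lemma GZ_neg {R : Finset (Zd d)} {x : Zd d} (hx : x ∈ GZ R) : -x ∈ GZ R := by
  rw [GZ_eq] at *; exact neg_mem hx
lemma Gp_GZ {R : Finset (Zd d)} {x : Zd d} (hx : x ∈ Gp R) : x ∈ GZ R := by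
  obtain ⟨l, hl, rfl⟩ := Gp_iff_list.1 hx
  rw [GZ_eq]
  exact list_sum_mem fun z hz => AddSubgroup.subset_closure (hl z hz)

section ctx
variable [MeasurableSpace Ω] {ℙ : Measure Ω} [IsProbabilityMeasure ℙ] {T : Zd d → Ω → Ω} {R : Finset (Zd d)}
    {V : Ω → Zd d → ℝ} {p : Zd d → ℝ} {R' : Finset (Zd d)} {u : (Fin d → ℝ) →ₗ[ℝ] ℝ}

lemma fatou_real {f g : ℕ → Ω → ℝ} {c s : ℝ} (hf : ∀ n, Integrable (f n) ℙ) (hc : ∀ n, ∀ᵐ ω ∂ℙ, c ≤ f n ω)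
    (hgm : ∀ n, AEStronglyMeasurable (g n) ℙ)
    (hg : ∀ n, ∀ᵐ ω ∂ℙ, g n ω ≤ f n ω) (hgl : ∀ᵐ ω ∂ℙ, Tendsto (fun n => g n ω) atTop (𝓝 s))
    {ε : ℝ} (hε : 0 < ε) : ∀ᶠ n in atTop, s - ε ≤ ∫ ω, f n ω ∂ℙ := by
  have hφm : ∀ n, AEStronglyMeasurable (fun ω => max c (min (g n ω) s)) ℙ := fun n =>
    aestronglyMeasurable_const.sup ((hgm n).inf aestronglyMeasurable_const)
  have hφb : ∀ n, ∀ᵐ ω ∂ℙ, ‖max c (min (g n ω) s)‖ ≤ |c| + |s| := by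
    intro n
    refine Eventually.of_forall fun ω => ?_
    rw [Real.norm_eq_abs, abs_le]
    constructor
    · linarith [neg_abs_le c, le_max_left c (min (g n ω) s), abs_nonneg s]
    · exact max_le (by linarith [le_abs_self c, abs_nonneg s])
        ((min_le_right _ _).trans (by linarith [le_abs_self s, abs_nonneg c]))
  have h1 : Tendsto (fun n => ∫ ω, max c (min (g n ω) s) ∂ℙ) atTop (𝓝 (∫ _ω, max c s ∂ℙ)) := by
    refine tendsto_integral_of_dominated_convergence (fun _ => |c| + |s|) hφm (integrable_const _) hφb ?_
    filter_upwards [hgl] with ω hω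
    have := (tendsto_const_nhds (x := c)).max (hω.min (tendsto_const_nhds (x := s)))
    rwa [min_self] at this
  have h2 : ∫ _ω, max c s ∂ℙ = max c s := by simp
  rw [h2] at h1
  have h3 := h1.eventually (lt_mem_nhds (show s - ε < max c s by linarith [le_max_right c s]))
  filter_upwards [h3] with n hn
  refine hn.le.trans (integral_mono_ae ?_ (hf n) ?_)
  · exact Integrable.of_bound (hφm n) _ (hφb n)
  · filter_upwards [hc n, hg n] with ω h1 h2
    exact max_le h1 ((min_le_left _ _).trans h2)

variable (c : Ctx ℙ T R V p R' u)
include c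

lemma Ctx.cov_all {B : Ω → Zd d → Zd d → ℝ} (hB : InKplus ℙ T V p R' B) : ∀ᵐ ω ∂ℙ, ∀ v : Zd d,
    ((∀ x ∈ GZ R', ∀ y ∈ GZ R', ∀ z ∈ GZ R', B (T v ω) x y + B (T v ω) y z = B (T v ω) x z) ∧
    (∀ x ∈ GZ R', ∀ y ∈ GZ R', ∀ z ∈ GZ R', B (T v ω) (x + z) (y + z) = B (T z (T v ω)) x y)) ∧
    ∑ z ∈ R', p z * Real.exp (-(V (T v ω) z) - B (T v ω) 0 z) ≤ 1 :=
  ae_shift (P := fun ω => ((∀ x ∈ GZ R', ∀ y ∈ GZ R', ∀ z ∈ GZ R', B ω x y + B ω y z = B ω x z) ∧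
    (∀ x ∈ GZ R', ∀ y ∈ GZ R', ∀ z ∈ GZ R', B ω (x + z) (y + z) = B (T z ω) x y)) ∧
    ∑ z ∈ R', p z * Real.exp (-(V ω z) - B ω 0 z) ≤ 1) c.mp
    ((hB.1.2.2.1.and hB.1.2.2.2).and hB.2)

lemma Ctx.B_lower {B : Ω → Zd d → Zd d → ℝ} (hB : InKplus ℙ T V p R' B) :
    ∀ᵐ ω ∂ℙ, ∀ y ∈ Gp R', - B ω 0 y ≤ aFun T V p R ω 0 y := by
  filter_upwards [c.good, c.cov_all hB] with ω hg hall y hy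
  have hco := (hall 0).1.1
  have hcv := (hall 0).1.2
  simp only [c.T0, id] at hco hcv
  have h00 : B ω 0 0 = 0 := by
    have := hco 0 (GZ_zero _) 0 (GZ_zero _) 0 (GZ_zero _)
    linarith
  by_cases hy0 : y = 0
  · subst hy0; simp [aFun, h00]
  set h : Zd d → ℝ≥0∞ := fun x => if y - x ∈ Gp R' then ENNReal.ofReal (Real.exp (-B ω 0 x)) else
    if y - x ∈ Gp R then ⊤ else 0 with hh
  have key := walkK_super T V p R ω h (fun x => ?_) 0 y
  · have e1 : h y = ENNReal.ofReal (Real.exp (-B ω 0 y)) := by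
      rw [hh]; simp [Gp_zero]
    have e2 : h 0 = 1 := by
      rw [hh]; simp [hy, h00]
    have e3 : walkK T V p R ω 0 y = ENNReal.ofReal (Real.exp (-aFun T V p R ω 0 y)) := by
      rw [← Kt_eq hg c.ppos c.psum (by simpa using Gp_mono c.sub hy), Kt, if_neg hy0]
    rw [e1, e2, e3, ← ENNReal.ofReal_mul (Real.exp_pos _).le, ← Real.exp_add, ← ENNReal.ofReal_one,
      ENNReal.ofReal_le_ofReal_iff zero_le_one, Real.exp_le_one_iff] at key
    linarith
  · by_cases h1 : y - x ∈ Gp R'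
    · have hx : x ∈ GZ R' := by
        have := GZ_sub (Gp_GZ hy) (Gp_GZ h1)
        simpa using this
      have e0 : h x = ENNReal.ofReal (Real.exp (-B ω 0 x)) := by rw [hh]; simp [h1]
      rw [e0]
      calc ∑ z ∈ R, cw T V p ω x z * h (x + z) ≤
          ∑ z ∈ R', cw T V p ω x z * ENNReal.ofReal (Real.exp (-B ω 0 (x + z))) := by
            have hsum : ∑ z ∈ R', cw T V p ω x z * ENNReal.ofReal (Real.exp (-B ω 0 (x + z))) =
                ∑ z ∈ R, if z ∈ R' then cw T V p ω x z * ENNReal.ofReal (Real.exp (-B ω 0 (x + z))) else 0 := by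
              rw [← Finset.sum_filter]
              congr 1
              ext z
              simp only [Finset.mem_filter]
              exact ⟨fun h => ⟨c.sub h, h⟩, fun h => h.2⟩
            rw [hsum]
            refine Finset.sum_le_sum fun z hz => ?_
            by_cases h2 : y - x - z ∈ Gp R
            · have h3 := c.step _ _ h1 hz h2
              have : h (x + z) = ENNReal.ofReal (Real.exp (-B ω 0 (x + z))) := by
                rw [hh]; simp [← sub_sub, h3.2]
              simp [this, h3.1]
            · have h3 : y - x - z ∉ Gp R' := fun h3 => h2 (Gp_mono c.sub h3)
              have : h (x + z) = 0 := by
                rw [hh]; simp [← sub_sub, h2, h3]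
              simp [this]
        _ = ENNReal.ofReal (∑ z ∈ R', (p z * Real.exp (-(V (T x ω) z) - B (T x ω) 0 z)) * Real.exp (-B ω 0 x)) := by
            rw [ENNReal.ofReal_sum_of_nonneg fun z hz => by have := c.ppos z (c.sub hz); positivity]
            refine Finset.sum_congr rfl fun z hz => ?_
            have h5 := hco 0 (GZ_zero _) x hx (x + z) (GZ_add hx (GZ_mem hz))
            have h6 := hcv 0 (GZ_zero _) z (GZ_mem hz) x hx
            rw [zero_add, add_comm z x] at h6
            unfold cw
            rw [mul_assoc, ← ENNReal.ofReal_mul (Real.exp_pos _).le, ← Real.exp_add,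
              ← ENNReal.ofReal_mul (c.ppos z (c.sub hz)).le, mul_assoc, ← Real.exp_add, ← h6, ← h5]
            congr 3; ring
        _ ≤ _ := by
            rw [← Finset.sum_mul]
            refine ENNReal.ofReal_le_ofReal ?_
            exact mul_le_of_le_one_left (Real.exp_pos _).le (hall x).2
    · by_cases h2 : y - x ∈ Gp R
      · have : h x = ⊤ := by rw [hh]; simp [h1, h2]
        rw [this]; exact le_top
      · rw [Finset.sum_eq_zero]
        · exact bot_le
        · intro z hz
          have h3 : y - x - z ∉ Gp R := by
            intro h3
            apply h2
            have := Gp_add (Gp_mem hz) h3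
            simpa using this
          have h4 : y - x - z ∉ Gp R' := fun h4 => h3 (Gp_mono c.sub h4)
          have : h (x + z) = 0 := by rw [hh]; simp [← sub_sub, h3, h4]
          rw [this, mul_zero]

lemma Ctx.B_step {B : Ω → Zd d → Zd d → ℝ} {ω : Ω}
    (h : ∑ z ∈ R', p z * Real.exp (-(V ω z) - B ω 0 z) ≤ 1) {z : Zd d} (hz : z ∈ R') :
    - Wf V p ω z ≤ B ω 0 z := by
  have hp := c.ppos z (c.sub hz)
  have h1 := (Finset.single_le_sum (f := fun z => p z * Real.exp (-(V ω z) - B ω 0 z))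
    (fun w hw => by have := c.ppos w (c.sub hw); positivity) hz).trans h
  nth_rw 1 [← Real.exp_log hp] at h1
  rw [← Real.exp_add, Real.exp_le_one_iff] at h1
  unfold Wf
  linarith [le_max_left (V ω z) 0]

lemma Ctx.B_path {B : Ω → Zd d → Zd d → ℝ} (l : List (Zd d)) (hl : ∀ z ∈ l, z ∈ R') {ω : Ω} 
    (h : ∀ v : Zd d,
    ((∀ x ∈ GZ R', ∀ y ∈ GZ R', ∀ z ∈ GZ R', B (T v ω) x y + B (T v ω) y z = B (T v ω) x z) ∧
    (∀ x ∈ GZ R', ∀ y ∈ GZ R', ∀ z ∈ GZ R', B (T v ω) (x + z) (y + z) = B (T z (T v ω)) x y)) ∧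
    ∑ z ∈ R', p z * Real.exp (-(V (T v ω) z) - B (T v ω) 0 z) ≤ 1) (M : ℝ) (hM : 0 ≤ M) :
    ps T (fun ω z => B ω 0 z) l ω = B ω 0 l.sum ∧ 
    -M * l.length ≤ ps T (fun ω z => B ω 0 z) l ω + ps T (fun ω z => max (Wf V p ω z - M) 0) l ω := by
  induction l generalizing ω with
  | nil =>
    have := (h 0).1.1 0 (GZ_zero _) 0 (GZ_zero _) 0 (GZ_zero _)
    simp only [c.T0, id] at this
    simp only [ps, List.sum_nil, List.length_nil]
    constructor
    · linarith
    · simp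
  | cons z l ih =>
    have hz := hl z (by simp)
    have hl' : ∀ w ∈ l, w ∈ R' := fun w hw => hl w (by simp [hw])
    obtain ⟨h1, h2⟩ := ih hl' (ω := T z ω) (fun v => by
      have := h (v + z)
      rwa [c.Tadd] at this)
    have hls : l.sum ∈ GZ R' := Gp_GZ (Gp_list l hl')
    have h3 := (h 0).1.1 0 (GZ_zero _) z (GZ_mem hz) (z + l.sum) (GZ_add (GZ_mem hz) hls)
    have h4 := (h 0).1.2 0 (GZ_zero _) l.sum hls z (GZ_mem hz)
    have h5 := c.B_step (h 0).2 hz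
    simp only [c.T0, id] at h3 h4 h5
    rw [zero_add, add_comm l.sum] at h4
    simp only [ps, List.sum_cons, List.length_cons, Nat.cast_add, Nat.cast_one]
    constructor
    · rw [h1, ← h4, h3]
    · linarith [le_max_left (Wf V p ω z - M) 0]

lemma Ctx.part1 {B : Ω → Zd d → Zd d → ℝ} (hB : InKplus ℙ T V p R' B) {γ : Zd d → ℝ} (hγ : ∀ z, 0 ≤ γ z)
    {s : ℝ} (hs : ∀ᵐ ω ∂ℙ, Tendsto (fun n : ℕ => aFun T V p R ω 0 (∑ z ∈ R', ⌊n * γ z⌋₊ • z) / n) atTop (𝓝 s)) :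
    - ∑ z ∈ R', γ z * ∫ ω, B ω 0 z ∂ℙ ≤ s := by
  have hBint : ∀ z ∈ R', Integrable (fun ω => B ω 0 z) ℙ := fun z hz => hB.1.2.1 0 (GZ_zero _) z (GZ_mem hz)
  have hWint : ∀ M : ℝ, ∀ z ∈ R', Integrable (fun ω => max (Wf V p ω z - M) 0) ℙ := fun M z hz =>
    ((c.W_int (c.sub hz)).sub (integrable_const M)).sup (integrable_const 0)
  have key : ∀ M : ℕ, -s ≤ ∑ z ∈ R', γ z * ((∫ ω, B ω 0 z ∂ℙ) + ∫ ω, max (Wf V p ω z - M) 0 ∂ℙ) := by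
    intro M
    choose l hl hls hlen hlφ using fun n : ℕ => exists_list R' (fun z => ⌊n * γ z⌋₊)
    have i1 := fun n => ps_int c.mp (g := fun ω z => B ω 0 z) (l n) fun z hz => hBint z (hl n z hz)
    have i2 := fun n => ps_int c.mp (g := fun ω z => max (Wf V p ω z - M) 0) (l n) fun z hz => hWint M z (hl n z hz)
    have hfl : ∀ z, Tendsto (fun n : ℕ => (⌊n * γ z⌋₊ : ℝ) / n) atTop (𝓝 (γ z)) := by
      intro z
      have := (tendsto_nat_floor_mul_div_atTop (hγ z)).comp (tendsto_natCast_atTop_atTop (R := ℝ))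
      simpa [Function.comp_def, mul_comm] using this
    have hlim : Tendsto (fun n : ℕ => ∫ ω, (ps T (fun ω z => B ω 0 z) (l n) ω + ps T (fun ω z => max (Wf V p ω z - M) 0) (l n) ω) / n ∂ℙ)
        atTop (𝓝 (∑ z ∈ R', γ z * ((∫ ω, B ω 0 z ∂ℙ) + ∫ ω, max (Wf V p ω z - M) 0 ∂ℙ))) := by
      have e : ∀ n : ℕ, ∫ ω, (ps T (fun ω z => B ω 0 z) (l n) ω + ps T (fun ω z => max (Wf V p ω z - M) 0) (l n) ω) / n ∂ℙ
          = ∑ z ∈ R', ((⌊n * γ z⌋₊ : ℝ) / n) * ((∫ ω, B ω 0 z ∂ℙ) + ∫ ω, max (Wf V p ω z - M) 0 ∂ℙ) := by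
        intro n
        rw [integral_div, integral_add (i1 n).1 (i2 n).1, (i1 n).2, (i2 n).2, hlφ, hlφ, ← Finset.sum_add_distrib,
          Finset.sum_div]
        refine Finset.sum_congr rfl fun z _ => ?_
        ring
      simp only [e]
      exact tendsto_finsetSum _ fun z _ => (hfl z).mul_const _
    refine le_of_forall_pos_le_add fun ε hε => ?_
    have hev := fatou_real (ℙ := ℙ) (s := -s) (c := -M * ∑ z ∈ R', γ z) (ε := ε)
      (f := fun n ω => (ps T (fun ω z => B ω 0 z) (l n) ω + ps T (fun ω z => max (Wf V p ω z - M) 0) (l n) ω) / n)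
      (g := fun n ω => - (aFun T V p R ω 0 (∑ z ∈ R', ⌊n * γ z⌋₊ • z) / n))
      (fun n => ((i1 n).1.add (i2 n).1).div_const _) (fun n => ?_)
      (fun n => ((c.a_meas _ _).div_const _).neg.aestronglyMeasurable) (fun n => ?_)
      (by filter_upwards [hs] with ω hω using hω.neg) hε
    · have := ge_of_tendsto hlim hev
      linarith
    · filter_upwards [c.cov_all hB] with ω hω
      have h := (c.B_path (l n) (hl n) hω M (Nat.cast_nonneg _)).2
      rcases Nat.eq_zero_or_pos n with h0 | h0
      · subst h0
        have : 0 ≤ ∑ z ∈ R', γ z := Finset.sum_nonneg fun z _ => hγ z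
        simp; positivity
      · have hn : (0:ℝ) < n := by exact_mod_cast h0
        rw [le_div_iff₀ hn]
        refine le_trans ?_ h
        have : ((l n).length : ℝ) ≤ (∑ z ∈ R', γ z) * n := by
          rw [hlen, Finset.sum_mul]
          push_cast
          exact Finset.sum_le_sum fun z _ => (Nat.floor_le (by have := hγ z; positivity)).trans_eq (mul_comm _ _)
        have hM : (0:ℝ) ≤ M := Nat.cast_nonneg _
        nlinarith
    · filter_upwards [c.cov_all hB, c.B_lower hB] with ω hω hω2
      have h := (c.B_path (l n) (hl n) hω 0 le_rfl).1
      have h2 := hω2 _ (Gp_list (l n) (hl n))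
      have h3 : 0 ≤ ps T (fun ω z => max (Wf V p ω z - M) 0) (l n) ω := by
        generalize l n = l'
        clear * -
        induction l' generalizing ω with
        | nil => simp [ps]
        | cons z l ih => simp only [ps]; have := ih (ω := T z ω); positivity
      rw [h, ← neg_div, ← hls]
      gcongr
      linarith
  have hM : ∀ z ∈ R', Tendsto (fun M : ℕ => ∫ ω, max (Wf V p ω z - M) 0 ∂ℙ) atTop (𝓝 0) := by
    intro z hz
    have := tendsto_integral_of_dominated_convergence (μ := ℙ) (F := fun (M : ℕ) ω => max (Wf V p ω z - M) 0) (f := fun _ => 0)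
      (fun ω => Wf V p ω z) (fun M => (hWint M z hz).aestronglyMeasurable) (c.W_int (c.sub hz))
      (fun M => Eventually.of_forall fun ω => by
        rw [Real.norm_eq_abs, abs_of_nonneg (le_max_right _ _)]
        exact max_le (by linarith [Nat.cast_nonneg (α := ℝ) M]) (c.W_nonneg (c.sub hz) ω))
      (Eventually.of_forall fun ω => by
        refine tendsto_const_nhds.congr' ?_
        filter_upwards [eventually_ge_atTop ⌈Wf V p ω z⌉₊] with M hM
        rw [max_eq_right]
        linarith [Nat.ceil_le.1 hM])
    simpa using this
  have hlim : Tendsto (fun M : ℕ => ∑ z ∈ R', γ z * ((∫ ω, B ω 0 z ∂ℙ) + ∫ ω, max (Wf V p ω z - M) 0 ∂ℙ)) atTop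
      (𝓝 (∑ z ∈ R', γ z * ((∫ ω, B ω 0 z ∂ℙ) + 0))) :=
    tendsto_finsetSum _ fun z hz => (tendsto_const_nhds.add (hM z hz)).const_mul _
  have := ge_of_tendsto' hlim key
  simp only [add_zero] at this
  linarith

end ctx
end RWRP

namespace RWRP
variable {d : ℕ} {Ω : Type*}

section gen
variable [MeasurableSpace Ω] {ℙ : Measure Ω} [IsProbabilityMeasure ℙ]

lemma ae_summable {F : ℕ → Ω → ℝ} (hm : ∀ k, Measurable (F k)) (h : ∑' k, ∫⁻ ω, ‖F k ω‖ₑ ∂ℙ ≠ ⊤) :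
    ∀ᵐ ω ∂ℙ, Summable fun k => F k ω := by
  rw [← lintegral_tsum fun k => (hm k).enorm.aemeasurable] at h
  have h2 := ae_lt_top' (AEMeasurable.tsum fun k => (hm k).enorm.aemeasurable) h
  filter_upwards [h2] with ω hω
  have := (ENNReal.tsum_coe_ne_top_iff_summable (f := fun k => ‖F k ω‖₊)).1 hω.ne
  exact Summable.of_nnnorm this

lemma geom_ne_top (C : ℝ≥0∞) (hC : C ≠ ⊤) {f : ℕ → ℝ≥0∞} (h : ∀ k, f k ≤ C * 2⁻¹ ^ k) : ∑' k, f k ≠ ⊤ := by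
  refine ((ENNReal.tsum_le_tsum h).trans_lt ?_).ne
  rw [ENNReal.tsum_mul_left, ENNReal.tsum_geometric]
  refine ENNReal.mul_lt_top hC.lt_top ?_
  simp

lemma fatou2 {F : ℕ → Ω → ℝ} {L : Ω → ℝ} {C : ℝ} (hF : ∀ k, Integrable (F k) ℙ) (h0 : ∀ k, ∀ᵐ ω ∂ℙ, 0 ≤ F k ω)
    (hl : ∀ᵐ ω ∂ℙ, Tendsto (fun k => F k ω) atTop (𝓝 (L ω))) (hC : ∀ᶠ k in atTop, ∫ ω, F k ω ∂ℙ ≤ C) :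
    Integrable L ℙ ∧ ∫ ω, L ω ∂ℙ ≤ C := by
  have hLm : AEStronglyMeasurable L ℙ := aestronglyMeasurable_of_tendsto_ae atTop (fun k => (hF k).aestronglyMeasurable) hl
  have hL0 : 0 ≤ᵐ[ℙ] L := by
    filter_upwards [hl, ae_all_iff.2 h0] with ω h1 h2
    exact ge_of_tendsto' h1 h2
  have hC0 : 0 ≤ C := by
    obtain ⟨k, hk⟩ := hC.exists
    exact (integral_nonneg_of_ae (h0 k)).trans hk
  have key : ∫⁻ ω, ENNReal.ofReal (L ω) ∂ℙ ≤ ENNReal.ofReal C := by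
    calc ∫⁻ ω, ENNReal.ofReal (L ω) ∂ℙ = ∫⁻ ω, liminf (fun k => ENNReal.ofReal (F k ω)) atTop ∂ℙ := by
          refine lintegral_congr_ae ?_
          filter_upwards [hl] with ω hω
          exact ((ENNReal.tendsto_ofReal hω).liminf_eq).symm
      _ ≤ liminf (fun k => ∫⁻ ω, ENNReal.ofReal (F k ω) ∂ℙ) atTop :=
          lintegral_liminf_le' fun k => (hF k).aestronglyMeasurable.aemeasurable.ennreal_ofReal
      _ ≤ ENNReal.ofReal C := by
          refine liminf_le_of_frequently_le' (Eventually.frequently ?_)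
          filter_upwards [hC] with k hk
          rw [← ofReal_integral_eq_lintegral_ofReal (hF k) (h0 k)]
          exact ENNReal.ofReal_le_ofReal hk
  have hLi : Integrable L ℙ := ⟨hLm, by
    rw [hasFiniteIntegral_iff_ofReal hL0]
    exact key.trans_lt ENNReal.ofReal_lt_top⟩
  refine ⟨hLi, ?_⟩
  rw [← ofReal_integral_eq_lintegral_ofReal hLi hL0] at key
  exact (ENNReal.ofReal_le_ofReal_iff hC0).1 key

end gen

def phi (V : Ω → Zd d → ℝ) (p : Zd d → ℝ) (g : Ω → Zd d → ℝ) (ω : Ω) (z : Zd d) : ℝ :=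
  Real.exp ((Real.log (p z) - V ω z - (g ω z - g ω 0)) / 2)

def Phi (V : Ω → Zd d → ℝ) (p : Zd d → ℝ) (R' : Finset (Zd d)) (g : Ω → Zd d → ℝ) (ω : Ω) : ℝ :=
  ∑ z ∈ R', phi V p g ω z ^ 2

def Dfct (T : Zd d → Ω → Ω) (g : Ω → Zd d → ℝ) (x v : Zd d) (ω : Ω) : ℝ :=
  (g ω (x + v) - g ω v) - (g (T v ω) x - g (T v ω) 0)

section ctx
variable [MeasurableSpace Ω] {ℙ : Measure Ω} [IsProbabilityMeasure ℙ] {T : Zd d → Ω → Ω} {R : Finset (Zd d)}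
    {V : Ω → Zd d → ℝ} {p : Zd d → ℝ} {R' : Finset (Zd d)} {u : (Fin d → ℝ) →ₗ[ℝ] ℝ}

omit [MeasurableSpace Ω] in
lemma phi_sq (hp : ∀ z ∈ R', 0 < p z) (g : Ω → Zd d → ℝ) (ω : Ω) {z : Zd d} (hz : z ∈ R') :
    phi V p g ω z ^ 2 = p z * Real.exp (-(V ω z) - (g ω z - g ω 0)) := by
  unfold phi
  rw [← Real.exp_nat_mul]
  nth_rw 2 [← Real.exp_log (hp z hz)]
  rw [← Real.exp_add]
  congr 1
  push_cast; ring

omit [MeasurableSpace Ω] in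
lemma Phi_convex (g h : Ω → Zd d → ℝ) {a b : ℝ} (ha : 0 ≤ a) (hb : 0 ≤ b) (hab : a + b = 1) (ω : Ω) :
    Phi V p R' (a • g + b • h) ω ≤ a * Phi V p R' g ω + b * Phi V p R' h ω := by
  unfold Phi
  rw [Finset.mul_sum, Finset.mul_sum, ← Finset.sum_add_distrib]
  refine Finset.sum_le_sum fun z _ => ?_
  unfold phi
  simp only [← Real.exp_nat_mul]
  have := convexOn_exp.2 (mem_univ (((2:ℕ):ℝ) * ((Real.log (p z) - V ω z - (g ω z - g ω 0)) / 2)))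
    (mem_univ (((2:ℕ):ℝ) * ((Real.log (p z) - V ω z - (h ω z - h ω 0)) / 2))) ha hb hab
  refine le_trans (le_of_eq ?_) this
  congr 1
  simp only [Pi.add_apply, Pi.smul_apply, smul_eq_mul]
  obtain rfl : b = 1 - a := by linarith
  push_cast; ring

omit [MeasurableSpace Ω] in
lemma Phi_mid (g h : Ω → Zd d → ℝ) (ω : Ω) :
    (Phi V p R' g ω + Phi V p R' h ω) / 2 - Phi V p R' ((1/2:ℝ) • g + (1/2:ℝ) • h) ω =
      ∑ z ∈ R', (phi V p g ω z - phi V p h ω z) ^ 2 / 2 := by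
  unfold Phi
  rw [← Finset.sum_add_distrib, Finset.sum_div, ← Finset.sum_sub_distrib]
  refine Finset.sum_congr rfl fun z _ => ?_
  have : phi V p ((1/2:ℝ) • g + (1/2:ℝ) • h) ω z ^ 2 = phi V p g ω z * phi V p h ω z := by
    unfold phi
    rw [← Real.exp_nat_mul, ← Real.exp_add]
    congr 1
    simp only [Pi.add_apply, Pi.smul_apply, smul_eq_mul]
    push_cast; ring
  rw [this]; ring

lemma phi_meas (hV : ∀ z : Zd d, Measurable fun ω => V ω z) {g : Ω → Zd d → ℝ}
    (hg : ∀ x, Measurable fun ω => g ω x) (z : Zd d) : Measurable fun ω => phi V p g ω z := by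
  unfold phi
  have := hV z
  have := hg z
  have := hg 0
  fun_prop

variable (ℙ V p R') in
def Q1 : Set (Ω → Zd d → ℝ) := {g | (∀ x, Measurable fun ω => g ω x) ∧
  (∀ z ∈ R', Integrable (fun ω => g ω z - g ω 0) ℙ) ∧ ∀ᵐ ω ∂ℙ, Phi V p R' g ω ≤ 1}

omit [IsProbabilityMeasure ℙ] in
lemma Q1_convex : Convex ℝ (Q1 ℙ V p R') := by
  intro g hg h hh a b ha hb hab
  refine ⟨fun x => ?_, fun z hz => ?_, ?_⟩
  · exact ((hg.1 x).const_mul a).add ((hh.1 x).const_mul b)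
  · have := ((hg.2.1 z hz).const_mul a).add ((hh.2.1 z hz).const_mul b)
    refine this.congr (Eventually.of_forall fun ω => ?_)
    simp only [Pi.add_apply, Pi.smul_apply, smul_eq_mul]
    ring
  · filter_upwards [hg.2.2, hh.2.2] with ω h1 h2
    refine (Phi_convex g h ha hb hab ω).trans ?_
    nlinarith

variable (ℙ V p R') in
def Q2 (cf : Zd d → ℝ) (s : ℝ) : Set (Ω → Zd d → ℝ) := {g | (∀ z ∈ R', Integrable (fun ω => g ω z - g ω 0) ℙ) ∧
  ∑ z ∈ R', cf z * ∫ ω, (g ω z - g ω 0) ∂ℙ ≤ s}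

omit [IsProbabilityMeasure ℙ] in
lemma Q2_convex (cf : Zd d → ℝ) (s : ℝ) : Convex ℝ (Q2 ℙ R' cf s) := by
  intro g hg h hh a b ha hb hab
  have e : ∀ z ∈ R', (fun ω => (a • g + b • h) ω z - (a • g + b • h) ω 0) =
      fun ω => a * (g ω z - g ω 0) + b * (h ω z - h ω 0) := by
    intro z _
    funext ω
    simp only [Pi.add_apply, Pi.smul_apply, smul_eq_mul]
    ring
  refine ⟨fun z hz => ?_, ?_⟩
  · rw [e z hz]
    exact ((hg.1 z hz).const_mul a).add ((hh.1 z hz).const_mul b)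
  · calc _ = a * ∑ z ∈ R', cf z * ∫ ω, (g ω z - g ω 0) ∂ℙ + b * ∑ z ∈ R', cf z * ∫ ω, (h ω z - h ω 0) ∂ℙ := by
          rw [Finset.mul_sum, Finset.mul_sum, ← Finset.sum_add_distrib]
          refine Finset.sum_congr rfl fun z hz => ?_
          rw [e z hz, integral_add ((hg.1 z hz).const_mul a) ((hh.1 z hz).const_mul b), integral_const_mul,
            integral_const_mul]
          ring
      _ ≤ a * s + b * s := add_le_add (mul_le_mul_of_nonneg_left hg.2 ha) (mul_le_mul_of_nonneg_left hh.2 hb)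
      _ = s := by rw [← add_mul, hab, one_mul]

omit [MeasurableSpace Ω] in
lemma Dfct_lin (g h : Ω → Zd d → ℝ) (a b : ℝ) (x v : Zd d) (ω : Ω) :
    Dfct T (a • g + b • h) x v ω = a * Dfct T g x v ω + b * Dfct T h x v ω := by
  unfold Dfct
  simp only [Pi.add_apply, Pi.smul_apply, smul_eq_mul]
  ring

lemma Dfct_meas (hT : ∀ z, Measurable (T z)) {g : Ω → Zd d → ℝ} (hg : ∀ x, Measurable fun ω => g ω x) (x v : Zd d) :
    Measurable (Dfct T g x v) := by
  unfold Dfct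
  exact ((hg _).sub (hg _)).sub (((hg x).comp (hT v)).sub ((hg 0).comp (hT v)))

variable (ℙ T) in
def Q3 (x v : Zd d) (δ : ℝ≥0∞) : Set (Ω → Zd d → ℝ) := {g | (∀ x, Measurable fun ω => g ω x) ∧
  ∫⁻ ω, ‖Dfct T g x v ω‖ₑ ∂ℙ ≤ δ}

omit [IsProbabilityMeasure ℙ] in
lemma Q3_convex (hT : ∀ z, Measurable (T z)) (x v : Zd d) (δ : ℝ≥0∞) : Convex ℝ (Q3 ℙ T x v δ) := by
  intro g hg h hh a b ha hb hab
  refine ⟨fun x => ((hg.1 x).const_mul a).add ((hh.1 x).const_mul b), ?_⟩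
  have hgm := Dfct_meas hT hg.1 x v
  have hhm := Dfct_meas hT hh.1 x v
  calc ∫⁻ ω, ‖Dfct T (a • g + b • h) x v ω‖ₑ ∂ℙ
      ≤ ∫⁻ ω, (ENNReal.ofReal a * ‖Dfct T g x v ω‖ₑ + ENNReal.ofReal b * ‖Dfct T h x v ω‖ₑ) ∂ℙ := by
        refine lintegral_mono fun ω => ?_
        rw [Dfct_lin]
        refine (enorm_add_le _ _).trans ?_
        rw [enorm_mul, enorm_mul, Real.enorm_of_nonneg ha, Real.enorm_of_nonneg hb]
    _ = ENNReal.ofReal a * ∫⁻ ω, ‖Dfct T g x v ω‖ₑ ∂ℙ + ENNReal.ofReal b * ∫⁻ ω, ‖Dfct T h x v ω‖ₑ ∂ℙ := by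
        rw [lintegral_add_left (hgm.enorm.const_mul _), lintegral_const_mul _ hgm.enorm, lintegral_const_mul _ hhm.enorm]
    _ ≤ ENNReal.ofReal a * δ + ENNReal.ofReal b * δ := by
        gcongr
        · exact hg.2
        · exact hh.2
    _ = δ := by rw [← add_mul, ← ENNReal.ofReal_add ha hb, hab]; simp

lemma Phi_nonneg (g : Ω → Zd d → ℝ) (ω : Ω) : 0 ≤ Phi V p R' g ω :=
  Finset.sum_nonneg fun z _ => sq_nonneg _

lemma Phi_int (hV : ∀ z : Zd d, Measurable fun ω => V ω z) {g : Ω → Zd d → ℝ} (hg : g ∈ Q1 ℙ V p R') :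
    Integrable (Phi V p R' g) ℙ := by
  refine Integrable.of_bound (C := 1) ?_ ?_
  · unfold Phi
    exact (Finset.measurable_sum _ fun z _ => (phi_meas hV hg.1 z).pow_const 2).aestronglyMeasurable
  · filter_upwards [hg.2.2] with ω hω
    rwa [Real.norm_eq_abs, abs_of_nonneg (Phi_nonneg g ω)]

/-- fast-Cauchy convex combinations -/
lemma exists_comb (hV : ∀ z : Zd d, Measurable fun ω => V ω z) (hT : ∀ z, Measurable (T z))
    (f : ℕ → Ω → Zd d → ℝ) (hf : ∀ n, f n ∈ Q1 ℙ V p R')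
    (P3 : ∀ x ∈ GZ R', ∀ v ∈ GZ R', Tendsto (fun n => ∫⁻ ω, ‖Dfct T (f n) x v ω‖ₑ ∂ℙ) atTop (𝓝 0)) :
    ∃ (N : ℕ → ℕ) (g : ℕ → Ω → Zd d → ℝ), StrictMono N ∧ (∀ k, g k ∈ convexHull ℝ (f '' Ici (N k))) ∧
      (∀ k, ∫ ω, ∑ z ∈ R', (phi V p (g k) ω z - phi V p (g (k+1)) ω z) ^ 2 / 2 ∂ℙ ≤ 2 * (1/4:ℝ)^k) ∧
      (∀ x ∈ GZ R', ∀ v ∈ GZ R', ∀ᶠ k in atTop, ∫⁻ ω, ‖Dfct T (g k) x v ω‖ₑ ∂ℙ ≤ 2⁻¹ ^ k) := by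
  set C : ℕ → Set (Ω → Zd d → ℝ) := fun n => convexHull ℝ (f '' Ici n) with hC
  have hCanti : Antitone C := fun m n h => convexHull_mono (image_mono (Ici_subset_Ici.2 h))
  have hCne : ∀ n, (C n).Nonempty := fun n => ⟨f n, subset_convexHull ℝ _ ⟨n, self_mem_Ici, rfl⟩⟩
  have hCQ : ∀ n, C n ⊆ Q1 ℙ V p R' := fun n => convexHull_min (by rintro _ ⟨m, _, rfl⟩; exact hf m) Q1_convex
  set J : (Ω → Zd d → ℝ) → ℝ := fun g => ∫ ω, Phi V p R' g ω ∂ℙ with hJ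
  have hJ0 : ∀ g, 0 ≤ J g := fun g => integral_nonneg fun ω => Phi_nonneg g ω
  have hJ1 : ∀ n, ∀ g ∈ C n, J g ≤ 1 := by
    intro n g hg
    have hg := hCQ n hg
    calc J g ≤ ∫ _ω, (1:ℝ) ∂ℙ := integral_mono_ae (Phi_int hV hg) (integrable_const _) hg.2.2
      _ = 1 := by simp
  set j : ℕ → ℝ := fun n => sInf (J '' C n) with hj
  have hbb : ∀ n, BddBelow (J '' C n) := fun n => ⟨0, by rintro _ ⟨g, _, rfl⟩; exact hJ0 g⟩
  have hjm : Monotone j := fun m n h => csInf_le_csInf (hbb m) ((hCne n).image J) (image_mono (hCanti h))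
  have hj1 : ∀ n, j n ≤ 1 := fun n => by
    obtain ⟨g, hg⟩ := hCne n
    exact (csInf_le (hbb n) ⟨g, hg, rfl⟩).trans (hJ1 n g hg)
  have hjlim := tendsto_atTop_ciSup hjm ⟨1, by rintro _ ⟨n, rfl⟩; exact hj1 n⟩
  have hjle := fun n => le_ciSup (f := j) ⟨1, by rintro _ ⟨n, rfl⟩; exact hj1 n⟩ n
  set j0 := ⨆ n, j n
  obtain ⟨e, he⟩ := exists_surjective_nat (Zd d × Zd d)
  obtain ⟨N, hN, hNp⟩ := Filter.extraction_forall_of_eventually (P := fun k n => j0 - (1/4:ℝ)^k ≤ j n ∧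
    ∀ i ∈ Finset.range k, (e i).1 ∈ GZ R' → (e i).2 ∈ GZ R' → ∀ m ≥ n, ∫⁻ ω, ‖Dfct T (f m) (e i).1 (e i).2 ω‖ₑ ∂ℙ ≤ 2⁻¹ ^ k)
    (fun k => by
      refine (hjlim.eventually (le_mem_nhds (by linarith [show (0:ℝ) < (1/4:ℝ)^k by positivity]))).and ?_
      rw [Finset.eventually_all]
      intro i _
      by_cases h1 : (e i).1 ∈ GZ R'
      · by_cases h2 : (e i).2 ∈ GZ R'
        · simp only [h1, h2, true_imp_iff]
          rw [eventually_forall_ge_atTop]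
          refine (P3 _ h1 _ h2).eventually (Iic_mem_nhds ?_)
          exact ENNReal.pow_pos (by simp) k
        · simp [h2]
      · simp [h1])
  have hch : ∀ k, ∃ g ∈ C (N k), J g ≤ j (N k) + (1/4:ℝ)^k := by
    intro k
    obtain ⟨_, ⟨g, hg, rfl⟩, hlt⟩ := exists_lt_of_csInf_lt ((hCne (N k)).image J)
      (show sInf (J '' C (N k)) < j (N k) + (1/4:ℝ)^k by
        have : (0:ℝ) < (1/4:ℝ)^k := by positivity
        simp only [hj]; linarith)
    exact ⟨g, hg, hlt.le⟩
  choose g hg hgJ using hch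
  refine ⟨N, g, hN, hg, fun k => ?_, ?_⟩
  · have h1 : g (k+1) ∈ C (N k) := hCanti (hN.monotone (Nat.le_succ k)) (hg (k+1))
    have hmid : (1/2:ℝ) • g k + (1/2:ℝ) • g (k+1) ∈ C (N k) :=
      convex_convexHull ℝ _ (hg k) h1 (by norm_num) (by norm_num) (by norm_num)
    have i1 := Phi_int hV (hCQ _ (hg k))
    have i2 := Phi_int hV (hCQ _ h1)
    have i3 := Phi_int hV (hCQ _ hmid)
    simp only [← Phi_mid]
    have i4 : Integrable (fun ω => (Phi V p R' (g k) ω + Phi V p R' (g (k+1)) ω) / 2) ℙ := (i1.add i2).div_const 2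
    rw [integral_sub i4 i3, integral_div, integral_add i1 i2]
    have k1 : j (N k) ≤ J _ := csInf_le (hbb (N k)) ⟨_, hmid, rfl⟩
    have k2 := hgJ k
    have k3 := hgJ (k+1)
    have k4 := (hNp k).1
    have k5 := hjle (N k)
    have k6 := hjle (N (k+1))
    have k7 : (1/4:ℝ)^(k+1) ≤ (1/4:ℝ)^k := pow_le_pow_of_le_one (by norm_num) (by norm_num) (Nat.le_succ k)
    simp only [hJ] at k1 k2 k3
    linarith
  · intro x hx v hv
    obtain ⟨i, hi⟩ := he (x, v)
    filter_upwards [eventually_gt_atTop i] with k hk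
    have : C (N k) ⊆ Q3 ℙ T x v (2⁻¹ ^ k) := by
      refine convexHull_min ?_ (Q3_convex hT x v _)
      rintro _ ⟨m, hm, rfl⟩
      refine ⟨(hf m).1, ?_⟩
      have := (hNp k).2 i (Finset.mem_range.2 hk)
      rw [hi] at this
      exact this hx hv m hm
    exact (this (hg k)).2

end ctx
end RWRP

namespace RWRP
variable {d : ℕ} {Ω : Type*}

section ctx
variable [MeasurableSpace Ω] {ℙ : Measure Ω} [IsProbabilityMeasure ℙ] {T : Zd d → Ω → Ω} {R : Finset (Zd d)}
    {V : Ω → Zd d → ℝ} {p : Zd d → ℝ} {R' : Finset (Zd d)} {u : (Fin d → ℝ) →ₗ[ℝ] ℝ}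
    (c : Ctx ℙ T R V p R' u)
include c

lemma Ctx.Phi_eq (g : Ω → Zd d → ℝ) (ω : Ω) :
    Phi V p R' g ω = ∑ z ∈ R', p z * Real.exp (-(V ω z) - (g ω z - g ω 0)) :=
  Finset.sum_congr rfl fun _ hz => phi_sq (fun z hz => c.ppos z (c.sub hz)) g ω hz

lemma Ctx.step_lower {g : Ω → Zd d → ℝ} {ω : Ω} (h : Phi V p R' g ω ≤ 1) {z : Zd d} (hz : z ∈ R') :
    0 ≤ (g ω z - g ω 0) + Wf V p ω z := by
  rw [c.Phi_eq] at h
  have := c.B_step (B := fun ω _ z => g ω z - g ω 0) h hz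
  linarith

lemma Ctx.phi_conv {g : ℕ → Ω → Zd d → ℝ} (hg : ∀ k, g k ∈ Q1 ℙ V p R')
    (hJ : ∀ k, ∫ ω, ∑ z ∈ R', (phi V p (g k) ω z - phi V p (g (k+1)) ω z) ^ 2 / 2 ∂ℙ ≤ 2 * (1/4:ℝ)^k)
    {z : Zd d} (hz : z ∈ R') :
    ∀ᵐ ω ∂ℙ, ∃ l, Tendsto (fun k => phi V p (g k) ω z) atTop (𝓝 l) := by
  have hm : ∀ k, Measurable fun ω => phi V p (g k) ω z := fun k => phi_meas c.mV (hg k).1 z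
  have := ae_summable (ℙ := ℙ) (F := fun k ω => phi V p (g k) ω z - phi V p (g (k+1)) ω z)
    (fun k => (hm k).sub (hm (k+1))) (geom_ne_top (ENNReal.ofReal (5/2)) (by simp) fun k => ?_)
  · filter_upwards [this] with ω hω
    have h1 := hω.hasSum.tendsto_sum_nat
    simp only [Finset.sum_range_sub' (fun k => phi V p (g k) ω z)] at h1
    refine ⟨_, (h1.const_sub (phi V p (g 0) ω z)).congr fun n => ?_⟩
    ring
  · set S : Ω → ℝ := fun ω => ∑ z ∈ R', (phi V p (g k) ω z - phi V p (g (k+1)) ω z) ^ 2 / 2 with hS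
    have hSi : Integrable S ℙ := by
      have h1 := Phi_int c.mV (hg k)
      have h2 := Phi_int c.mV (hg (k+1))
      have h3 := Phi_int c.mV (Q1_convex (hg k) (hg (k+1)) (by norm_num : (0:ℝ) ≤ 1/2) (by norm_num : (0:ℝ) ≤ 1/2) (by norm_num))
      have := ((h1.add h2).div_const 2).sub h3
      refine this.congr (Eventually.of_forall fun ω => ?_)
      simp only [hS, ← Phi_mid, Pi.sub_apply, Pi.add_apply]
    have hb : ∀ ω, |phi V p (g k) ω z - phi V p (g (k+1)) ω z| ≤ 2^k * S ω + (1/2)^k / 2 := by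
      intro ω
      set t := phi V p (g k) ω z - phi V p (g (k+1)) ω z with ht
      have h1 : t^2 / 2 ≤ S ω := Finset.single_le_sum
        (f := fun z => (phi V p (g k) ω z - phi V p (g (k+1)) ω z) ^ 2 / 2) (fun w _ => by positivity) hz
      have h2 : (2:ℝ)^k * (1/2)^k = 1 := by rw [← mul_pow]; norm_num
      have h3 : (0:ℝ) < 2^k := by positivity
      have h5 : |t| ≤ 2^k * (t^2/2) + (1/2)^k/2 := by
        have h4 : 0 ≤ (1/2:ℝ)^k * (2^k * |t| - 1)^2 := by positivity
        have : (1/2:ℝ)^k * (2^k * |t| - 1)^2 = (2^k * (1/2:ℝ)^k) * 2^k * |t|^2 - 2 * (2^k * (1/2:ℝ)^k) * |t| + (1/2:ℝ)^k := by ring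
        rw [this, h2, sq_abs] at h4
        linarith
      have := mul_le_mul_of_nonneg_left h1 h3.le
      linarith
    have hint : Integrable (fun ω => 2^k * S ω + (1/2)^k / 2) ℙ := (hSi.const_mul _).add (integrable_const _)
    calc ∫⁻ ω, ‖phi V p (g k) ω z - phi V p (g (k+1)) ω z‖ₑ ∂ℙ ≤ ∫⁻ ω, ENNReal.ofReal (2^k * S ω + (1/2)^k / 2) ∂ℙ := by
          refine lintegral_mono fun ω => ?_
          rw [Real.enorm_eq_ofReal_abs]
          exact ENNReal.ofReal_le_ofReal (hb ω)
      _ = ENNReal.ofReal (∫ ω, (2^k * S ω + (1/2)^k / 2) ∂ℙ) :=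
          (ofReal_integral_eq_lintegral_ofReal hint (Eventually.of_forall fun ω => (abs_nonneg _).trans (hb ω))).symm
      _ ≤ ENNReal.ofReal ((5/2) * (1/2)^k) := by
          refine ENNReal.ofReal_le_ofReal ?_
          rw [integral_add (hSi.const_mul _) (integrable_const _), integral_const_mul]
          have h1 := mul_le_mul_of_nonneg_left (hJ k) (show (0:ℝ) ≤ 2^k by positivity)
          have h2 : (2:ℝ)^k * (2 * (1/4)^k) = 2 * (1/2)^k := by
            rw [mul_left_comm, ← mul_pow]; norm_num
          rw [h2] at h1
          simp only [integral_const, probReal_univ, one_smul]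
          linarith
      _ = ENNReal.ofReal (5/2) * 2⁻¹ ^ k := by
          rw [ENNReal.ofReal_mul (by norm_num), ENNReal.ofReal_pow (by norm_num)]
          congr 2
          rw [one_div, ENNReal.ofReal_inv_of_pos (by norm_num)]
          simp

lemma Ctx.G_conv {g : ℕ → Ω → Zd d → ℝ} (hg : ∀ k, g k ∈ Q1 ℙ V p R')
    (hJ : ∀ k, ∫ ω, ∑ z ∈ R', (phi V p (g k) ω z - phi V p (g (k+1)) ω z) ^ 2 / 2 ∂ℙ ≤ 2 * (1/4:ℝ)^k)
    {z : Zd d} (hz : z ∈ R') {C : ℝ} (hC : ∀ᶠ k in atTop, ∫ ω, (g k ω z - g k ω 0) ∂ℙ ≤ C) :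
    ∀ᵐ ω ∂ℙ, ∃ l, Tendsto (fun k => g k ω z - g k ω 0) atTop (𝓝 l) := by
  have hWi := c.W_int (c.sub hz)
  have hFi : ∀ k, Integrable (fun ω => (g k ω z - g k ω 0) + Wf V p ω z) ℙ := fun k => ((hg k).2.1 z hz).add hWi
  have hF0 : ∀ k, ∀ᵐ ω ∂ℙ, 0 ≤ (g k ω z - g k ω 0) + Wf V p ω z := fun k => by
    filter_upwards [(hg k).2.2] with ω hω using c.step_lower hω hz
  have hlim : ∫⁻ ω, liminf (fun k => ENNReal.ofReal ((g k ω z - g k ω 0) + Wf V p ω z)) atTop ∂ℙ ≤ ENNReal.ofReal (C + EW ℙ V p z) := by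
    refine (lintegral_liminf_le' fun k => (hFi k).aestronglyMeasurable.aemeasurable.ennreal_ofReal).trans ?_
    refine liminf_le_of_frequently_le' (Eventually.frequently ?_)
    filter_upwards [hC] with k hk
    rw [← ofReal_integral_eq_lintegral_ofReal (hFi k) (hF0 k), integral_add ((hg k).2.1 z hz) hWi]
    exact ENNReal.ofReal_le_ofReal (by unfold EW; linarith)
  have hWm : Measurable fun ω => Wf V p ω z := by
    unfold Wf
    exact ((c.mV z).max measurable_const).sub measurable_const
  have hfin : ∀ᵐ ω ∂ℙ, liminf (fun k => ENNReal.ofReal ((g k ω z - g k ω 0) + Wf V p ω z)) atTop < ⊤ := ae_lt_top (Measurable.liminf fun k =>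
      ((((hg k).1 z).sub ((hg k).1 0)).add hWm).ennreal_ofReal)
    (hlim.trans_lt ENNReal.ofReal_lt_top).ne
  filter_upwards [hfin, c.phi_conv hg hJ hz] with ω h1 ⟨l, hl⟩
  have hG : ∀ k, g k ω z - g k ω 0 = Real.log (p z) - V ω z - 2 * Real.log (phi V p (g k) ω z) := by
    intro k; unfold phi; rw [Real.log_exp]; ring
  have hl0 : 0 ≤ l := ge_of_tendsto' hl fun k => (Real.exp_pos _).le
  rcases hl0.eq_or_lt with h0 | h0
  · exfalso
    subst h0
    have hl' : Tendsto (fun k => phi V p (g k) ω z) atTop (𝓝[>] 0) :=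
      tendsto_nhdsWithin_iff.2 ⟨hl, Eventually.of_forall fun k => Real.exp_pos _⟩
    have h2 : Tendsto (fun k => (g k ω z - g k ω 0) + Wf V p ω z) atTop atTop := by
      simp only [hG]
      refine tendsto_atTop_add_const_right _ _ ?_
      simp only [sub_eq_add_neg]
      refine tendsto_atTop_add_const_left _ _ ?_
      exact tendsto_neg_atBot_atTop.comp (((Real.tendsto_log_nhdsGT_zero).comp hl').const_mul_atBot (by norm_num))
    have h3 := (ENNReal.tendsto_ofReal_atTop.comp h2).liminf_eq
    simp only [Function.comp_def] at h3
    rw [h3] at h1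
    exact lt_irrefl _ h1
  · refine ⟨Real.log (p z) - V ω z - 2 * Real.log l, ?_⟩
    simp only [hG]
    exact ((hl.log h0.ne').const_mul 2).const_sub _

lemma Ctx.CL (f : ℕ → Ω → Zd d → ℝ) (hf : ∀ n, f n ∈ Q1 ℙ V p R')
    (P3 : ∀ x ∈ GZ R', ∀ v ∈ GZ R', Tendsto (fun n => ∫⁻ ω, ‖Dfct T (f n) x v ω‖ₑ ∂ℙ) atTop (𝓝 0))
    (P4 : ∃ C : ℝ, ∀ᶠ n in atTop, ∀ z ∈ R', ∫ ω, (f n ω z - f n ω 0) ∂ℙ ≤ C) :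
    ∃ B, InKplus ℙ T V p R' B ∧ ∀ (cf : Zd d → ℝ) (s : ℝ), (∀ z, 0 ≤ cf z) →
      (∀ᶠ n in atTop, ∑ z ∈ R', cf z * ∫ ω, (f n ω z - f n ω 0) ∂ℙ ≤ s) →
      ∑ z ∈ R', cf z * ∫ ω, B ω 0 z ∂ℙ ≤ s := by
  have hTm : ∀ z, Measurable (T z) := fun z => (c.mp z).measurable
  obtain ⟨N, g, hN, hgC, hJ, hD⟩ := exists_comb (ℙ := ℙ) (T := T) c.mV hTm f hf P3
  have hgQ : ∀ k, g k ∈ Q1 ℙ V p R' := fun k =>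
    convexHull_min (by rintro _ ⟨m, _, rfl⟩; exact hf m) Q1_convex (hgC k)
  have hgQ2 : ∀ (cf : Zd d → ℝ) (s : ℝ), (∀ᶠ n in atTop, ∑ z ∈ R', cf z * ∫ ω, (f n ω z - f n ω 0) ∂ℙ ≤ s) →
      ∀ᶠ k in atTop, ∑ z ∈ R', cf z * ∫ ω, (g k ω z - g k ω 0) ∂ℙ ≤ s := by
    intro cf s h
    obtain ⟨n0, hn0⟩ := eventually_atTop.1 h
    filter_upwards [eventually_ge_atTop n0] with k hk
    have : convexHull ℝ (f '' Ici (N k)) ⊆ Q2 ℙ R' cf s := by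
      refine convexHull_min ?_ (Q2_convex cf s)
      rintro _ ⟨m, hm, rfl⟩
      exact ⟨(hf m).2.1, hn0 m (hk.trans ((hN.le_apply).trans hm))⟩
    exact (this (hgC k)).2
  obtain ⟨C, hC⟩ := P4
  have hgC : ∀ z ∈ R', ∀ᶠ k in atTop, ∫ ω, (g k ω z - g k ω 0) ∂ℙ ≤ C := by
    intro z hz
    have := hgQ2 (Pi.single z 1) C (by
      filter_upwards [hC] with n hn
      simpa [Pi.single_apply, ite_mul, hz] using hn z hz)
    simpa [Pi.single_apply, ite_mul, hz] using this
  have hGc : ∀ᵐ ω ∂ℙ, ∀ v : Zd d, ∀ z ∈ R', ∃ l, Tendsto (fun k => g k (T v ω) z - g k (T v ω) 0) atTop (𝓝 l) := by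
    refine ae_shift (P := fun ω => ∀ z ∈ R', ∃ l, Tendsto (fun k => g k ω z - g k ω 0) atTop (𝓝 l)) c.mp ?_
    exact (Finset.eventually_all R').2 fun z hz => c.G_conv hgQ hJ hz (hgC z hz)
  have hD0 : ∀ᵐ ω ∂ℙ, ∀ w : Zd d, ∀ x ∈ GZ R', ∀ v ∈ GZ R', Tendsto (fun k => Dfct T (g k) x v (T w ω)) atTop (𝓝 0) := by
    refine ae_shift (P := fun ω => ∀ x ∈ GZ R', ∀ v ∈ GZ R', Tendsto (fun k => Dfct T (g k) x v ω) atTop (𝓝 0)) c.mp ?_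
    refine ae_all_iff.2 fun x => ?_
    by_cases hx : x ∈ GZ R'
    swap
    · exact Eventually.of_forall fun ω h => absurd h hx
    simp only [hx, true_imp_iff]
    refine ae_all_iff.2 fun v => ?_
    by_cases hv : v ∈ GZ R'
    swap
    · exact Eventually.of_forall fun ω h => absurd h hv
    simp only [hv, true_imp_iff]
    obtain ⟨k0, hk0⟩ := eventually_atTop.1 (hD x hx v hv)
    have := ae_summable (ℙ := ℙ) (F := fun k ω => Dfct T (g (k + k0)) x v ω)
      (fun k => Dfct_meas hTm (hgQ _).1 x v) (geom_ne_top 1 (by simp) fun k => by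
        refine (hk0 (k + k0) (Nat.le_add_left _ _)).trans ?_
        rw [one_mul]
        exact pow_le_pow_of_le_one (by simp) (by simp) (Nat.le_add_right _ _))
    filter_upwards [this] with ω hω
    exact (tendsto_add_atTop_iff_nat k0).1 hω.tendsto_atTop_zero
  have hall : ∀ᵐ ω ∂ℙ, ∀ x ∈ GZ R', ∀ v : Zd d, ∃ l, Tendsto (fun k => g k (T v ω) x - g k (T v ω) 0) atTop (𝓝 l) := by
    filter_upwards [hGc, hD0] with ω h1 h2 x hx
    have hx' := hx
    rw [GZ_eq] at hx'
    have hTT : ∀ v w, T v (T w ω) = T (v + w) ω := fun v w => by rw [c.Tadd]; rfl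
    induction hx' using AddSubgroup.closure_induction with
    | mem z hz => exact fun v => h1 v z hz
    | zero => exact fun v => ⟨0, by simp⟩
    | add x y hx1 hy1 ihx ihy =>
      intro v
      have hx2 : x ∈ GZ R' := by rw [GZ_eq]; exact hx1
      have hy2 : y ∈ GZ R' := by rw [GZ_eq]; exact hy1
      obtain ⟨l1, hl1⟩ := ihy hy2 v
      obtain ⟨l2, hl2⟩ := ihx hx2 (y + v)
      refine ⟨_, ((h2 v x hx2 y hy2).add (hl1.add hl2)).congr fun k => ?_⟩
      unfold Dfct
      rw [hTT]
      ring
    | neg x hx1 ih =>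
      intro v
      have hx2 : x ∈ GZ R' := by rw [GZ_eq]; exact hx1
      obtain ⟨l1, hl1⟩ := ih hx2 (-x + v)
      refine ⟨_, ((h2 v x hx2 (-x) (GZ_neg hx2)).add hl1).neg.congr fun k => ?_⟩
      unfold Dfct
      rw [hTT, add_neg_cancel]
      ring
  have hβ : ∀ x : Zd d, ∃ β : Ω → ℝ, Measurable β ∧ (x ∈ GZ R' → ∀ᵐ ω ∂ℙ, Tendsto (fun k => g k ω x - g k ω 0) atTop (𝓝 (β ω))) := by
    intro x
    by_cases hx : x ∈ GZ R'
    · obtain ⟨β, h1, h2⟩ := measurable_limit_of_tendsto_metrizable_ae (μ := ℙ) (L := atTop)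
        (f := fun k ω => g k ω x - g k ω 0) (fun k => (((hgQ k).1 x).sub ((hgQ k).1 0)).aemeasurable) (by
          filter_upwards [hall] with ω hω
          simpa [c.T0] using hω x hx 0)
      exact ⟨β, h1, fun _ => h2⟩
    · exact ⟨fun _ => 0, measurable_const, fun h => absurd h hx⟩
  choose β hβm hβl using hβ
  have hβa : ∀ᵐ ω ∂ℙ, ∀ v : Zd d, ∀ x ∈ GZ R', Tendsto (fun k => g k (T v ω) x - g k (T v ω) 0) atTop (𝓝 (β x (T v ω))) := by
    refine ae_shift (P := fun ω => ∀ x ∈ GZ R', Tendsto (fun k => g k ω x - g k ω 0) atTop (𝓝 (β x ω))) c.mp ?_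
    refine ae_all_iff.2 fun x => ?_
    by_cases hx : x ∈ GZ R'
    · simpa only [hx, true_imp_iff] using hβl x hx
    · exact Eventually.of_forall fun ω h => absurd h hx
  set B : Ω → Zd d → Zd d → ℝ := fun ω x y => β y ω - β x ω with hB
  have hBl : ∀ᵐ ω ∂ℙ, ∀ x ∈ GZ R', ∀ y ∈ GZ R', Tendsto (fun k => g k ω y - g k ω x) atTop (𝓝 (B ω x y)) := by
    filter_upwards [hβa] with ω h1 x hx y hy
    have := (h1 0 y hy).sub (h1 0 x hx)
    simp only [c.T0, id] at this
    simpa using this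
  have hcov : ∀ᵐ ω ∂ℙ, ∀ x ∈ GZ R', ∀ y ∈ GZ R', ∀ z ∈ GZ R', B ω (x + z) (y + z) = B (T z ω) x y := by
    filter_upwards [hBl, ae_shift c.mp hBl, hD0] with ω h1 h2 h3 x hx y hy z hz
    have a1 := h1 (x + z) (GZ_add hx hz) (y + z) (GZ_add hy hz)
    have a2 := h2 z x hx y hy
    have a3 := (h3 0 y hy z hz).sub (h3 0 x hx z hz)
    simp only [c.T0, id, sub_zero] at a3
    have a4 := a2.add a3
    rw [add_zero] at a4
    refine tendsto_nhds_unique a1 (a4.congr fun k => ?_)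
    unfold Dfct
    ring
  have hB0 : ∀ᵐ ω ∂ℙ, ∀ z ∈ R', Tendsto (fun k => g k ω z - g k ω 0) atTop (𝓝 (B ω 0 z)) := by
    filter_upwards [hBl] with ω h z hz using h 0 (GZ_zero _) z (GZ_mem hz)
  have hfat : ∀ (cf : Zd d → ℝ) (s : ℝ), (∀ z, 0 ≤ cf z) →
      (∀ᶠ k in atTop, ∑ z ∈ R', cf z * ∫ ω, (g k ω z - g k ω 0) ∂ℙ ≤ s) →
      Integrable (fun ω => ∑ z ∈ R', cf z * (B ω 0 z + Wf V p ω z)) ℙ ∧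
      ∫ ω, ∑ z ∈ R', cf z * (B ω 0 z + Wf V p ω z) ∂ℙ ≤ s + ∑ z ∈ R', cf z * EW ℙ V p z := by
    intro cf s hcf hs
    have hi : ∀ k, ∀ z ∈ R', Integrable (fun ω => cf z * ((g k ω z - g k ω 0) + Wf V p ω z)) ℙ := fun k z hz =>
      (((hgQ k).2.1 z hz).add (c.W_int (c.sub hz))).const_mul _
    refine fatou2 (F := fun k ω => ∑ z ∈ R', cf z * ((g k ω z - g k ω 0) + Wf V p ω z))
      (fun k => integrable_finsetSum _ (hi k)) (fun k => ?_) ?_ ?_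
    · filter_upwards [(hgQ k).2.2] with ω hω
      exact Finset.sum_nonneg fun z hz => mul_nonneg (hcf z) (c.step_lower hω hz)
    · filter_upwards [hB0] with ω hω
      exact tendsto_finsetSum _ fun z hz => ((hω z hz).add_const _).const_mul _
    · filter_upwards [hs] with k hk
      rw [integral_finsetSum _ (hi k)]
      calc _ = ∑ z ∈ R', cf z * ∫ ω, (g k ω z - g k ω 0) ∂ℙ + ∑ z ∈ R', cf z * EW ℙ V p z := by
            rw [← Finset.sum_add_distrib]
            refine Finset.sum_congr rfl fun z hz => ?_
            rw [integral_const_mul, integral_add ((hgQ k).2.1 z hz) (c.W_int (c.sub hz)), mul_add]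
            rfl
        _ ≤ _ := by linarith
  have hBi0 : ∀ z ∈ R', Integrable (fun ω => B ω 0 z) ℙ := by
    intro z hz
    have := (hfat (Pi.single z 1) C (fun w => by rw [Pi.single_apply]; split_ifs <;> simp)
      (by simpa [Pi.single_apply, ite_mul, hz] using hgC z hz)).1
    simp only [Pi.single_apply, ite_mul, one_mul, zero_mul, Finset.sum_ite_eq', hz, if_true] at this
    refine (this.sub (c.W_int (c.sub hz))).congr (Eventually.of_forall fun ω => ?_)
    simp
  have hBmeas : ∀ x y : Zd d, Measurable fun ω => B ω x y := fun x y => (hβm y).sub (hβm x)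
  have hBi : ∀ x ∈ GZ R', Integrable (fun ω => B ω 0 x) ℙ := by
    intro x hx
    have hx' := hx
    rw [GZ_eq] at hx'
    induction hx' using AddSubgroup.closure_induction with
    | mem z hz => exact hBi0 z hz
    | zero => simp [hB]
    | add x y hx1 hy1 ihx ihy =>
      have hx2 : x ∈ GZ R' := by rw [GZ_eq]; exact hx1
      have hy2 : y ∈ GZ R' := by rw [GZ_eq]; exact hy1
      have := (ihy hy2).add ((c.mp y).integrable_comp_of_integrable (ihx hx2))
      refine this.congr ?_
      filter_upwards [hcov] with ω hω
      have := hω 0 (GZ_zero _) x hx2 y hy2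
      simp only [Pi.add_apply, Function.comp]
      rw [← this]
      simp [hB]
    | neg x hx1 ih =>
      have hx2 : x ∈ GZ R' := by rw [GZ_eq]; exact hx1
      have := ((c.mp (-x)).integrable_comp_of_integrable (ih hx2)).neg
      refine this.congr ?_
      filter_upwards [hcov] with ω hω
      have := hω 0 (GZ_zero _) x hx2 (-x) (GZ_neg hx2)
      simp only [Pi.neg_apply, Function.comp]
      rw [← this]
      simp [hB]
  refine ⟨B, ⟨⟨hBmeas, ?_, ?_, hcov⟩, ?_⟩, ?_⟩
  · intro x hx y hy
    refine ((hBi y hy).sub (hBi x hx)).congr (Eventually.of_forall fun ω => ?_)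
    simp [hB]
  · exact Eventually.of_forall fun ω x _ y _ z _ => by simp only [hB]; ring
  · filter_upwards [hB0, ae_all_iff.2 fun k => (hgQ k).2.2] with ω h1 h2
    refine le_of_tendsto' (f := fun k => Phi V p R' (g k) ω) (x := atTop) ?_ h2
    simp only [c.Phi_eq]
    refine tendsto_finsetSum _ fun z hz => Tendsto.const_mul _ ?_
    exact ((h1 z hz).const_sub _).rexp
  · intro cf s hcf hs
    have := (hfat cf s hcf (hgQ2 cf s hs)).2
    have hi : ∀ z ∈ R', Integrable (fun ω => cf z * (B ω 0 z + Wf V p ω z)) ℙ := fun z hz => ((hBi0 z hz).add (c.W_int (c.sub hz))).const_mul _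
    rw [integral_finsetSum _ hi] at this
    have e : ∀ z ∈ R', ∫ ω, cf z * (B ω 0 z + Wf V p ω z) ∂ℙ = cf z * (∫ ω, B ω 0 z ∂ℙ) + cf z * EW ℙ V p z := by
      intro z hz
      rw [integral_const_mul, integral_add (hBi0 z hz) (c.W_int (c.sub hz)), mul_add]
      rfl
    rw [Finset.sum_congr rfl e, Finset.sum_add_distrib] at this
    linarith

end ctx
end RWRP

namespace RWRP
variable {d : ℕ} {Ω : Type*}

section avg
variable {E E' : Type*} [AddCommGroup E] [Module ℝ E] [AddCommGroup E'] [Module ℝ E']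

/-- iterated averages -/
def AvgL (M : ℕ) : List (Zd d) → (Zd d → E) → Zd d → E
  | [], F, y => F y
  | z :: L, F, y => (M:ℝ)⁻¹ • ∑ i ∈ Finset.range M, AvgL M L F (y + i • z)

lemma AvgL_perm {M : ℕ} {L L' : List (Zd d)} (h : L.Perm L') (F : Zd d → E) (y : Zd d) :
    AvgL M L F y = AvgL M L' F y := by
  induction h generalizing y with
  | nil => rfl
  | cons z _ ih => simp only [AvgL, ih]
  | swap z w l =>
    simp only [AvgL, ← Finset.smul_sum]
    rw [Finset.sum_comm]
    simp only [add_right_comm]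
  | trans _ _ ih1 ih2 => rw [ih1, ih2]

lemma AvgL_map {M : ℕ} (L : List (Zd d)) (φ : E →ₗ[ℝ] E') (F : Zd d → E) (y : Zd d) :
    φ (AvgL M L F y) = AvgL M L (fun t => φ (F t)) y := by
  induction L generalizing y with
  | nil => rfl
  | cons z L ih => simp only [AvgL, map_smul, map_sum, ih]

lemma AvgL_shift {M : ℕ} (L : List (Zd d)) (F : Zd d → E) (v y : Zd d) :
    AvgL M L (fun t => F (t + v)) y = AvgL M L F (y + v) := by
  induction L generalizing y with
  | nil => rfl
  | cons z L ih => simp only [AvgL, ih, add_right_comm]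

lemma AvgL_sub {M : ℕ} (L : List (Zd d)) (F G : Zd d → E) (y : Zd d) :
    AvgL M L (fun t => F t - G t) y = AvgL M L F y - AvgL M L G y := by
  induction L generalizing y with
  | nil => rfl
  | cons z L ih => simp only [AvgL, ih, Finset.sum_sub_distrib, smul_sub]

lemma AvgL_add {M : ℕ} (L : List (Zd d)) (F G : Zd d → E) (y : Zd d) :
    AvgL M L (fun t => F t + G t) y = AvgL M L F y + AvgL M L G y := by
  induction L generalizing y with
  | nil => rfl
  | cons z L ih => simp only [AvgL, ih, Finset.sum_add_distrib, smul_add]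

lemma AvgL_const {M : ℕ} (hM : 1 ≤ M) (L : List (Zd d)) (a : E) (y : Zd d) :
    AvgL M L (fun _ => a) y = a := by
  induction L generalizing y with
  | nil => rfl
  | cons z L ih =>
    have : (M:ℝ) ≠ 0 := by positivity
    simp only [AvgL, ih, Finset.sum_const, Finset.card_range]
    rw [← Nat.cast_smul_eq_nsmul ℝ, smul_smul, inv_mul_cancel₀ this, one_smul]

lemma AvgL_tel {M : ℕ} (L : List (Zd d)) (F : Zd d → E) (z y : Zd d) :
    AvgL M (z :: L) F (y + z) - AvgL M (z :: L) F y = (M:ℝ)⁻¹ • (AvgL M L F (y + M • z) - AvgL M L F y) := by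
  simp only [AvgL]
  rw [← smul_sub, ← Finset.sum_sub_distrib]
  congr 1
  have := Finset.sum_range_sub (fun i : ℕ => AvgL M L F (y + i • z)) M
  simp only [zero_smul, add_zero] at this
  rw [← this]
  refine Finset.sum_congr rfl fun i _ => ?_
  rw [succ_nsmul', add_assoc]

lemma avg_mem {S : Set E} (hS : Convex ℝ S) {n : ℕ} (hn : 1 ≤ n) {G : ℕ → E} (hG : ∀ k < n, G k ∈ S) :
    (n:ℝ)⁻¹ • ∑ k ∈ Finset.range n, G k ∈ S := by
  have hn' : (n:ℝ) ≠ 0 := by positivity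
  rw [Finset.smul_sum]
  refine hS.sum_mem (fun i _ => by positivity) ?_ (fun i hi => hG i (Finset.mem_range.1 hi))
  simp [hn']

lemma AvgL_mem {S : Set E} (hS : Convex ℝ S) {M : ℕ} (hM : 1 ≤ M) {R' : Finset (Zd d)} (L : List (Zd d)) (hL : ∀ z ∈ L, z ∈ R')
    (F : Zd d → E) (y : Zd d)
    (hF : ∀ l : List (Zd d), (∀ z ∈ l, z ∈ R') → l.length ≤ M * L.length → F (y + l.sum) ∈ S) : AvgL M L F y ∈ S := by
  induction L generalizing y with
  | nil => simpa [AvgL] using hF [] (by simp) (by simp)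
  | cons z L ih =>
    refine avg_mem hS hM fun i hi => ?_
    refine ih (fun w hw => hL w (by simp [hw])) _ fun l hl hlen => ?_
    have := hF (List.replicate i z ++ l) ?_ ?_
    · simpa [add_assoc] using this
    · intro w hw
      rcases List.mem_append.1 hw with h | h
      · rw [List.eq_of_mem_replicate h]; exact hL z (by simp)
      · exact hl w h
    · simp only [List.length_append, List.length_replicate, List.length_cons]
      nlinarith

lemma AvgL_exists_le {M : ℕ} (hM : 1 ≤ M) {R' : Finset (Zd d)} (L : List (Zd d)) (hL : ∀ z ∈ L, z ∈ R')
    (F : Zd d → ℝ) (y : Zd d) :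
    ∃ l : List (Zd d), (∀ z ∈ l, z ∈ R') ∧ l.length ≤ M * L.length ∧ F (y + l.sum) ≤ AvgL M L F y := by
  by_contra! h
  have := AvgL_mem (S := Set.Ioi (AvgL M L F y)) (convex_Ioi _) hM L hL F y (fun l h1 h2 => h l h1 h2)
  exact lt_irrefl _ (Set.mem_Ioi.1 this)

section mea
variable [MeasurableSpace Ω] {ℙ : Measure Ω}

lemma convex_abs : Convex ℝ {q : (Ω → ℝ) × ℝ | Integrable q.1 ℙ ∧ ∫ ω, |q.1 ω| ∂ℙ ≤ q.2} := by
  intro g hg h hh a b ha hb hab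
  refine ⟨(hg.1.const_mul a).add (hh.1.const_mul b), ?_⟩
  have e : ∫ ω, (a * |g.1 ω| + b * |h.1 ω|) ∂ℙ = a * (∫ ω, |g.1 ω| ∂ℙ) + b * ∫ ω, |h.1 ω| ∂ℙ := by
    rw [integral_add (hg.1.abs.const_mul a) (hh.1.abs.const_mul b), integral_const_mul, integral_const_mul]
  calc ∫ ω, |(a • g + b • h).1 ω| ∂ℙ ≤ ∫ ω, (a * |g.1 ω| + b * |h.1 ω|) ∂ℙ := by
        refine integral_mono ((hg.1.const_mul a).add (hh.1.const_mul b)).abs ((hg.1.abs.const_mul a).add (hh.1.abs.const_mul b)) fun ω => ?_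
        simp only [Prod.fst_add, Prod.smul_fst, Pi.add_apply, Pi.smul_apply, smul_eq_mul]
        refine (abs_add_le _ _).trans ?_
        rw [abs_mul, abs_mul, abs_of_nonneg ha, abs_of_nonneg hb]
    _ ≤ _ := by
        rw [e]
        simp only [Prod.snd_add, Prod.smul_snd, smul_eq_mul]
        exact add_le_add (mul_le_mul_of_nonneg_left hg.2 ha) (mul_le_mul_of_nonneg_left hh.2 hb)

lemma convex_eq : Convex ℝ {q : (Ω → ℝ) × ℝ | Integrable q.1 ℙ ∧ ∫ ω, q.1 ω ∂ℙ = q.2} := by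
  intro g hg h hh a b ha hb hab
  refine ⟨(hg.1.const_mul a).add (hh.1.const_mul b), ?_⟩
  have e : ∫ ω, (a * g.1 ω + b * h.1 ω) ∂ℙ = a * (∫ ω, g.1 ω ∂ℙ) + b * ∫ ω, h.1 ω ∂ℙ := by
    rw [integral_add (hg.1.const_mul a) (hh.1.const_mul b), integral_const_mul, integral_const_mul]
  rw [hg.2, hh.2] at e
  exact e

lemma AvgL_pair {M : ℕ} (L : List (Zd d)) (F : Zd d → E) (G : Zd d → E') (y : Zd d) :
    AvgL M L (fun t => (F t, G t)) y = (AvgL M L F y, AvgL M L G y) := by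
  refine Prod.ext ?_ ?_
  · exact AvgL_map L (LinearMap.fst ℝ E E') (fun t => (F t, G t)) y
  · exact AvgL_map L (LinearMap.snd ℝ E E') (fun t => (F t, G t)) y

end mea
end avg

/-- representation by a list of bounded length -/
def Len (R' : Finset (Zd d)) (K : ℝ) (x : Zd d) : Prop :=
  ∃ l : List (Zd d), (∀ z ∈ l, z ∈ R') ∧ l.sum = x ∧ (l.length : ℝ) ≤ K

lemma Len.add {R' : Finset (Zd d)} {K K' : ℝ} {x x' : Zd d} (h : Len R' K x) (h' : Len R' K' x') :
    Len R' (K + K') (x + x') := by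
  obtain ⟨l, h1, rfl, h3⟩ := h
  obtain ⟨l', h1', rfl, h3'⟩ := h'
  refine ⟨l ++ l', fun z hz => ?_, by simp, by simp only [List.length_append]; push_cast; linarith⟩
  rcases List.mem_append.1 hz with h | h
  · exact h1 z h
  · exact h1' z h

lemma Len.mono {R' : Finset (Zd d)} {K K' : ℝ} {x : Zd d} (h : Len R' K x) (hK : K ≤ K') : Len R' K' x := by
  obtain ⟨l, h1, h2, h3⟩ := h
  exact ⟨l, h1, h2, h3.trans hK⟩

lemma Len.gp {R' : Finset (Zd d)} {K : ℝ} {x : Zd d} (h : Len R' K x) : x ∈ Gp R' := by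
  obtain ⟨l, h1, h2, h3⟩ := h
  exact Gp_iff_list.2 ⟨l, h1, h2⟩

lemma Len_zero {R' : Finset (Zd d)} : Len R' 0 0 := ⟨[], by simp, by simp, by simp⟩

lemma Len_list {R' : Finset (Zd d)} {l : List (Zd d)} (h : ∀ z ∈ l, z ∈ R') : Len R' l.length l.sum := ⟨l, h, rfl, le_rfl⟩

lemma Len_comb (R' : Finset (Zd d)) (b : Zd d → ℕ) : Len R' (∑ z ∈ R', (b z : ℝ)) (∑ z ∈ R', b z • z) := by
  obtain ⟨l, h1, h2, h3, _⟩ := exists_list R' b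
  refine ⟨l, h1, h2, ?_⟩
  rw [h3]; push_cast; exact le_rfl

lemma Len_nsmul {R' : Finset (Zd d)} (m : ℕ) {z : Zd d} (hz : z ∈ R') : Len R' m (m • z) :=
  ⟨List.replicate m z, fun w hw => by rw [List.eq_of_mem_replicate hw]; exact hz, by simp, by simp⟩

lemma GZ_deep {R' : Finset (Zd d)} {x : Zd d} (hx : x ∈ GZ R') :
    ∃ κ : ℕ, ∃ K : ℝ, ∀ m ≥ κ, Len R' (K + R'.card * m) (m • (∑ z ∈ R', z) - x) := by
  obtain ⟨b, rfl⟩ := hx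
  refine ⟨∑ z ∈ R', (b z).natAbs, ∑ z ∈ R', (b z).natAbs, fun m hm => ?_⟩
  have hb : ∀ z ∈ R', (b z).natAbs ≤ m := fun z hz =>
    (Finset.single_le_sum (f := fun z => (b z).natAbs) (fun _ _ => Nat.zero_le _) hz).trans hm
  have e : m • (∑ z ∈ R', z) - ∑ z ∈ R', b z • z = ∑ z ∈ R', ((m:ℤ) - b z).toNat • z := by
    rw [Finset.smul_sum, ← Finset.sum_sub_distrib]
    refine Finset.sum_congr rfl fun z hz => ?_
    have h1 := hb z hz
    have h2 : (((m:ℤ) - b z).toNat : ℤ) = m - b z := Int.toNat_of_nonneg (by omega)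
    rw [← natCast_zsmul, ← natCast_zsmul z (((m:ℤ) - b z).toNat), h2, sub_smul]
  rw [e]
  refine (Len_comb _ _).mono ?_
  have : ∀ z ∈ R', ((((m:ℤ) - b z).toNat : ℕ) : ℝ) ≤ ((b z).natAbs : ℝ) + m := fun z hz => by
    have : ((m:ℤ) - b z).toNat ≤ (b z).natAbs + m := by omega
    exact_mod_cast this
  refine (Finset.sum_le_sum this).trans ?_
  rw [Finset.sum_add_distrib]
  simp

end RWRP

namespace RWRP
variable {d : ℕ} {Ω : Type*}

def Mq (n : ℕ) : ℕ := ⌈(n:ℝ) ^ (3/4:ℝ)⌉₊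

lemma Mq_pos {n : ℕ} (hn : 1 ≤ n) : 1 ≤ Mq n := by
  unfold Mq
  rw [Nat.one_le_ceil_iff]
  have : (0:ℝ) < n := by positivity
  positivity

lemma Mq_le {n : ℕ} (hn : 1 ≤ n) : Mq n ≤ n := by
  unfold Mq
  rw [Nat.ceil_le]
  have h1 : (1:ℝ) ≤ n := by exact_mod_cast hn
  calc (n:ℝ) ^ (3/4:ℝ) ≤ (n:ℝ) ^ (1:ℝ) := Real.rpow_le_rpow_of_exponent_le h1 (by norm_num)
    _ = n := Real.rpow_one _

lemma Mq_top : Tendsto (fun n => (Mq n : ℝ)) atTop atTop := by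
  refine tendsto_atTop_mono (fun n => Nat.le_ceil _) ?_
  exact (tendsto_rpow_atTop (by norm_num)).comp tendsto_natCast_atTop_atTop

lemma Mq_div : Tendsto (fun n : ℕ => (Mq n : ℝ) / n) atTop (𝓝 0) := by
  have h1 : Tendsto (fun n : ℕ => ((n:ℝ) ^ (-(1/4):ℝ)) + (n:ℝ)⁻¹) atTop (𝓝 (0 + 0)) :=
    ((tendsto_rpow_neg_atTop (by norm_num : (0:ℝ) < 1/4)).comp tendsto_natCast_atTop_atTop).add tendsto_inv_atTop_nhds_zero_nat
  rw [add_zero] at h1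
  refine squeeze_zero' (Eventually.of_forall fun n => by positivity) ?_ h1
  filter_upwards [eventually_ge_atTop 1] with n hn
  have hn0 : (0:ℝ) < n := by positivity
  have h2 : (Mq n : ℝ) < (n:ℝ) ^ (3/4:ℝ) + 1 := Nat.ceil_lt_add_one (by positivity)
  have h3 : (n:ℝ) ^ (-(1/4):ℝ) * n = (n:ℝ) ^ (3/4:ℝ) := by
    nth_rw 2 [← Real.rpow_one (n:ℝ)]
    rw [← Real.rpow_add hn0]; norm_num
  rw [div_le_iff₀ hn0, add_mul, h3, inv_mul_cancel₀ hn0.ne']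
  exact h2.le

lemma Mq_sq : Tendsto (fun n : ℕ => (n : ℝ) / (Mq n : ℝ) ^ 2) atTop (𝓝 0) := by
  have h1 : Tendsto (fun n : ℕ => ((n:ℝ) ^ (-(1/2):ℝ))) atTop (𝓝 0) :=
    ((tendsto_rpow_neg_atTop (by norm_num : (0:ℝ) < 1/2)).comp tendsto_natCast_atTop_atTop)
  refine squeeze_zero' (Eventually.of_forall fun n => by positivity) ?_ h1
  filter_upwards [eventually_ge_atTop 1] with n hn
  have hn0 : (0:ℝ) < n := by positivity
  have h2 : (n:ℝ) ^ (3/4:ℝ) ≤ Mq n := Nat.le_ceil _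
  have hM : (0:ℝ) < Mq n := by have := Mq_pos hn; positivity
  rw [div_le_iff₀ (by positivity)]
  calc (n:ℝ) = (n:ℝ) ^ (-(1/2):ℝ) * ((n:ℝ) ^ (3/4:ℝ)) ^ 2 := by
        rw [← Real.rpow_natCast, ← Real.rpow_mul hn0.le, ← Real.rpow_add hn0]; norm_num
    _ ≤ _ := by gcongr

def xh (R' : Finset (Zd d)) (g : Zd d → ℝ) (k : ℕ) : Zd d := ∑ z ∈ R', ⌊(k:ℝ) * g z⌋₊ • z

def yk (R' : Finset (Zd d)) (g : Zd d → ℝ) (n k : ℕ) : Zd d := Mq n • (∑ z ∈ R', z) + xh R' g k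

def LL (R' : Finset (Zd d)) : List (Zd d) := R'.toList ++ R'.toList

lemma LL_mem (R' : Finset (Zd d)) : ∀ z ∈ LL R', z ∈ R' := by simp [LL]

lemma LL_perm {R' : Finset (Zd d)} {z w : Zd d} (hz : z ∈ R') (hw : w ∈ R') :
    ∃ L : List (Zd d), (LL R').Perm (z :: w :: L) ∧ (∀ v ∈ L, v ∈ R') ∧ L.length ≤ 2 * R'.card := by
  have h1 := List.perm_cons_erase (Finset.mem_toList.2 hz)
  have h2 := List.perm_cons_erase (Finset.mem_toList.2 hw)
  refine ⟨R'.toList.erase z ++ R'.toList.erase w, ?_, ?_, ?_⟩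
  · refine (h1.append h2).trans ?_
    simp only [List.cons_append]
    exact (List.perm_middle).cons z
  · intro v hv
    rcases List.mem_append.1 hv with h | h
    · exact Finset.mem_toList.1 (List.mem_of_mem_erase h)
    · exact Finset.mem_toList.1 (List.mem_of_mem_erase h)
  · have a := List.length_erase_le (a := z) (l := R'.toList)
    have b := List.length_erase_le (a := w) (l := R'.toList)
    simp only [List.length_append]
    rw [Finset.length_toList] at a b
    omega

lemma xh_len (R' : Finset (Zd d)) {g : Zd d → ℝ} (hg : ∀ z, 0 < g z) (k : ℕ) :
    Len R' (k * ∑ z ∈ R', g z) (xh R' g k) := by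
  refine (Len_comb _ _).mono ?_
  rw [Finset.mul_sum]
  exact Finset.sum_le_sum fun z _ => Nat.floor_le (mul_nonneg (by positivity) (hg z).le)

lemma yk_deep {R' : Finset (Zd d)} {g : Zd d → ℝ} (hg : ∀ z, 0 < g z) {x : Zd d} (hx : x ∈ GZ R') :
    ∃ K : ℝ, 0 ≤ K ∧ ∀ᶠ n : ℕ in atTop, ∀ k ≤ n, Len R' (K * n) (yk R' g n k - x) := by
  obtain ⟨κ, K, h⟩ := GZ_deep hx
  have hS : 0 ≤ ∑ z ∈ R', g z := Finset.sum_nonneg fun z _ => (hg z).le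
  refine ⟨|K| + R'.card + ∑ z ∈ R', g z, by positivity, ?_⟩
  filter_upwards [eventually_ge_atTop 1, Mq_top.eventually_ge_atTop (κ:ℝ)] with n hn hM k hk
  have hM' : κ ≤ Mq n := by exact_mod_cast hM
  have := (h (Mq n) hM').add (xh_len R' hg k)
  unfold yk
  rw [add_sub_right_comm]
  refine this.mono ?_
  have h1 : (Mq n : ℝ) ≤ n := by exact_mod_cast Mq_le hn
  have h2 : (k:ℝ) ≤ n := by exact_mod_cast hk
  have h3 : (1:ℝ) ≤ n := by exact_mod_cast hn
  have h4 : (R'.card : ℝ) * Mq n ≤ R'.card * n := by gcongr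
  have h5 : (k:ℝ) * ∑ z ∈ R', g z ≤ n * ∑ z ∈ R', g z := by gcongr
  have h6 : K ≤ |K| * n := (le_abs_self K).trans (le_mul_of_one_le_right (abs_nonneg _) h3)
  linarith

def Fa (T : Zd d → Ω → Ω) (V : Ω → Zd d → ℝ) (p : Zd d → ℝ) (R : Finset (Zd d)) (t : Zd d) : Ω → Zd d → ℝ :=
  fun ω x => aFun T V p R ω x t

def fn (T : Zd d → Ω → Ω) (V : Ω → Zd d → ℝ) (p : Zd d → ℝ) (R : Finset (Zd d)) (R' : Finset (Zd d)) (g : Zd d → ℝ)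
    (n : ℕ) : Ω → Zd d → ℝ :=
  (n:ℝ)⁻¹ • ∑ k ∈ Finset.range n, AvgL (Mq n) (LL R') (Fa T V p R) (yk R' g n k)

def evx (x : Zd d) : (Ω → Zd d → ℝ) →ₗ[ℝ] (Ω → ℝ) where
  toFun h := fun ω => h ω x
  map_add' _ _ := rfl
  map_smul' _ _ := rfl

lemma fn_evx (T : Zd d → Ω → Ω) (V : Ω → Zd d → ℝ) (p : Zd d → ℝ) (R : Finset (Zd d)) (R' : Finset (Zd d)) (g : Zd d → ℝ)
    (n : ℕ) (x : Zd d) : (fun ω => fn T V p R R' g n ω x) =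
      (n:ℝ)⁻¹ • ∑ k ∈ Finset.range n, AvgL (Mq n) (LL R') (fun t ω => aFun T V p R ω x t) (yk R' g n k) := by
  change evx x (fn T V p R R' g n) = _
  unfold fn
  rw [map_smul, map_sum]
  simp only [AvgL_map]
  rfl

lemma fn_ev (T : Zd d → Ω → Ω) (V : Ω → Zd d → ℝ) (p : Zd d → ℝ) (R : Finset (Zd d)) (R' : Finset (Zd d)) (g : Zd d → ℝ)
    (n : ℕ) (ω : Ω) (x : Zd d) : fn T V p R R' g n ω x =
      (n:ℝ)⁻¹ • ∑ k ∈ Finset.range n, AvgL (Mq n) (LL R') (fun t => aFun T V p R ω x t) (yk R' g n k) := by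
  have := congrArg (LinearMap.proj (R := ℝ) (φ := fun _ : Ω => ℝ) ω) (fn_evx T V p R R' g n x)
  rw [map_smul, map_sum] at this
  simp only [AvgL_map] at this
  exact this

def DD (T : Zd d → Ω → Ω) (f : Ω → Zd d → ℝ) (x y v : Zd d) (ω : Ω) : ℝ :=
  (f ω y - f ω x) - (f (T v ω) (y - v) - f (T v ω) (x - v))

section ctx
variable [MeasurableSpace Ω] {ℙ : Measure Ω} [IsProbabilityMeasure ℙ] {T : Zd d → Ω → Ω} {R : Finset (Zd d)}
    {V : Ω → Zd d → ℝ} {p : Zd d → ℝ} {R' : Finset (Zd d)} {u : (Fin d → ℝ) →ₗ[ℝ] ℝ} (c : Ctx ℙ T R V p R' u)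
    {g : Zd d → ℝ} (hg : ∀ z, 0 < g z)
include c

lemma Ctx.Len_abs {K : ℝ} {y : Zd d} (h : Len R' K y) : |ef ℙ T R V p y| ≤ C0 ℙ R V p u * K := by
  obtain ⟨l, h1, rfl, h3⟩ := h
  exact (c.e_abs l fun z hz => c.sub (h1 z hz)).trans (mul_le_mul_of_nonneg_left h3 c.C0_nonneg)

lemma Ctx.avg_abs {M : ℕ} (hM : 1 ≤ M) {L : List (Zd d)} (hL : ∀ z ∈ L, z ∈ R') {K : ℝ} {y : Zd d} (h : Len R' K y) :
    |AvgL M L (ef ℙ T R V p) y| ≤ C0 ℙ R V p u * (K + M * L.length) := by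
  have : AvgL M L (ef ℙ T R V p) y ∈ Set.Icc (-(C0 ℙ R V p u * (K + M * L.length))) (C0 ℙ R V p u * (K + M * L.length)) := by
    refine AvgL_mem (convex_Icc _ _) hM L hL _ y fun l h1 h2 => ?_
    rw [Set.mem_Icc, ← abs_le]
    refine c.Len_abs ((h.add (Len_list h1)).mono ?_)
    have : (l.length : ℝ) ≤ M * L.length := by exact_mod_cast h2
    linarith
  rw [Set.mem_Icc, ← abs_le] at this
  exact this

lemma Ctx.D_bound {M : ℕ} (hM : 1 ≤ M) {L : List (Zd d)} (hL : ∀ z ∈ L, z ∈ R') {K : ℝ} {x y w : Zd d}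
    (hw : w ∈ R') (h : Len R' K (y - (x + w))) :
    Integrable (AvgL M (w :: L) (fun t ω => aFun T V p R ω (x + w) t - aFun T V p R ω x t) y) ℙ ∧
    ∫ ω, |AvgL M (w :: L) (fun t ω => aFun T V p R ω (x + w) t - aFun T V p R ω x t) y ω| ∂ℙ ≤
      2 * EW ℙ V p w + (M:ℝ)⁻¹ * (2 * (C0 ℙ R V p u * (K + M + M * L.length))) := by
  have hw' : ∀ v ∈ w :: L, v ∈ R' := by simpa [hw] using hL
  have key := AvgL_mem (convex_abs (ℙ := ℙ)) hM (w :: L) hw'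
    (fun t => ((fun ω => aFun T V p R ω (x + w) t - aFun T V p R ω x t),
      2 * EW ℙ V p w + (ef ℙ T R V p (t - (x + w)) - ef ℙ T R V p (t - x)))) y ?_
  · rw [AvgL_pair] at key
    refine ⟨key.1, key.2.trans ?_⟩
    simp only
    rw [AvgL_add, AvgL_const hM, AvgL_sub]
    simp only [sub_eq_add_neg _ (x + w), sub_eq_add_neg _ x]
    rw [AvgL_shift, AvgL_shift]
    have e : y + -x = (y + -(x + w)) + w := by abel
    rw [e, ← neg_sub, AvgL_tel]
    rw [sub_eq_add_neg] at h
    have h1 := c.avg_abs hM hL (h.add (Len_nsmul M hw))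
    have h2 := c.avg_abs hM hL h
    have hM0 : (0:ℝ) ≤ (M:ℝ)⁻¹ := by positivity
    have h3 : C0 ℙ R V p u * (K + M * L.length) ≤ C0 ℙ R V p u * (K + M + M * L.length) :=
      mul_le_mul_of_nonneg_left (by linarith [Nat.cast_nonneg (α := ℝ) M]) c.C0_nonneg
    rw [smul_eq_mul, ← mul_neg]
    gcongr
    rw [abs_le] at h1 h2
    linarith
  · intro l h1 h2
    have hG : y + l.sum - (x + w) ∈ Gp R := by
      rw [add_sub_right_comm]
      exact Gp_mono c.sub (h.add (Len_list h1)).gp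
    have hG' : y + l.sum - x ∈ Gp R := by
      have e : y + l.sum - x = (y - (x + w)) + l.sum + w := by abel
      rw [e]
      have := (h.add (Len_list h1)).add (Len_nsmul 1 hw)
      rw [one_smul] at this
      exact Gp_mono c.sub this.gp
    refine ⟨(c.a_int hG).sub (c.a_int hG'), ?_⟩
    refine (c.diff_bound (c.sub hw) hG).trans (le_of_eq ?_)
    simp only; ring

end ctx
end RWRP

namespace RWRP
variable {d : ℕ} {Ω : Type*}

section ctx
variable [MeasurableSpace Ω] {ℙ : Measure Ω} [IsProbabilityMeasure ℙ] {T : Zd d → Ω → Ω} {R : Finset (Zd d)}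
    {V : Ω → Zd d → ℝ} {p : Zd d → ℝ} {R' : Finset (Zd d)} {u : (Fin d → ℝ) →ₗ[ℝ] ℝ}
    {g : Zd d → ℝ}

omit [IsProbabilityMeasure ℙ] in
lemma avg_pair {S : Set ((Ω → ℝ) × ℝ)} (hS : Convex ℝ S) {n : ℕ} (hn : 1 ≤ n) {G : ℕ → Ω → ℝ} {r : ℕ → ℝ}
    (h : ∀ k < n, (G k, r k) ∈ S) :
    ((n:ℝ)⁻¹ • ∑ k ∈ Finset.range n, G k, (n:ℝ)⁻¹ * ∑ k ∈ Finset.range n, r k) ∈ S := by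
  have := avg_mem hS hn h
  convert this using 1
  refine Prod.ext ?_ ?_
  · simp [Prod.fst_sum]
  · simp [Prod.snd_sum]

variable (c : Ctx ℙ T R V p R' u) (hg : ∀ z, 0 < g z)
include c

lemma Ctx.fn_cov (n : ℕ) (ω : Ω) (v y : Zd d) : fn T V p R R' g n (T v ω) (y - v) =
    (n:ℝ)⁻¹ • ∑ k ∈ Finset.range n, AvgL (Mq n) (LL R') (fun t => aFun T V p R ω y t) (yk R' g n k + v) := by
  rw [fn_ev]
  congr 1
  refine Finset.sum_congr rfl fun k _ => ?_
  rw [← AvgL_shift]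
  congr 1
  funext t
  rw [aFun_cov T c.Tadd]
  rw [sub_add_cancel]

lemma Ctx.DD_eq {n : ℕ} {x w z : Zd d} {L : List (Zd d)} (hL : (LL R').Perm (z :: w :: L)) :
    DD T (fn T V p R R' g n) x (x + w) z = (n:ℝ)⁻¹ • ∑ k ∈ Finset.range n,
      ((Mq n : ℝ)⁻¹ • (AvgL (Mq n) (w :: L) (fun t ω => aFun T V p R ω (x + w) t - aFun T V p R ω x t) (yk R' g n k) -
        AvgL (Mq n) (w :: L) (fun t ω => aFun T V p R ω (x + w) t - aFun T V p R ω x t) (yk R' g n k + Mq n • z))) := by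
  funext ω
  have e : ∀ y, AvgL (Mq n) (w :: L) (fun t ω => aFun T V p R ω (x + w) t - aFun T V p R ω x t) y ω =
      AvgL (Mq n) (w :: L) (fun t => aFun T V p R ω (x + w) t - aFun T V p R ω x t) y := fun y =>
    AvgL_map (w :: L) (LinearMap.proj (R := ℝ) (φ := fun _ : Ω => ℝ) ω)
      (fun t ω => aFun T V p R ω (x + w) t - aFun T V p R ω x t) y
  unfold DD
  rw [c.fn_cov, c.fn_cov, fn_ev, fn_ev, ← smul_sub, ← smul_sub, ← smul_sub, Pi.smul_apply, Finset.sum_apply]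
  congr 1
  rw [← Finset.sum_sub_distrib, ← Finset.sum_sub_distrib, ← Finset.sum_sub_distrib]
  refine Finset.sum_congr rfl fun k _ => ?_
  rw [Pi.smul_apply, Pi.sub_apply, e, e, ← AvgL_sub, ← AvgL_sub, AvgL_perm hL, AvgL_perm hL, ← neg_sub, AvgL_tel, ← smul_neg, neg_sub]

include hg in
lemma Ctx.DD_K {x w z : Zd d} (hx : x ∈ GZ R') (hw : w ∈ R') (hz : z ∈ R') :
    Tendsto (fun n => ∫⁻ ω, ‖DD T (fn T V p R R' g n) x (x + w) z ω‖ₑ ∂ℙ) atTop (𝓝 0) := by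
  obtain ⟨L, hLp, hL, hLl⟩ := LL_perm hz hw
  obtain ⟨K, hK0, hK⟩ := yk_deep hg (GZ_add hx (GZ_mem hw))
  set C := C0 ℙ R V p u with hC
  set lL : ℝ := (L.length : ℝ) with hlL
  have hb : Tendsto (fun n : ℕ => (Mq n : ℝ)⁻¹ * (4 * EW ℙ V p w) + (n / (Mq n : ℝ)^2) * (4 * (C * (K + 1 + 1 + lL)))) atTop (𝓝 0) := by
    have := (Mq_top.inv_tendsto_atTop.mul_const (4 * EW ℙ V p w)).add (Mq_sq.mul_const (4 * (C * (K + 1 + 1 + lL))))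
    simpa using this
  have hb' := ENNReal.tendsto_ofReal hb
  rw [ENNReal.ofReal_zero] at hb'
  refine tendsto_of_tendsto_of_tendsto_of_le_of_le' tendsto_const_nhds hb' (Eventually.of_forall fun _ => zero_le) ?_
  filter_upwards [eventually_ge_atTop 1, hK] with n hn hKn
  have hM := Mq_pos hn
  have hM0 : (0:ℝ) < Mq n := by positivity
  have hMn : (Mq n : ℝ) ≤ n := by exact_mod_cast Mq_le hn
  set M := Mq n with hMdef
  set B : ℝ := 2 * EW ℙ V p w + (M:ℝ)⁻¹ * (2 * (C * ((K * n + M) + M + M * lL))) with hB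
  have hmain : ∀ k < n, (((M : ℝ)⁻¹ • (AvgL M (w :: L) (fun t ω => aFun T V p R ω (x + w) t - aFun T V p R ω x t) (yk R' g n k) -
        AvgL M (w :: L) (fun t ω => aFun T V p R ω (x + w) t - aFun T V p R ω x t) (yk R' g n k + M • z))), (M:ℝ)⁻¹ * (2 * B)) ∈
        {q : (Ω → ℝ) × ℝ | Integrable q.1 ℙ ∧ ∫ ω, |q.1 ω| ∂ℙ ≤ q.2} := by
    intro k hk
    have l1 := hKn k hk.le
    have l2 := l1.add (Len_nsmul M hz)
    rw [← add_sub_right_comm] at l2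
    obtain ⟨i1, b1⟩ := c.D_bound hM hL hw (l1.mono (by linarith : K * n ≤ K * n + M))
    obtain ⟨i2, b2⟩ := c.D_bound hM hL hw l2
    refine ⟨(i1.sub i2).smul _, ?_⟩
    simp only [Pi.smul_apply, Pi.sub_apply, smul_eq_mul, abs_mul, abs_of_pos (inv_pos.2 hM0)]
    rw [integral_const_mul]
    refine mul_le_mul_of_nonneg_left ?_ (inv_pos.2 hM0).le
    refine (integral_mono (i1.sub i2).abs (i1.abs.add i2.abs) fun ω => abs_sub _ _).trans ?_
    rw [integral_add' i1.abs i2.abs]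
    linarith
  have hav := avg_pair convex_abs hn hmain
  rw [← c.DD_eq hLp] at hav
  obtain ⟨i3, b3⟩ := hav
  have hn0 : (n:ℝ) ≠ 0 := by positivity
  simp only [Finset.sum_const, Finset.card_range, nsmul_eq_mul, inv_mul_cancel_left₀ hn0] at b3
  have := ofReal_integral_norm_eq_lintegral_enorm i3
  simp only [Real.norm_eq_abs] at this
  rw [← this]
  refine ENNReal.ofReal_le_ofReal (b3.trans ?_)
  have hC0 : 0 ≤ C := c.C0_nonneg
  have hl0 : 0 ≤ lL := by positivity
  have h1 : K * n + M + M + M * lL ≤ n * (K + 1 + 1 + lL) := by nlinarith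
  have h2 : C * (K * n + M + M + M * lL) ≤ C * (n * (K + 1 + 1 + lL)) := mul_le_mul_of_nonneg_left h1 hC0
  have h3 : (M:ℝ)⁻¹ * (2 * (C * ((K * n + M) + M + M * lL))) ≤ (M:ℝ)⁻¹ * (2 * (C * (n * (K + 1 + 1 + lL)))) := by gcongr
  calc (M:ℝ)⁻¹ * (2 * B) ≤ (M:ℝ)⁻¹ * (2 * (2 * EW ℙ V p w + (M:ℝ)⁻¹ * (2 * (C * (n * (K + 1 + 1 + lL)))))) := by
        gcongr
        linarith
    _ = _ := by field_simp; ring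

lemma Ctx.fn_Q1 {n : ℕ} (hn : 1 ≤ n) : fn T V p R R' g n ∈ Q1 ℙ V p R' := by
  refine avg_mem Q1_convex hn fun k _ => ?_
  refine AvgL_mem Q1_convex (Mq_pos hn) _ (LL_mem R') _ _ fun l hl _ => ?_
  set t := yk R' g n k + l.sum with ht
  have h0 : ∀ z ∈ R', t - z ∈ Gp R' := by
    intro z hz
    obtain ⟨m, hm⟩ := Nat.exists_eq_add_of_le (Mq_pos hn)
    have e : t - z = (∑ w ∈ R'.erase z, w) + m • (∑ w ∈ R', w) + xh R' g k + l.sum := by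
      rw [ht, yk, hm, add_smul, one_smul, ← Finset.add_sum_erase R' (fun w => w) hz]; abel
    rw [e]
    refine Gp_add (Gp_add (Gp_add ?_ (Gp_nsmul _ ?_)) ⟨_, rfl⟩) (Gp_list l hl)
    · exact Gp_sum _ _ fun w hw => Gp_mem (Finset.mem_of_mem_erase hw)
    · exact Gp_sum _ _ fun w hw => Gp_mem hw
  have h1 : t ∈ Gp R' := Gp_add (Gp_add (Gp_nsmul _ (Gp_sum _ _ fun w hw => Gp_mem hw)) ⟨_, rfl⟩) (Gp_list l hl)
  refine ⟨fun x => c.a_meas x t, fun z hz => ?_, ?_⟩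
  · exact (c.a_int (Gp_mono c.sub (h0 z hz))).sub (c.a_int0 (Gp_mono c.sub h1))
  · filter_upwards [c.good] with ω hω
    rw [c.Phi_eq]
    exact a_sum hω c.ppos c.psum c.sub (Gp_mono c.sub h1) (fun z hz => Gp_mono c.sub (h0 z hz)) c.T0

omit c in
lemma DD_tri {f : ℕ → Ω → Zd d → ℝ} (hT : ∀ z, MeasurePreserving (T z) ℙ ℙ)  (hf : ∀ n x, Measurable fun ω => f n ω x)
    {F : ℕ → Ω → ℝ} {F1 : ℕ → Ω → ℝ} {F2 : ℕ → Ω → ℝ} (v : Zd d)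
    (h : ∀ n ω, |F n ω| ≤ |F1 n ω| + |F2 n (T v ω)|) (m1 : ∀ n, Measurable (F1 n)) (m2 : ∀ n, Measurable (F2 n))
    (h1 : Tendsto (fun n => ∫⁻ ω, ‖F1 n ω‖ₑ ∂ℙ) atTop (𝓝 0)) (h2 : Tendsto (fun n => ∫⁻ ω, ‖F2 n ω‖ₑ ∂ℙ) atTop (𝓝 0)) :
    Tendsto (fun n => ∫⁻ ω, ‖F n ω‖ₑ ∂ℙ) atTop (𝓝 0) := by
  have h3 := h1.add h2
  rw [add_zero] at h3
  refine tendsto_of_tendsto_of_tendsto_of_le_of_le tendsto_const_nhds h3 (fun _ => zero_le) fun n => ?_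
  have e : ∫⁻ ω, ‖F2 n ω‖ₑ ∂ℙ = ∫⁻ ω, ‖F2 n (T v ω)‖ₑ ∂ℙ := ((hT v).lintegral_comp (m2 n).enorm).symm
  simp only
  rw [e, ← lintegral_add_left (m1 n).enorm]
  refine lintegral_mono fun ω => ?_
  rw [Real.enorm_eq_ofReal_abs, Real.enorm_eq_ofReal_abs, Real.enorm_eq_ofReal_abs, ← ENNReal.ofReal_add (abs_nonneg _) (abs_nonneg _)]
  exact ENNReal.ofReal_le_ofReal (h n ω)

omit c in
lemma DD_meas (hT : ∀ z, Measurable (T z)) {f : Ω → Zd d → ℝ} (hf : ∀ x, Measurable fun ω => f ω x) (x y v : Zd d) :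
    Measurable (DD T f x y v) := by
  unfold DD
  exact ((hf _).sub (hf _)).sub (((hf _).comp (hT v)).sub ((hf _).comp (hT v)))

lemma Ctx.DD_all {f : ℕ → Ω → Zd d → ℝ} (hf : ∀ n x, Measurable fun ω => f n ω x)
    (hK : ∀ x ∈ GZ R', ∀ w ∈ R', ∀ z ∈ R', Tendsto (fun n => ∫⁻ ω, ‖DD T (f n) x (x + w) z ω‖ₑ ∂ℙ) atTop (𝓝 0)) :
    ∀ v ∈ GZ R', ∀ x ∈ GZ R', ∀ y ∈ GZ R', Tendsto (fun n => ∫⁻ ω, ‖DD T (f n) x y v ω‖ₑ ∂ℙ) atTop (𝓝 0) := by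
  have hTm := fun z => (c.mp z).measurable
  have hT0 : ∀ ω, T 0 ω = ω := fun ω => by rw [c.T0]; rfl
  have hTT : ∀ v w ω, T v (T w ω) = T (v + w) ω := fun v w ω => by rw [c.Tadd]; rfl
  have hm := fun n x y v => DD_meas hTm (hf n) x y v
  intro v hv
  rw [GZ_eq] at hv
  induction hv using AddSubgroup.closure_induction with
  | mem z hz =>
    have hz : z ∈ R' := hz
    suffices H : ∀ h ∈ GZ R', ∀ x ∈ GZ R', Tendsto (fun n => ∫⁻ ω, ‖DD T (f n) x (x + h) z ω‖ₑ ∂ℙ) atTop (𝓝 0) by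
      intro x hx y hy
      have := H (y - x) (GZ_sub hy hx) x hx
      rwa [add_sub_cancel] at this
    intro h hh
    rw [GZ_eq] at hh
    induction hh using AddSubgroup.closure_induction with
    | mem w hw => exact fun x hx => hK x hx w hw z hz
    | zero => intro x hx; simp [DD]
    | add a b ha hb iha ihb =>
      intro x hx
      have ha2 : a ∈ GZ R' := by rw [GZ_eq]; exact ha
      refine DD_tri c.mp hf (F1 := fun n => DD T (f n) x (x + a) z) (F2 := fun n => DD T (f n) (x + a) (x + a + b) z) 0 ?_
        (fun n => hm n _ _ _) (fun n => hm n _ _ _) (iha x hx) (ihb (x + a) (GZ_add hx ha2))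
      intro n ω
      rw [hT0]
      refine le_trans (le_of_eq ?_) (abs_add_le _ _)
      congr 1
      unfold DD
      rw [← add_assoc]
      ring
    | neg a ha iha =>
      intro x hx
      have ha2 : a ∈ GZ R' := by rw [GZ_eq]; exact ha
      have := iha (x + -a) (GZ_add hx (GZ_neg ha2))
      refine this.congr fun n => lintegral_congr fun ω => ?_
      rw [← enorm_neg]
      congr 1
      unfold DD
      rw [neg_add_cancel_right]
      ring
  | zero =>
    intro x hx y hy
    simp [DD, hT0]
  | add a b ha hb iha ihb =>
    intro x hx y hy
    have ha2 : a ∈ GZ R' := by rw [GZ_eq]; exact ha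
    refine DD_tri c.mp hf (F1 := fun n => DD T (f n) x y a) (F2 := fun n => DD T (f n) (x - a) (y - a) b) a ?_
        (fun n => hm n _ _ _) (fun n => hm n _ _ _) (iha x hx y hy) (ihb _ (GZ_sub hx ha2) _ (GZ_sub hy ha2))
    intro n ω
    refine le_trans (le_of_eq ?_) (abs_add_le _ _)
    congr 1
    unfold DD
    rw [hTT, sub_sub, sub_sub, add_comm b a]
    ring
  | neg a ha iha =>
    intro x hx y hy
    have ha2 : a ∈ GZ R' := by rw [GZ_eq]; exact ha
    refine DD_tri c.mp hf (F1 := fun n ω => 0) (F2 := fun n => DD T (f n) (x + a) (y + a) a) (-a) ?_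
        (fun n => measurable_const) (fun n => hm n _ _ _) (by simp) (iha _ (GZ_add hx ha2) _ (GZ_add hy ha2))
    intro n ω
    rw [abs_zero, zero_add, ← abs_neg]
    refine le_of_eq ?_
    congr 1
    unfold DD
    rw [hTT, add_neg_cancel, hT0, add_sub_cancel_right, add_sub_cancel_right, sub_neg_eq_add, sub_neg_eq_add]
    ring

include hg in
lemma Ctx.P3 : ∀ x ∈ GZ R', ∀ v ∈ GZ R',
    Tendsto (fun n => ∫⁻ ω, ‖Dfct T (fn T V p R R' g (n+1)) x v ω‖ₑ ∂ℙ) atTop (𝓝 0) := by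
  intro x hx v hv
  have := c.DD_all (f := fun n => fn T V p R R' g (n+1)) (fun n x => (c.fn_Q1 (Nat.le_add_left 1 n)).1 x)
    (fun x hx w hw z hz => (tendsto_add_atTop_iff_nat 1).2 (c.DD_K hg hx hw hz)) v hv v hv (x + v) (GZ_add hx hv)
  refine this.congr fun n => lintegral_congr fun ω => ?_
  simp [DD, Dfct]

end ctx
end RWRP

namespace RWRP
variable {d : ℕ} {Ω : Type*}

lemma AvgL_mono {M : ℕ} (hM : 1 ≤ M) {R' : Finset (Zd d)} (L : List (Zd d)) (hL : ∀ z ∈ L, z ∈ R')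
    (F G : Zd d → ℝ) (y : Zd d)
    (h : ∀ l : List (Zd d), (∀ z ∈ l, z ∈ R') → F (y + l.sum) ≤ G (y + l.sum)) : AvgL M L F y ≤ AvgL M L G y := by
  have := AvgL_mem (S := Set.Ici (0:ℝ)) (convex_Ici _) hM L hL (fun t => G t - F t) y (fun l h1 _ => by
    have := h l h1
    simpa using this)
  rw [AvgL_sub] at this
  have := Set.mem_Ici.1 this
  linarith

lemma floor_lim {a : ℝ} (ha : 0 ≤ a) (j : ℕ) : Tendsto (fun n : ℕ => (n:ℝ)⁻¹ * (⌊((n - j : ℕ):ℝ) * a⌋₊ : ℝ)) atTop (𝓝 a) := by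
  have h1 : Tendsto (fun n : ℕ => a - (j * a + 1) * (n:ℝ)⁻¹) atTop (𝓝 a) := by
    have := (tendsto_inv_atTop_nhds_zero_nat (𝕜 := ℝ)).const_mul (j * a + 1)
    simpa using this.const_sub a
  refine tendsto_of_tendsto_of_tendsto_of_le_of_le' h1 (tendsto_const_nhds (x := a)) ?_ ?_
  · filter_upwards [eventually_ge_atTop 1, eventually_ge_atTop j] with n hn hj
    have hn0 : (0:ℝ) < n := by positivity
    have h2 := Nat.lt_floor_add_one (((n - j : ℕ):ℝ) * a)
    rw [Nat.cast_sub hj] at *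
    have e : a - (j * a + 1) * (n:ℝ)⁻¹ = (n:ℝ)⁻¹ * (n * a - j * a - 1) := by field_simp; ring
    rw [e]
    gcongr
    linarith
  · filter_upwards [eventually_ge_atTop 1] with n hn
    have hn0 : (0:ℝ) < n := by positivity
    have h2 := Nat.floor_le (a := ((n - j : ℕ):ℝ) * a) (by positivity)
    have h3 : ((n - j : ℕ):ℝ) ≤ n := by exact_mod_cast Nat.sub_le _ _
    have h4 : ((n - j : ℕ):ℝ) * a ≤ n * a := by gcongr
    calc (n:ℝ)⁻¹ * (⌊((n - j : ℕ):ℝ) * a⌋₊ : ℝ) ≤ (n:ℝ)⁻¹ * (n * a) := by gcongr; linarith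
      _ = a := by field_simp

lemma xh_lim {R' : Finset (Zd d)} {g : Zd d → ℝ} (hg : ∀ z, 0 ≤ g z) {ξ : Fin d → ℝ} (hξ : ∑ z ∈ R', g z • toR z = ξ) (j : ℕ) :
    Tendsto (fun n : ℕ => (n:ℝ)⁻¹ • toR (xh R' g (n - j))) atTop (𝓝 ξ) := by
  have e : ∀ n : ℕ, (n:ℝ)⁻¹ • toR (xh R' g (n - j)) = ∑ z ∈ R', ((n:ℝ)⁻¹ * (⌊((n - j : ℕ):ℝ) * g z⌋₊ : ℝ)) • toR z := by
    intro n
    unfold xh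
    rw [toR_sum, Finset.smul_sum]
    refine Finset.sum_congr rfl fun z _ => ?_
    rw [toR_nsmul, smul_smul]
  simp only [e]
  rw [← hξ]
  exact tendsto_finsetSum _ fun z _ => (floor_lim (hg z) j).smul_const _

lemma Len_coord {R' : Finset (Zd d)} (l : List (Zd d)) (hl : ∀ z ∈ l, z ∈ R') (i : Fin d) :
    |toR l.sum i| ≤ l.length * ∑ z ∈ R', |toR z i| := by
  induction l with
  | nil => simp [toR]
  | cons a l ih =>
    rw [List.sum_cons, toR_add, Pi.add_apply, List.length_cons]
    refine (abs_add_le _ _).trans ?_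
    have h1 := ih fun z hz => hl z (by simp [hz])
    have h2 := Finset.single_le_sum (f := fun z => |toR z i|) (fun _ _ => abs_nonneg _) (hl a (by simp))
    push_cast
    linarith

lemma small_lim {R' : Finset (Zd d)} {l : ℕ → List (Zd d)} (hl : ∀ n, ∀ z ∈ l n, z ∈ R') {b : ℕ}
    (hb : ∀ n, (l n).length ≤ Mq n * b) :
    Tendsto (fun n : ℕ => (n:ℝ)⁻¹ • toR (l n).sum) atTop (𝓝 0) := by
  rw [tendsto_pi_nhds]
  intro i
  have h1 := Mq_div.mul_const (b * ∑ z ∈ R', |toR z i|)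
  rw [zero_mul] at h1
  refine squeeze_zero_norm (fun n => ?_) h1
  rw [Pi.smul_apply, smul_eq_mul, Real.norm_eq_abs, abs_mul, abs_of_nonneg (by positivity : (0:ℝ) ≤ (n:ℝ)⁻¹), div_eq_inv_mul, mul_assoc]
  refine mul_le_mul_of_nonneg_left ((Len_coord _ (hl n) i).trans ?_) (by positivity)
  have h2 : ((l n).length : ℝ) ≤ Mq n * b := by exact_mod_cast hb n
  have h3 : 0 ≤ ∑ z ∈ R', |toR z i| := Finset.sum_nonneg fun _ _ => abs_nonneg _
  rw [← mul_assoc]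
  gcongr

section ctx
variable [MeasurableSpace Ω] {ℙ : Measure Ω} [IsProbabilityMeasure ℙ] {T : Zd d → Ω → Ω} {R : Finset (Zd d)}
    {V : Ω → Zd d → ℝ} {p : Zd d → ℝ} {R' : Finset (Zd d)} {u : (Fin d → ℝ) →ₗ[ℝ] ℝ}
    {g : Zd d → ℝ} (c : Ctx ℙ T R V p R' u) (hg : ∀ z, 0 < g z)
include c

lemma Ctx.fn_int {n : ℕ} (hn : 1 ≤ n) {x : Zd d} (h : ∀ k < n, yk R' g n k - x ∈ Gp R') :
    Integrable (fun ω => fn T V p R R' g n ω x) ℙ ∧ ∫ ω, fn T V p R R' g n ω x ∂ℙ =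
      (n:ℝ)⁻¹ * ∑ k ∈ Finset.range n, AvgL (Mq n) (LL R') (ef ℙ T R V p) (yk R' g n k - x) := by
  have key := avg_pair (convex_eq (ℙ := ℙ)) hn (G := fun k => AvgL (Mq n) (LL R') (fun t ω => aFun T V p R ω x t) (yk R' g n k))
    (r := fun k => AvgL (Mq n) (LL R') (ef ℙ T R V p) (yk R' g n k - x)) ?_
  · rw [← fn_evx] at key
    exact key
  · intro k hk
    have := AvgL_mem (convex_eq (ℙ := ℙ)) (Mq_pos hn) (LL R') (LL_mem R')
      (fun t => ((fun ω => aFun T V p R ω x t), ef ℙ T R V p (t + -x))) (yk R' g n k) ?_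
    · rw [AvgL_pair, AvgL_shift, ← sub_eq_add_neg] at this
      exact this
    · intro l hl _
      refine ⟨c.a_int ?_, ?_⟩
      · rw [add_sub_right_comm]
        exact Gp_mono c.sub (Gp_add (h k hk) (Gp_list l hl))
      · simp only
        rw [c.a_integral, sub_eq_add_neg]

variable (ℙ T R V p R' g) in
omit [IsProbabilityMeasure ℙ] c in
def mn (n : ℕ) (x : Zd d) : ℝ := ∫ ω, fn T V p R R' g n ω x ∂ℙ

include hg in
lemma Ctx.mn_add {x v : Zd d} (hx : x ∈ GZ R') (hv : v ∈ GZ R') :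
    Tendsto (fun n => mn ℙ T R V p R' g n (x + v) - mn ℙ T R V p R' g n v - (mn ℙ T R V p R' g n x - mn ℙ T R V p R' g n 0)) atTop (𝓝 0) := by
  have h3 := (tendsto_add_atTop_iff_nat (f := fun n => ∫⁻ ω, ‖Dfct T (fn T V p R R' g n) x v ω‖ₑ ∂ℙ) 1).1 (c.P3 hg x hx v hv)
  have h4 : Tendsto (fun n => ‖∫ ω, Dfct T (fn T V p R R' g n) x v ω ∂ℙ‖ₑ) atTop (𝓝 0) :=
    tendsto_of_tendsto_of_tendsto_of_le_of_le tendsto_const_nhds h3 (fun _ => zero_le) fun n => enorm_integral_le_lintegral_enorm _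
  have h5 := tendsto_zero_iff_enorm_tendsto_zero.2 h4
  refine h5.congr' ?_
  have hI : ∀ y ∈ GZ R', ∀ᶠ n in atTop, Integrable (fun ω => fn T V p R R' g n ω y) ℙ := by
    intro y hy
    obtain ⟨K, _, hK⟩ := yk_deep hg hy
    filter_upwards [hK, eventually_ge_atTop 1] with n h1 h2
    exact (c.fn_int h2 fun k hk => (h1 k hk.le).gp).1
  filter_upwards [hI _ (GZ_add hx hv), hI v hv, hI x hx, hI 0 (GZ_zero _)] with n i1 i2 i3 i4
  have i3' : Integrable (fun ω => fn T V p R R' g n (T v ω) x) ℙ := (c.mp v).integrable_comp_of_integrable i3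
  have i4' : Integrable (fun ω => fn T V p R R' g n (T v ω) 0) ℙ := (c.mp v).integrable_comp_of_integrable i4
  unfold Dfct mn
  have e3 := integral_shift c.mp i3.aestronglyMeasurable v
  have e4 := integral_shift c.mp i4.aestronglyMeasurable v
  rw [← e3, ← e4, ← integral_sub i1 i2, ← integral_sub i3' i4']
  exact integral_sub (i1.sub i2) (i3'.sub i4')

include hg in
lemma Ctx.mn_list (l : List (Zd d)) (hl : ∀ z ∈ l, z ∈ R') :
    Tendsto (fun n => mn ℙ T R V p R' g n l.sum - mn ℙ T R V p R' g n 0 -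
      (l.map fun z => mn ℙ T R V p R' g n z - mn ℙ T R V p R' g n 0).sum) atTop (𝓝 0) := by
  induction l with
  | nil => simp
  | cons a l ih =>
    have h1 := ih fun z hz => hl z (by simp [hz])
    have h2 := c.mn_add hg (x := a) (v := l.sum) (GZ_mem (hl a (by simp))) (Gp_GZ (Gp_list l fun z hz => hl z (by simp [hz])))
    have h3 := h1.add h2
    rw [add_zero] at h3
    refine h3.congr fun n => ?_
    simp only [List.sum_cons, List.map_cons]
    ring

/-- first boundary term -/
lemma Ctx.bd1 (hg : ∀ z, 0 < g z) {x : Zd d} (hx : x ∈ GZ R') (k : ℕ) :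
    Tendsto (fun n : ℕ => (n:ℝ)⁻¹ * AvgL (Mq n) (LL R') (ef ℙ T R V p) (yk R' g n k - x)) atTop (𝓝 0) := by
  obtain ⟨κ, K, h⟩ := GZ_deep hx
  have h1 : Tendsto (fun n : ℕ => C0 ℙ R V p u * ((n:ℝ)⁻¹ * (K + k * ∑ z ∈ R', g z) + (Mq n / n : ℝ) * (R'.card + (LL R').length))) atTop (𝓝 0) := by
    have := (((tendsto_inv_atTop_nhds_zero_nat (𝕜 := ℝ)).mul_const (K + k * ∑ z ∈ R', g z)).add
      (Mq_div.mul_const ((R'.card : ℝ) + (LL R').length))).const_mul (C0 ℙ R V p u)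
    simpa using this
  refine squeeze_zero_norm' ?_ h1
  filter_upwards [eventually_ge_atTop 1, Mq_top.eventually_ge_atTop (κ:ℝ)] with n hn hM
  have hM' : κ ≤ Mq n := by exact_mod_cast hM
  have hl := (h (Mq n) hM').add (xh_len R' hg k)
  rw [← add_sub_right_comm] at hl
  have := c.avg_abs (Mq_pos hn) (LL_mem R') hl
  rw [Real.norm_eq_abs, abs_mul, abs_of_nonneg (by positivity : (0:ℝ) ≤ (n:ℝ)⁻¹)]
  calc (n:ℝ)⁻¹ * _ ≤ (n:ℝ)⁻¹ * _ := mul_le_mul_of_nonneg_left this (by positivity)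
    _ = _ := by rw [div_eq_inv_mul]; ring

/-- second boundary term -/
lemma Ctx.bd2 (hg : ∀ z, 0 < g z) {ξ : Fin d → ℝ} (hξ : ∑ z ∈ R', g z • toR z = ξ) {s : ℝ}
    (hs : ∀ x : ℕ → Zd d, (∀ n, x n ∈ Gp R') → Tendsto (fun n : ℕ => (n : ℝ)⁻¹ • toR (x n)) atTop (𝓝 ξ) →
      ∀ᵐ ω ∂ℙ, Tendsto (fun n : ℕ => aFun T V p R ω 0 (x n) / n) atTop (𝓝 s)) (j : ℕ) {ε : ℝ} (hε : 0 < ε) :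
    ∀ᶠ n : ℕ in atTop, s - ε ≤ (n:ℝ)⁻¹ * AvgL (Mq n) (LL R') (ef ℙ T R V p) (yk R' g n (n - j)) := by
  have hex : ∀ n : ℕ, ∃ l : List (Zd d), (∀ z ∈ l, z ∈ R') ∧ l.length ≤ Mq n * (LL R').length ∧
      (1 ≤ n → ef ℙ T R V p (yk R' g n (n - j) + l.sum) ≤ AvgL (Mq n) (LL R') (ef ℙ T R V p) (yk R' g n (n - j))) := by
    intro n
    by_cases hn : 1 ≤ n
    · obtain ⟨l, h1, h2, h3⟩ := AvgL_exists_le (Mq_pos hn) (LL R') (LL_mem R') (ef ℙ T R V p) (yk R' g n (n - j))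
      exact ⟨l, h1, h2, fun _ => h3⟩
    · exact ⟨[], by simp, by simp, fun h => absurd h hn⟩
  choose l hl hlen hle using hex
  set x : ℕ → Zd d := fun n => yk R' g n (n - j) + (l n).sum with hx
  have hxG : ∀ n, x n ∈ Gp R' := fun n =>
    Gp_add (Gp_add (Gp_nsmul _ (Gp_sum _ _ fun w hw => Gp_mem hw)) ⟨_, rfl⟩) (Gp_list _ (hl n))
  have hxl : Tendsto (fun n : ℕ => (n : ℝ)⁻¹ • toR (x n)) atTop (𝓝 ξ) := by
    have h1 := ((Mq_div.smul_const (toR (∑ z ∈ R', z))).add (xh_lim (fun z => (hg z).le) hξ j)).add (small_lim hl hlen)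
    rw [zero_smul, zero_add, add_zero] at h1
    refine h1.congr fun n => ?_
    simp only [hx, yk]
    rw [toR_add, toR_add, toR_nsmul, smul_add, smul_add, smul_smul, div_eq_inv_mul]
  have hlim := hs x hxG hxl
  have hu : Tendsto (fun n : ℕ => - u ((n : ℝ)⁻¹ • toR (x n))) atTop (𝓝 (- u ξ)) :=
    ((u.continuous_of_finiteDimensional.tendsto ξ).comp hxl).neg
  obtain ⟨b, hb⟩ := hu.bddBelow_range
  have hxG' := fun n => Gp_mono c.sub (hxG n)
  have key := fatou_real (ℙ := ℙ) (f := fun n ω => aFun T V p R ω 0 (x n) / n) (g := fun n ω => aFun T V p R ω 0 (x n) / n)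
    (c := b) (fun n => (c.a_int0 (hxG' n)).div_const _) (fun n => ?_) (fun n => ((c.a_int0 (hxG' n)).div_const _).aestronglyMeasurable)
    (fun n => Eventually.of_forall fun ω => le_rfl) hlim hε
  · filter_upwards [key, eventually_ge_atTop 1] with n h1 h2
    refine h1.trans ?_
    rw [integral_div, div_eq_inv_mul]
    exact mul_le_mul_of_nonneg_left (hle n h2) (by positivity)
  · filter_upwards [c.good] with ω hω
    have h1 := a_lower hω c.ppos c.psum (x := 0) (y := x n) (by simpa using hxG' n)
    rw [toR_zero, map_zero, zero_sub] at h1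
    have h2 : b ≤ - u ((n : ℝ)⁻¹ • toR (x n)) := hb ⟨n, rfl⟩
    rw [map_smul, smul_eq_mul, ← mul_neg] at h2
    rw [div_eq_inv_mul]
    exact h2.trans (mul_le_mul_of_nonneg_left h1 (by positivity))

end ctx
end RWRP

namespace RWRP
variable {d : ℕ} {Ω : Type*}

lemma floor_add_cases {x y : ℝ} (hx : 0 ≤ x) (hy : 0 ≤ y) :
    ∃ e : ℕ, e ≤ 1 ∧ ⌊x + y⌋₊ = ⌊x⌋₊ + ⌊y⌋₊ + e := by
  have h1 : ⌊x⌋₊ + ⌊y⌋₊ ≤ ⌊x + y⌋₊ := by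
    apply Nat.le_floor
    push_cast
    exact add_le_add (Nat.floor_le hx) (Nat.floor_le hy)
  have h2 : ⌊x + y⌋₊ < ⌊x⌋₊ + ⌊y⌋₊ + 2 := by
    rw [Nat.floor_lt (by positivity)]
    push_cast
    linarith [Nat.lt_floor_add_one x, Nat.lt_floor_add_one y]
  exact ⟨⌊x + y⌋₊ - (⌊x⌋₊ + ⌊y⌋₊), by omega, by omega⟩

lemma xh_add (R' : Finset (Zd d)) {g : Zd d → ℝ} (hg : ∀ z, 0 < g z) (q j : ℕ) :
    ∃ l : List (Zd d), (∀ z ∈ l, z ∈ R') ∧ l.length ≤ R'.card ∧ xh R' g (q + j) = xh R' g q + xh R' g j + l.sum := by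
  have h : ∀ z, ∃ e : ℕ, e ≤ 1 ∧ ⌊((q + j : ℕ) : ℝ) * g z⌋₊ = ⌊(q:ℝ) * g z⌋₊ + ⌊(j:ℝ) * g z⌋₊ + e := by
    intro z
    rw [Nat.cast_add, add_mul]
    have := (hg z).le
    exact floor_add_cases (by positivity) (by positivity)
  choose e he1 he2 using h
  obtain ⟨l, h1, h2, h3, -⟩ := exists_list R' e
  refine ⟨l, h1, ?_, ?_⟩
  · rw [h3]
    refine (Finset.sum_le_card_nsmul _ _ 1 fun z _ => he1 z).trans (by simp)
  · rw [h2]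
    simp only [xh, he2, add_smul, Finset.sum_add_distrib]

section ctx
variable [MeasurableSpace Ω] {ℙ : Measure Ω} [IsProbabilityMeasure ℙ] {T : Zd d → Ω → Ω} {R : Finset (Zd d)}
    {V : Ω → Zd d → ℝ} {p : Zd d → ℝ} {R' : Finset (Zd d)} {u : (Fin d → ℝ) →ₗ[ℝ] ℝ}
    {g : Zd d → ℝ} (c : Ctx ℙ T R V p R' u) (hg : ∀ z, 0 < g z)
include c

include hg in
lemma Ctx.ek_add {n : ℕ} (hn : 1 ≤ n) (q j : ℕ) :
    AvgL (Mq n) (LL R') (ef ℙ T R V p) (yk R' g n (q + j) - xh R' g q) ≤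
      AvgL (Mq n) (LL R') (ef ℙ T R V p) (yk R' g n j) + C0 ℙ R V p u * R'.card := by
  obtain ⟨l, hl, hlen, he⟩ := xh_add R' hg q j
  have e1 : yk R' g n (q + j) - xh R' g q = yk R' g n j + l.sum := by
    simp only [yk, he]; abel
  rw [e1, ← AvgL_shift, ← AvgL_const (Mq_pos hn) (LL R') (C0 ℙ R V p u * R'.card) (yk R' g n j), ← AvgL_add]
  refine AvgL_mono (Mq_pos hn) (LL R') (LL_mem R') _ _ _ fun m hm => ?_
  have hy : yk R' g n j + m.sum ∈ Gp R' :=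
    Gp_add (Gp_add (Gp_nsmul _ (Gp_sum _ _ fun w hw => Gp_mem hw)) ⟨_, rfl⟩) (Gp_list _ hm)
  have h1 := c.e_list (Gp_mono c.sub hy) l fun z hz => c.sub (hl z hz)
  have h2 := (c.list_bound l fun z hz => c.sub (hl z hz)).1
  have h3 : C0 ℙ R V p u * l.length ≤ C0 ℙ R V p u * R'.card :=
    mul_le_mul_of_nonneg_left (by exact_mod_cast hlen) c.C0_nonneg
  linarith

include hg in
lemma Ctx.mn_xh (q : ℕ) : ∀ᶠ n : ℕ in atTop, mn ℙ T R V p R' g n (xh R' g q) - mn ℙ T R V p R' g n 0 ≤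
    C0 ℙ R V p u * R'.card
    + ∑ k ∈ Finset.range q, (n:ℝ)⁻¹ * AvgL (Mq n) (LL R') (ef ℙ T R V p) (yk R' g n k - xh R' g q)
    - ∑ i ∈ Finset.range q, (n:ℝ)⁻¹ * AvgL (Mq n) (LL R') (ef ℙ T R V p) (yk R' g n (n - (q - i))) := by
  have hxq : xh R' g q ∈ GZ R' := Gp_GZ ⟨_, rfl⟩
  obtain ⟨K, _, hK⟩ := yk_deep hg hxq
  obtain ⟨K', _, hK'⟩ := yk_deep hg (GZ_zero R')
  filter_upwards [hK, hK', eventually_ge_atTop 1, eventually_ge_atTop q] with n h1 h2 hn hq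
  have hC : 0 ≤ C0 ℙ R V p u * R'.card := mul_nonneg c.C0_nonneg (by positivity)
  unfold mn
  rw [(c.fn_int hn fun k hk => (h1 k hk.le).gp).2, (c.fn_int hn fun k hk => (h2 k hk.le).gp).2]
  obtain ⟨m, rfl⟩ := Nat.exists_eq_add_of_le hq
  rw [Finset.sum_range_add]
  have hs2 : ∑ k ∈ Finset.range (q + m), AvgL (Mq (q + m)) (LL R') (ef ℙ T R V p) (yk R' g (q + m) k - 0)
      = ∑ j ∈ Finset.range m, AvgL (Mq (q + m)) (LL R') (ef ℙ T R V p) (yk R' g (q + m) j)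
      + ∑ i ∈ Finset.range q, AvgL (Mq (q + m)) (LL R') (ef ℙ T R V p) (yk R' g (q + m) (q + m - (q - i))) := by
    simp only [sub_zero]
    rw [add_comm q m, Finset.sum_range_add]
    congr 1
    refine Finset.sum_congr rfl fun i hi => ?_
    rw [Finset.mem_range] at hi
    rw [show m + q - (q - i) = m + i by omega]
  rw [hs2]
  have hb : ∑ j ∈ Finset.range m, AvgL (Mq (q + m)) (LL R') (ef ℙ T R V p) (yk R' g (q + m) (q + j) - xh R' g q) ≤
      ∑ j ∈ Finset.range m, AvgL (Mq (q + m)) (LL R') (ef ℙ T R V p) (yk R' g (q + m) j) + ((q + m : ℕ) : ℝ) * (C0 ℙ R V p u * R'.card) := by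
    refine (Finset.sum_le_sum fun j _ => c.ek_add hg hn q j).trans ?_
    rw [Finset.sum_add_distrib, Finset.sum_const, Finset.card_range, nsmul_eq_mul]
    gcongr
    omega
  have hn0 : (0:ℝ) < ((q + m : ℕ) : ℝ) := by exact_mod_cast hn
  rw [← Finset.mul_sum, ← Finset.mul_sum]
  have hb' := mul_le_mul_of_nonneg_left hb (inv_nonneg.2 hn0.le)
  rw [mul_add, inv_mul_cancel_left₀ hn0.ne'] at hb'
  rw [mul_add, mul_add]
  linarith

variable {ξ : Fin d → ℝ} {s : ℝ}

lemma Ctx.mn_q (hg : ∀ z, 0 < g z) (hξ : ∑ z ∈ R', g z • toR z = ξ)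
    (hs : ∀ x : ℕ → Zd d, (∀ n, x n ∈ Gp R') → Tendsto (fun n : ℕ => (n : ℝ)⁻¹ • toR (x n)) atTop (𝓝 ξ) →
      ∀ᵐ ω ∂ℙ, Tendsto (fun n : ℕ => aFun T V p R ω 0 (x n) / n) atTop (𝓝 s)) (q : ℕ) :
    ∀ᶠ n : ℕ in atTop, ∑ z ∈ R', (⌊(q:ℝ) * g z⌋₊ : ℝ) * (mn ℙ T R V p R' g n z - mn ℙ T R V p R' g n 0) ≤
      C0 ℙ R V p u * R'.card - q * s + 1 := by
  obtain ⟨l, hl, hsum, -, hmap⟩ := exists_list R' (fun z => ⌊(q:ℝ) * g z⌋₊)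
  have hml := c.mn_list hg l hl
  have hxq : xh R' g q ∈ GZ R' := Gp_GZ ⟨_, rfl⟩
  have hb1 : Tendsto (fun n : ℕ => ∑ k ∈ Finset.range q, (n:ℝ)⁻¹ * AvgL (Mq n) (LL R') (ef ℙ T R V p) (yk R' g n k - xh R' g q)) atTop (𝓝 0) := by
    have := tendsto_finsetSum (Finset.range q) fun k _ => c.bd1 hg hxq k
    simpa using this
  have hε : (0:ℝ) < 1 / (4 * (q + 1)) := by positivity
  have hb2 : ∀ᶠ n : ℕ in atTop, ∀ i ∈ Finset.range q, s - 1 / (4 * (q + 1)) ≤ (n:ℝ)⁻¹ * AvgL (Mq n) (LL R') (ef ℙ T R V p) (yk R' g n (n - (q - i))) :=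
    (Finset.eventually_all _).2 fun i _ => c.bd2 hg hξ hs (q - i) hε
  filter_upwards [c.mn_xh hg q, hb2, hb1.eventually_lt_const (by norm_num : (0:ℝ) < 1/4),
    hml.eventually_const_lt (by norm_num : (-(1/4):ℝ) < 0)] with n h1 h2 h3 h4
  have h5 := Finset.sum_le_sum h2
  rw [Finset.sum_const, Finset.card_range, nsmul_eq_mul] at h5
  have h6 : (q:ℝ) * (1 / (4 * (q + 1))) ≤ 1/4 := by
    rw [mul_one_div, div_le_div_iff₀ (by positivity) (by norm_num)]
    linarith
  rw [hmap, hsum] at h4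
  change _ < mn ℙ T R V p R' g n (xh R' g q) - _ - _ at h4
  rw [mul_sub] at h5
  linarith

theorem Ctx.exists_B (hg : ∀ z, 0 < g z) (hξ : ∑ z ∈ R', g z • toR z = ξ)
    (hs : ∀ x : ℕ → Zd d, (∀ n, x n ∈ Gp R') → Tendsto (fun n : ℕ => (n : ℝ)⁻¹ • toR (x n)) atTop (𝓝 ξ) →
      ∀ᵐ ω ∂ℙ, Tendsto (fun n : ℕ => aFun T V p R ω 0 (x n) / n) atTop (𝓝 s)) :
    ∃ B, InKplus ℙ T V p R' B ∧ ∑ z ∈ R', g z * ∫ ω, B ω 0 z ∂ℙ ≤ -s := by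
  have hI : ∀ y ∈ GZ R', ∀ᶠ n in atTop, Integrable (fun ω => fn T V p R R' g n ω y) ℙ := by
    intro y hy
    obtain ⟨K, _, hK⟩ := yk_deep hg hy
    filter_upwards [hK, eventually_ge_atTop 1] with n h1 h2
    exact (c.fn_int h2 fun k hk => (h1 k hk.le).gp).1
  have hE : ∀ᶠ n in atTop, ∀ z ∈ R', ∫ ω, (fn T V p R R' g n ω z - fn T V p R R' g n ω 0) ∂ℙ =
      mn ℙ T R V p R' g n z - mn ℙ T R V p R' g n 0 := by
    refine (Finset.eventually_all _).2 fun z hz => ?_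
    filter_upwards [hI z (GZ_mem hz), hI 0 (GZ_zero _)] with n i1 i2
    exact integral_sub i1 i2
  have hQ : ∀ q : ℕ, ∀ᶠ n in atTop, ∑ z ∈ R', (⌊(q:ℝ) * g z⌋₊ : ℝ) * ∫ ω, (fn T V p R R' g n ω z - fn T V p R R' g n ω 0) ∂ℙ ≤
      C0 ℙ R V p u * R'.card - q * s + 1 := by
    intro q
    filter_upwards [c.mn_q hg hξ hs q, hE] with n h1 h2
    rw [Finset.sum_congr rfl fun z hz => by rw [h2 z hz]]
    exact h1
  have hLow : ∀ n, 1 ≤ n → ∀ z ∈ R', -EW ℙ V p z ≤ ∫ ω, (fn T V p R R' g n ω z - fn T V p R R' g n ω 0) ∂ℙ := by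
    intro n hn z hz
    have hq := c.fn_Q1 (g := g) hn
    have h0 : 0 ≤ ∫ ω, ((fn T V p R R' g n ω z - fn T V p R R' g n ω 0) + Wf V p ω z) ∂ℙ := by
      refine integral_nonneg_of_ae ?_
      filter_upwards [hq.2.2] with ω hω using c.step_lower hω hz
    rw [integral_add (hq.2.1 z hz) (c.W_int (c.sub hz))] at h0
    change 0 ≤ _ + EW ℙ V p z at h0
    linarith
  have hbig : ∃ q : ℕ, ∀ z ∈ R', 1 ≤ ⌊(q:ℝ) * g z⌋₊ := by
    have : ∀ᶠ q : ℕ in atTop, ∀ z ∈ R', 1 ≤ ⌊(q:ℝ) * g z⌋₊ := by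
      refine (Finset.eventually_all _).2 fun z _ => ?_
      have := (tendsto_natCast_atTop_atTop (R := ℝ)).atTop_mul_const (hg z)
      filter_upwards [this.eventually_ge_atTop 1] with q hq
      exact Nat.le_floor (by exact_mod_cast hq)
    exact this.exists
  obtain ⟨q, hq⟩ := hbig
  set C1 : ℝ := |C0 ℙ R V p u * R'.card - q * s + 1 + ∑ z ∈ R', (⌊(q:ℝ) * g z⌋₊ : ℝ) * EW ℙ V p z| with hC1
  obtain ⟨B, hB, hcl⟩ := c.CL (fun n => fn T V p R R' g (n + 1)) (fun n => c.fn_Q1 (Nat.le_add_left 1 n)) (c.P3 hg) ⟨C1, by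
    filter_upwards [(tendsto_add_atTop_nat 1).eventually (hQ q)] with n hn z hz
    set b : Zd d → ℝ := fun z => ∫ ω, (fn T V p R R' g (n + 1) ω z - fn T V p R R' g (n + 1) ω 0) ∂ℙ with hb
    have hl : ∀ w ∈ R', 0 ≤ b w + EW ℙ V p w := fun w hw => by linarith [hLow (n+1) (by omega) w hw]
    have hn' : ∑ z ∈ R', (⌊(q:ℝ) * g z⌋₊ : ℝ) * b z ≤ C0 ℙ R V p u * R'.card - q * s + 1 := hn
    have hsl := Finset.single_le_sum (f := fun w => (⌊(q:ℝ) * g w⌋₊ : ℝ) * (b w + EW ℙ V p w))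
      (fun w hw => mul_nonneg (by positivity) (hl w hw)) hz
    simp only [mul_add, Finset.sum_add_distrib] at hsl
    have h1 : (1:ℝ) ≤ (⌊(q:ℝ) * g z⌋₊ : ℝ) := by exact_mod_cast hq z hz
    have h2 := le_mul_of_one_le_left (hl z hz) h1
    have h3 := c.EW_nonneg (c.sub hz)
    have h4 := le_abs_self (C0 ℙ R V p u * R'.card - q * s + 1 + ∑ z ∈ R', (⌊(q:ℝ) * g z⌋₊ : ℝ) * EW ℙ V p z)
    change b z ≤ C1
    rw [mul_add] at h2
    linarith⟩
  refine ⟨B, hB, ?_⟩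
  have hfin : ∀ q : ℕ, ∑ z ∈ R', (⌊(q:ℝ) * g z⌋₊ : ℝ) * ∫ ω, B ω 0 z ∂ℙ ≤ C0 ℙ R V p u * R'.card - q * s + 1 := fun q =>
    hcl (fun z => (⌊(q:ℝ) * g z⌋₊ : ℝ)) _ (fun z => by positivity) ((tendsto_add_atTop_nat 1).eventually (hQ q))
  have t1 : Tendsto (fun q : ℕ => ∑ z ∈ R', ((⌊(q:ℝ) * g z⌋₊ : ℝ) / q) * ∫ ω, B ω 0 z ∂ℙ) atTop (𝓝 (∑ z ∈ R', g z * ∫ ω, B ω 0 z ∂ℙ)) := by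
    refine tendsto_finsetSum _ fun z _ => Tendsto.mul_const _ ?_
    have := (tendsto_nat_floor_mul_div_atTop (hg z).le).comp (tendsto_natCast_atTop_atTop (R := ℝ))
    refine this.congr fun q => ?_
    simp [mul_comm]
  have t2 : Tendsto (fun q : ℕ => (C0 ℙ R V p u * R'.card + 1) * (q:ℝ)⁻¹ + -s) atTop (𝓝 (-s)) := by
    have := ((tendsto_inv_atTop_nhds_zero_nat (𝕜 := ℝ)).const_mul (C0 ℙ R V p u * R'.card + 1)).add_const (-s)
    simpa using this
  refine le_of_tendsto_of_tendsto t1 t2 ?_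
  filter_upwards [eventually_ge_atTop 1] with q hq
  have hq0 : (0:ℝ) < q := by exact_mod_cast hq
  have h := mul_le_mul_of_nonneg_left (hfin q) (inv_nonneg.2 hq0.le)
  calc _ = (q:ℝ)⁻¹ * ∑ z ∈ R', (⌊(q:ℝ) * g z⌋₊ : ℝ) * ∫ ω, B ω 0 z ∂ℙ := by
        rw [Finset.mul_sum]
        refine Finset.sum_congr rfl fun z _ => ?_
        rw [div_eq_inv_mul, mul_assoc]
    _ ≤ _ := h
    _ = _ := by field_simp; ring

theorem Ctx.main (hg : ∀ z, 0 < g z) (hξ : ∑ z ∈ R', g z • toR z = ξ)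
    (hs : ∀ x : ℕ → Zd d, (∀ n, x n ∈ Gp R') → Tendsto (fun n : ℕ => (n : ℝ)⁻¹ • toR (x n)) atTop (𝓝 ξ) →
      ∀ᵐ ω ∂ℙ, Tendsto (fun n : ℕ => aFun T V p R ω 0 (x n) / n) atTop (𝓝 s))
    {γ : Zd d → ℝ} (hγ : ∀ z, 0 ≤ γ z) (hγξ : ∑ z ∈ R', γ z • toR z = ξ) :
    IsGreatest {v : ℝ | ∃ B : Ω → Zd d → Zd d → ℝ, InKplus ℙ T V p R' B ∧
        v = - ∑ z ∈ R', γ z * ∫ ω, B ω 0 z ∂ℙ} s := by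
  have hp1 : ∀ B, InKplus ℙ T V p R' B → ∀ δ : Zd d → ℝ, (∀ z, 0 ≤ δ z) → ∑ z ∈ R', δ z • toR z = ξ →
      - ∑ z ∈ R', δ z * ∫ ω, B ω 0 z ∂ℙ ≤ s := by
    intro B hB δ hδ hδξ
    refine c.part1 hB hδ ?_
    exact hs (fun n => xh R' δ n) (fun n => ⟨_, rfl⟩) (by simpa using xh_lim hδ hδξ 0)
  obtain ⟨B, hB, hBs⟩ := c.exists_B hg hξ hs
  refine ⟨⟨B, hB, ?_⟩, ?_⟩
  · refine le_antisymm ?_ (hp1 B hB γ hγ hγξ)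
    obtain ⟨t, ht, htb⟩ : ∃ t : ℝ, 0 < t ∧ ∀ z ∈ R', 0 ≤ g z + t * (g z - γ z) := by
      have : ∀ᶠ t : ℝ in 𝓝[>] 0, ∀ z ∈ R', 0 ≤ g z + t * (g z - γ z) := by
        refine (Finset.eventually_all _).2 fun z _ => ?_
        have hc : Tendsto (fun t : ℝ => g z + t * (g z - γ z)) (𝓝 0) (𝓝 (g z)) := by
          have : Continuous fun t : ℝ => g z + t * (g z - γ z) := by fun_prop
          simpa using this.tendsto 0
        exact (hc.mono_left nhdsWithin_le_nhds).eventually_const_le (hg z) 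
      obtain ⟨t, h1, h2⟩ := (this.and self_mem_nhdsWithin).exists
      exact ⟨t, h2, h1⟩
    have hm : ∀ z ∈ R', max (g z + t * (g z - γ z)) 0 = (1 + t) * g z - t * γ z := fun z hz => by
      rw [max_eq_left (htb z hz)]; ring
    have h1 := hp1 B hB (fun z => max (g z + t * (g z - γ z)) 0) (fun z => le_max_right _ _) (by
      rw [Finset.sum_congr rfl fun z hz => by rw [hm z hz]]
      simp only [sub_smul, mul_smul, Finset.sum_sub_distrib, ← Finset.smul_sum]
      rw [hξ, hγξ, ← sub_smul]
      simp)
    rw [Finset.sum_congr rfl fun z hz => by rw [hm z hz]] at h1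
    simp only [sub_mul, mul_assoc, Finset.sum_sub_distrib, ← Finset.mul_sum] at h1
    set X := ∑ z ∈ R', g z * ∫ ω, B ω 0 z ∂ℙ
    set Y := ∑ z ∈ R', γ z * ∫ ω, B ω 0 z ∂ℙ
    have : t * Y ≤ t * (-s) := by nlinarith
    have := le_of_mul_le_mul_left this ht
    linarith
  · rintro v ⟨B', hB', rfl⟩
    exact hp1 B' hB' γ hγ hγξ

end ctx
end RWRP

open RWRP in
/-- the cocycle variational formula, with attainment, in the ergodic case. -/
theorem statement4
    {d : ℕ} {Ω : Type*} [MeasurableSpace Ω]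
    (ℙ : Measure Ω) [IsProbabilityMeasure ℙ]
    (T : Zd d → Ω → Ω) (R : Finset (Zd d)) (V : Ω → Zd d → ℝ) (p : Zd d → ℝ)
    (hset : Setting ℙ T R V p)
    (hV1 : VplusL1 ℙ V R)
    (U₀ : Set (Fin d → ℝ)) (hU₀ : IsZeroFace R U₀)
    (hi : AssumptionI ℙ V R U₀)
    (A : Set (Fin d → ℝ)) (hA : IsFace (Cp R) A) (hAne : A ≠ {0})
    (R' : Finset (Zd d)) (hR' : ∀ z, z ∈ R' ↔ z ∈ R ∧ toR z ∈ A)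
    (hL : ∀ z ∈ R', z ≠ 0 → classL ℙ T (fun ω => max (V ω z) 0) z R')
    (hL0 : ∃ zh ∈ R', zh ≠ 0 ∧ classL ℙ T (fun ω => max (V ω 0) 0) zh R')
    (herg : ErgodicUnder ℙ T {z | z ∈ R ∧ toR z ∈ A})
    (α : (Fin d → ℝ) → ℝ)
    (hα : ∀ ξ ∈ intrinsicInterior ℝ A, ∀ x : ℕ → Zd d,
      (∀ n, x n ∈ Gp R ∧ toR (x n) ∈ A) →
      Tendsto (fun n : ℕ => (n : ℝ)⁻¹ • toR (x n)) atTop (𝓝 ξ) →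
      ∀ᵐ ω ∂ℙ, Tendsto (fun n : ℕ => aFun T V p R ω 0 (x n) / n) atTop (𝓝 (α ξ))) :
    ∀ ξ ∈ intrinsicInterior ℝ A, ∀ γ : Zd d → ℝ,
      (∀ z, 0 ≤ γ z) → (∑ z ∈ R', γ z • toR z = ξ) →
      IsGreatest {v : ℝ | ∃ B : Ω → Zd d → Zd d → ℝ, InKplus ℙ T V p R' B ∧
        v = - ∑ z ∈ R', γ z * ∫ ω, B ω 0 z ∂ℙ} (α ξ) := by
  intro ξ hξ γ hγ hγξ
  obtain ⟨u, hu⟩ := exists_u ℙ V R U₀ hU₀ hi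
  obtain ⟨_, hT0, hTa, hmp, _, hmV, hp, hps⟩ := hset
  have h0 : (0 : Fin d → ℝ) ∈ A := face_zero hA (intrinsicInterior_subset hξ)
  have c : Ctx ℙ T R V p R' u :=
    { T0 := hT0
      Tadd := hTa
      mp := hmp
      mV := hmV
      ppos := fun z hz => (hp z hz).1
      ple := fun z hz => (hp z hz).2.le
      psum := hps
      sub := fun z hz => ((hR' z).1 hz).1
      hV1 := hV1
      hu := hu
      step := fun y z hy hz hyz => Gp_step hA hR' h0 hy hz hyz }
  obtain ⟨g, hg, hgξ⟩ := exists_pos_rep hA hR' hξ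
  exact c.main hg hgξ (fun x hx hl => hα ξ hξ x (fun n => Gp_face' hA hR' h0 (hx n)) hl) hγ hγξ
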